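/- arXiv:1904.06545 — 2 statements merged into one kernel-verified Lean document; each statement's English description precedes it below -/
import Mathlib

section
/- Let n ≥ 7 be a natural number and let p > 3 be a prime. Then cd^{ext}_{p'}(A_n) has at least 3 elements; that is, there are at least three distinct natural numbers d not divisible by p such that A_n has an irreducible complex character of degree d extending to S_n. -/
open CategoryTheory

/-- `cd^{ext}_{p'}(A_n)`: the set of degrees `d` not divisible by `p` of irreducible complex
characters of the alternating group `A_n` that extend to (i.e. are restrictions of characters
of) the symmetric group `S_n`. -/
def cdExtp' (n p : ℕ) : Set ℕ :=
  {d : ℕ | ¬ p ∣ d ∧ ∃ V : FDRep ℂ (alternatingGroup (Fin n)), Simple V ∧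
    Module.finrank ℂ V = d ∧
    ∃ W : FDRep ℂ (Equiv.Perm (Fin n)),
      ∀ g : alternatingGroup (Fin n), W.character (g : Equiv.Perm (Fin n)) = V.character g}


set_option linter.unusedSectionVars false

lemma trace_sub_quot {V : Type*} [AddCommGroup V] [Module ℂ V] [FiniteDimensional ℂ V]
    (p : Submodule ℂ V) (f : V →ₗ[ℂ] V) (hf : ∀ x ∈ p, f x ∈ p) :
    LinearMap.trace ℂ V f = LinearMap.trace ℂ p (f.restrict hf)
      + LinearMap.trace ℂ (V ⧸ p) (p.mapQ p f hf) := by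
  obtain ⟨s, hs⟩ := p.mkQ.exists_rightInverse_of_surjective (by simp)
  have hs' : ∀ y, p.mkQ (s y) = y := fun y => LinearMap.congr_fun hs y
  let r : V →ₗ[ℂ] p := LinearMap.codRestrict p (LinearMap.id - s ∘ₗ p.mkQ) (by
    intro x
    rw [← Submodule.Quotient.mk_eq_zero]
    have := hs' (p.mkQ x)
    simp only [Submodule.mkQ_apply] at this
    simp [this])
  have hid : f = (f ∘ₗ p.subtype) ∘ₗ r + (f ∘ₗ s) ∘ₗ p.mkQ := by
    ext x
    simp [r]
  have h1 : r ∘ₗ (f ∘ₗ p.subtype) = f.restrict hf := by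
    ext x
    have : p.mkQ (f x) = 0 := by simpa using hf x x.2
    simp only [Submodule.mkQ_apply] at this
    simp [r, this]
  have h2 : p.mkQ ∘ₗ (f ∘ₗ s) = p.mapQ p f hf := by
    apply LinearMap.ext
    intro y
    obtain ⟨x, rfl⟩ := p.mkQ_surjective y
    have h3 : p.mapQ p f hf (p.mkQ (s (p.mkQ x))) = p.mkQ (f (s (p.mkQ x))) := by simp
    rw [hs'] at h3
    rw [h3]; rfl
  conv_lhs => rw [hid]
  rw [map_add, LinearMap.trace_comp_comm', LinearMap.trace_comp_comm' p.mkQ, h1, h2]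

variable {G : Type} [Group G]

/-- `χ` is the character of a representation. -/
def IsCh (χ : G → ℂ) : Prop := ∃ V : FDRep ℂ G, V.character = χ

lemma isCh_of {V : Type} [AddCommGroup V] [Module ℂ V] [FiniteDimensional ℂ V]
    (ρ : Representation ℂ G V) : IsCh (fun g => LinearMap.trace ℂ V (ρ g)) :=
  ⟨FDRep.of ρ, rfl⟩

lemma IsCh.add {a b : G → ℂ} (ha : IsCh a) (hb : IsCh b) : IsCh (fun g => a g + b g) := by
  obtain ⟨A, rfl⟩ := ha
  obtain ⟨B, rfl⟩ := hb
  have := isCh_of (Representation.prod (G := G) (k := ℂ) (V := A) (W := B) A.ρ B.ρ)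
  convert this using 2 with g
  exact (LinearMap.trace_prodMap' _ _).symm

lemma IsCh.mul {a b : G → ℂ} (ha : IsCh a) (hb : IsCh b) : IsCh (fun g => a g * b g) := by
  obtain ⟨A, rfl⟩ := ha
  obtain ⟨B, rfl⟩ := hb
  have := isCh_of (Representation.tprod (G := G) (k := ℂ) (V := A) (W := B) A.ρ B.ρ)
  convert this using 2 with g
  exact (LinearMap.trace_tensorProduct' _ _).symm

lemma isCh_one : IsCh (fun _ : G => (1 : ℂ)) := by
  have := isCh_of (Representation.trivial ℂ G ℂ)
  convert this using 2 with g
  exact (by simp : (1 : ℂ) = LinearMap.trace ℂ ℂ (LinearMap.id))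

lemma isCh_nat (k : ℕ) : IsCh (fun _ : G => (k : ℂ)) := by
  induction k with
  | zero =>
    have := isCh_of (Representation.trivial ℂ G PUnit)
    convert this using 2 with g
    simp only [Nat.cast_zero]
    exact (by simp : (0 : ℂ) = LinearMap.trace ℂ PUnit (LinearMap.id))
  | succ k ih => simpa using ih.add isCh_one

lemma isCh_idem {V : Type} [AddCommGroup V] [Module ℂ V] [FiniteDimensional ℂ V]
    (ρ : Representation ℂ G V) (e : V →ₗ[ℂ] V) (he : e * e = e) (hc : ∀ g, ρ g * e = e * ρ g) :
    IsCh (fun g => LinearMap.trace ℂ V (ρ g * e)) := by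
  have he' : ∀ x, e (e x) = e x := fun x => LinearMap.congr_fun he x
  have hc' : ∀ g x, ρ g (e x) = e (ρ g x) := fun g x => LinearMap.congr_fun (hc g) x
  have hinv : ∀ g, ∀ x ∈ LinearMap.range e, ρ g x ∈ LinearMap.range e := by
    rintro g _ ⟨y, rfl⟩
    exact ⟨ρ g y, (hc' g y).symm⟩
  let σ : Representation ℂ G (LinearMap.range e) :=
    { toFun := fun g => (ρ g).restrict (hinv g)
      map_one' := by ext x; simp
      map_mul' := by intro g h; ext x; simp }
  have := isCh_of σ
  convert this using 2 with g
  have h1 : ρ g * e = (ρ g ∘ₗ (LinearMap.range e).subtype) ∘ₗ e.rangeRestrict := by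
    ext x; rfl
  rw [h1, LinearMap.trace_comp_comm']
  congr 1
  ext ⟨_, y, rfl⟩
  simp [σ, hc', he']

lemma reduce_step (A B : FDRep ℂ G) (T : A ⟶ B) (hT : T ≠ 0) :
    ∃ A' B' : FDRep ℂ G, Module.finrank ℂ A' < Module.finrank ℂ A ∧
      ∀ g, A'.character g - B'.character g = A.character g - B.character g := by
  let t : A →ₗ[ℂ] B := T.hom.hom.hom
  have ht : ∀ g x, t (A.ρ g x) = B.ρ g (t x) := by
    intro g x
    have := T.comm g
    exact ConcreteCategory.congr_hom this x
  have ht0 : t ≠ 0 := by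
    intro h
    apply hT
    ext x
    exact LinearMap.congr_fun h x
  have hk : ∀ g, ∀ x ∈ LinearMap.ker t, A.ρ g x ∈ LinearMap.ker t := by
    intro g x hx
    simp only [LinearMap.mem_ker] at hx ⊢
    rw [ht, hx, map_zero]
  have hr : ∀ g, ∀ x ∈ LinearMap.range t, B.ρ g x ∈ LinearMap.range t := by
    rintro g _ ⟨x, rfl⟩
    exact ⟨A.ρ g x, ht g x⟩
  let α : Representation ℂ G (LinearMap.ker t) :=
    { toFun := fun g => (A.ρ g).restrict (hk g)
      map_one' := by ext x; simp
      map_mul' := by intro g h; ext x; simp }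
  let β : Representation ℂ G (B ⧸ LinearMap.range t) :=
    { toFun := fun g => (LinearMap.range t).mapQ _ (B.ρ g) (hr g)
      map_one' := by ext x; simp
      map_mul' := by intro g h; ext x; simp }
  refine ⟨FDRep.of α, FDRep.of β, ?_, ?_⟩
  · apply Submodule.finrank_lt
    intro h
    exact ht0 (LinearMap.ker_eq_top.mp h)
  · intro g
    have h1 := trace_sub_quot _ (A.ρ g) (hk g)
    have h2 := trace_sub_quot _ (B.ρ g) (hr g)
    have h3 := LinearMap.trace_conj' ((LinearMap.ker t).mapQ _ (A.ρ g) (hk g)) t.quotKerEquivRange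
    have h4 : t.quotKerEquivRange.conj ((LinearMap.ker t).mapQ _ (A.ρ g) (hk g))
        = (B.ρ g).restrict (hr g) := by
      ext ⟨_, y, rfl⟩
      have : t.quotKerEquivRange.symm ⟨t y, y, rfl⟩ = Submodule.Quotient.mk y := by
        rw [LinearEquiv.symm_apply_eq]; rfl
      rw [LinearEquiv.conj_apply_apply, this]
      simp [ht]
    rw [h4] at h3
    change LinearMap.trace ℂ _ ((A.ρ g).restrict (hk g)) -
      LinearMap.trace ℂ _ ((LinearMap.range t).mapQ _ (B.ρ g) (hr g)) =
      LinearMap.trace ℂ A (A.ρ g) - LinearMap.trace ℂ B (B.ρ g)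
    rw [h1, h2, h3]
    ring

lemma reduce_all (A B : FDRep ℂ G) :
    ∃ A' B' : FDRep ℂ G, (∀ T : A' ⟶ B', T = 0) ∧
      ∀ g, A'.character g - B'.character g = A.character g - B.character g := by
  induction hm : Module.finrank ℂ A using Nat.strong_induction_on generalizing A B with
  | _ m ih =>
    by_cases h : ∀ T : A ⟶ B, T = 0
    · exact ⟨A, B, h, fun _ => rfl⟩
    · push Not at h
      obtain ⟨T, hT⟩ := h
      obtain ⟨A1, B1, h1, h2⟩ := reduce_step A B T hT
      obtain ⟨A2, B2, h3, h4⟩ := ih _ (hm ▸ h1) A1 B1 rfl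
      exact ⟨A2, B2, h3, fun g => (h4 g).trans (h2 g)⟩

lemma finrank_end_zero (A : FDRep ℂ G) (h : Module.finrank ℂ (A ⟶ A) = 0) :
    Module.finrank ℂ A = 0 := by
  have : Subsingleton (A ⟶ A) := Module.finrank_zero_iff.mp h
  have h1 : 𝟙 A = 0 := Subsingleton.elim _ _
  have : Subsingleton A := by
    refine ⟨fun x y => ?_⟩
    have key : ∀ z : A, z = 0 := fun z => by
      have := congrArg (fun T : A ⟶ A => (T.hom.hom.hom : A →ₗ[ℂ] A) z) h1
      exact this
    rw [key x, key y]
  exact Module.finrank_zero_of_subsingleton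

lemma exists_irr [Fintype G] (a b : G → ℂ) (ha : IsCh a) (hb : IsCh b) (d : ℕ) (hd : 0 < d)
    (h1 : a 1 - b 1 = d)
    (hnorm : ∑ g, (a g - b g) * (a g⁻¹ - b g⁻¹) = Nat.card G) :
    IsCh (fun g => a g - b g) := by
  obtain ⟨A0, rfl⟩ := ha
  obtain ⟨B0, rfl⟩ := hb
  obtain ⟨A, B, hAB, hch⟩ := reduce_all A0 B0
  simp_rw [← hch] at h1 hnorm ⊢
  have hcard : (Nat.card G : ℂ) ≠ 0 := by simp
  have := invertibleOfNonzero hcard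
  have e1 := FDRep.scalar_product_char_eq_finrank_equivariant A A
  have e2 := FDRep.scalar_product_char_eq_finrank_equivariant B B
  have e3 := FDRep.scalar_product_char_eq_finrank_equivariant A B
  have hsub : Subsingleton (A ⟶ B) := ⟨fun x y => by rw [hAB x, hAB y]⟩
  rw [Module.finrank_zero_of_subsingleton (M := A ⟶ B)] at e3
  have e3' : ∑ g, B.character g * A.character g⁻¹ = 0 := by
    simpa [hcard] using e3
  have e4 : ∑ g, A.character g * B.character g⁻¹ = 0 := by
    rw [← e3', ← Equiv.sum_comp (Equiv.inv G)]
    refine Finset.sum_congr rfl fun g _ => ?_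
    simp [mul_comm]
  have hexp : ∑ g, (A.character g - B.character g) * (A.character g⁻¹ - B.character g⁻¹)
      = ∑ g, A.character g * A.character g⁻¹ + ∑ g, B.character g * B.character g⁻¹
        - ∑ g, B.character g * A.character g⁻¹ - ∑ g, A.character g * B.character g⁻¹ := by
    rw [← Finset.sum_add_distrib, ← Finset.sum_sub_distrib, ← Finset.sum_sub_distrib]
    exact Finset.sum_congr rfl fun g _ => by ring
  rw [hnorm, e3', e4] at hexp
  have hsum : (Module.finrank ℂ (A ⟶ A) : ℂ) + Module.finrank ℂ (B ⟶ B) = 1 := by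
    rw [← e1, ← e2, ← mul_add]
    rw [show ∑ g, A.character g * A.character g⁻¹ + ∑ g, B.character g * B.character g⁻¹
      = (Nat.card G : ℂ) by rw [hexp]; ring]
    exact inv_mul_cancel₀ hcard
  have hsum' : Module.finrank ℂ (A ⟶ A) + Module.finrank ℂ (B ⟶ B) = 1 := by
    exact_mod_cast hsum
  rw [FDRep.char_one, FDRep.char_one] at h1
  by_cases hA : Module.finrank ℂ (A ⟶ A) = 0
  · exfalso
    rw [finrank_end_zero A hA] at h1
    have : (d : ℂ) + Module.finrank ℂ B = 0 := by rw [← h1]; simp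
    have : d + Module.finrank ℂ B = 0 := by exact_mod_cast this
    omega
  · have hB : Module.finrank ℂ B = 0 := finrank_end_zero B (by omega)
    have : Subsingleton B := Module.finrank_zero_iff.mp hB
    refine ⟨A, funext fun g => ?_⟩
    have : B.ρ g = 0 := by ext x; exact Subsingleton.elim _ _
    simp [FDRep.character, this]

/-- number of fixed points of `g ^ k`. -/
def fx {X : Type} [Fintype X] [DecidableEq X] [MulAction G X] (k : ℕ) (g : G) : ℕ :=
  Fintype.card {x : X // g ^ k • x = x}

lemma fx_inv {X : Type} [Fintype X] [DecidableEq X] [MulAction G X] (k : ℕ) (g : G) :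
    fx (X := X) k g⁻¹ = fx (X := X) k g := by
  unfold fx
  apply Fintype.card_congr
  apply Equiv.subtypeEquivRight
  intro x
  rw [inv_pow, inv_smul_eq_iff, eq_comm]

/-- permutation operator -/
def pop {Y : Type} (τ : Equiv.Perm Y) : (Y → ℂ) →ₗ[ℂ] (Y → ℂ) := LinearMap.funLeft ℂ ℂ τ

lemma pop_mul {Y : Type} (a b : Equiv.Perm Y) : pop a * pop b = pop (b * a) := by
  ext φ y; rfl

lemma pop_one {Y : Type} : pop (1 : Equiv.Perm Y) = 1 := by
  ext φ y; rfl

lemma trace_pop {Y : Type} [Fintype Y] [DecidableEq Y] (τ : Equiv.Perm Y) :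
    LinearMap.trace ℂ (Y → ℂ) (pop τ) = Fintype.card {y // τ y = y} := by
  rw [LinearMap.trace_eq_matrix_trace ℂ (Pi.basisFun ℂ Y), Matrix.trace, Fintype.card_subtype]
  simp [pop, LinearMap.funLeft_apply, Pi.single_apply]

/-- permutation representation -/
def prep (Y : Type) [MulAction G Y] : Representation ℂ G (Y → ℂ) where
  toFun g := pop (MulAction.toPerm g⁻¹)
  map_one' := by ext φ y; simp [pop, LinearMap.funLeft_apply]
  map_mul' g h := by ext φ y; simp [pop, LinearMap.funLeft_apply, mul_smul]

section
variable {X : Type} [Fintype X] [DecidableEq X] [MulAction G X]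

lemma isCh_fix : IsCh (fun g : G => (fx (X := X) 1 g : ℂ)) := by
  have := isCh_of (prep (G := G) X)
  convert this using 2 with g
  rw [← fx_inv]
  change _ = LinearMap.trace ℂ _ (pop _)
  rw [trace_pop]
  simp [fx]

lemma card_pair (g : G) :
    Fintype.card {y : X × X // (MulAction.toPerm g : Equiv.Perm (X × X)) y = y}
      = fx (X := X) 1 g ^ 2 := by
  rw [pow_two]
  unfold fx
  rw [← Fintype.card_prod]
  apply Fintype.card_congr
  refine ⟨fun y => (⟨y.1.1, ?_⟩, ⟨y.1.2, ?_⟩), fun z => ⟨(z.1.1, z.2.1), ?_⟩, ?_, ?_⟩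
  · have := y.2; simpa using congrArg Prod.fst this
  · have := y.2; simpa using congrArg Prod.snd this
  · have h1 := z.1.2
    have h2 := z.2.2
    simp only [pow_one] at h1 h2
    ext <;> simp [h1, h2]
  · intro y; rfl
  · intro z; rfl

lemma card_pair_swap (g : G) :
    Fintype.card {y : X × X // (Equiv.prodComm X X * (MulAction.toPerm g : Equiv.Perm (X × X))) y = y}
      = fx (X := X) 2 g := by
  unfold fx
  apply Fintype.card_congr
  refine ⟨fun y => ⟨y.1.1, ?_⟩, fun z => ⟨(z.1, g • z.1), ?_⟩, ?_, ?_⟩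
  · obtain ⟨⟨a, b⟩, h⟩ := y
    simp at h
    simp [pow_two, mul_smul, h]
  · have h1 := z.2
    simp only [pow_two, mul_smul] at h1
    ext <;> simp [h1]
  · rintro ⟨⟨a, b⟩, h⟩
    simp at h
    simp [h]
  · intro z; rfl

lemma isCh_two (ε : ℂ) (hε : ε * ε = 1) :
    IsCh (fun g : G => ((fx (X := X) 1 g : ℂ) ^ 2 + ε * fx (X := X) 2 g) / 2) := by
  let c : Equiv.Perm (X × X) := Equiv.prodComm X X
  have hcc : c * c = 1 := by ext <;> rfl
  have := isCh_idem (prep (G := G) (X × X)) ((1/2 : ℂ) • (1 + ε • pop c)) ?_ ?_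
  · convert this using 2 with g
    change _ = LinearMap.trace ℂ _ (pop (MulAction.toPerm g⁻¹) * _)
    rw [← fx_inv, ← fx_inv 2]
    rw [mul_smul_comm, mul_add, mul_one, mul_smul_comm, pop_mul, map_smul, map_add, map_smul,
      trace_pop, trace_pop, card_pair, card_pair_swap]
    simp only [smul_eq_mul]
    push_cast
    ring
  · have h : (pop c * pop c : (X × X → ℂ) →ₗ[ℂ] _) = 1 := by rw [pop_mul, hcc, pop_one]
    simp only [smul_mul_smul_comm, mul_add, add_mul, one_mul, mul_one, h, hε]
    module
  · intro g
    change pop (MulAction.toPerm g⁻¹) * _ = _ * pop (MulAction.toPerm g⁻¹)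
    simp only [smul_mul_assoc, mul_smul_comm, mul_add, add_mul, one_mul, mul_one, pop_mul]
    congr 3

/-- rotation of triples -/
def rot (X : Type) : Equiv.Perm (X × X × X) where
  toFun y := (y.2.1, y.2.2, y.1)
  invFun y := (y.2.2, y.1, y.2.1)
  left_inv _ := rfl
  right_inv _ := rfl

lemma card_triple (g : G) :
    Fintype.card {y : X × X × X // (MulAction.toPerm g : Equiv.Perm (X × X × X)) y = y}
      = fx (X := X) 1 g ^ 3 := by
  rw [pow_succ', ← card_pair]
  unfold fx
  rw [← Fintype.card_prod]
  apply Fintype.card_congr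
  refine ⟨fun y => (⟨y.1.1, ?_⟩, ⟨y.1.2, ?_⟩), fun z => ⟨(z.1.1, z.2.1), ?_⟩, ?_, ?_⟩
  · have := y.2; simpa using congrArg Prod.fst this
  · have := y.2; exact congrArg Prod.snd this
  · have h1 := z.1.2
    have h2 := z.2.2
    simp only [pow_one] at h1
    exact Prod.ext h1 h2
  · intro y; rfl
  · intro z; rfl

lemma card_triple_rot (g : G) :
    Fintype.card {y : X × X × X // (rot X * (MulAction.toPerm g : Equiv.Perm (X × X × X))) y = y}
      = fx (X := X) 3 g := by
  unfold fx
  apply Fintype.card_congr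
  refine ⟨fun y => ⟨y.1.1, ?_⟩, fun z => ⟨(z.1, g • g • z.1, g • z.1), ?_⟩, ?_, ?_⟩
  · obtain ⟨⟨a, b, c⟩, h⟩ := y
    simp [rot] at h
    simp [pow_succ, mul_smul, h]
  · have h1 := z.2
    simp only [pow_succ, pow_zero, one_mul, mul_smul] at h1
    simp [rot, h1]
  · rintro ⟨⟨a, b, c⟩, h⟩
    simp [rot] at h
    simp [h]
  · intro z; rfl

lemma card_triple_rot2 (g : G) :
    Fintype.card {y : X × X × X //
      (rot X * rot X * (MulAction.toPerm g : Equiv.Perm (X × X × X))) y = y}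
      = fx (X := X) 3 g := by
  unfold fx
  apply Fintype.card_congr
  refine ⟨fun y => ⟨y.1.1, ?_⟩, fun z => ⟨(z.1, g • z.1, g • g • z.1), ?_⟩, ?_, ?_⟩
  · obtain ⟨⟨a, b, c⟩, h⟩ := y
    simp [rot] at h
    simp [pow_succ, mul_smul, h]
  · have h1 := z.2
    simp only [pow_succ, pow_zero, one_mul, mul_smul] at h1
    simp [rot, h1]
  · rintro ⟨⟨a, b, c⟩, h⟩
    simp [rot] at h
    simp [h]
  · intro z; rfl

lemma exists_omega : ∃ ω : ℂ, 1 + ω + ω ^ 2 = 0 := by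
  have h := Complex.isPrimitiveRoot_exp 3 (by norm_num)
  have := h.geom_sum_eq_zero (by norm_num)
  rw [Finset.sum_range_succ, Finset.sum_range_succ, Finset.sum_range_one, pow_zero, pow_one] at this
  exact ⟨_, this⟩

lemma isCh_three :
    IsCh (fun g : G => ((fx (X := X) 1 g : ℂ) ^ 3 - fx (X := X) 3 g) / 3) := by
  obtain ⟨ω, hω⟩ := exists_omega
  let c : Equiv.Perm (X × X × X) := rot X
  have hcc : c * c * c = 1 := by ext <;> rfl
  have := isCh_idem (prep (G := G) (X × X × X))
    ((1/3 : ℂ) • (1 + ω • pop c + (ω ^ 2) • pop (c * c))) ?_ ?_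
  · convert this using 2 with g
    change _ = LinearMap.trace ℂ _ (pop (MulAction.toPerm g⁻¹) * _)
    rw [← fx_inv, ← fx_inv 3]
    rw [mul_smul_comm, mul_add, mul_add, mul_one, mul_smul_comm, mul_smul_comm, pop_mul, pop_mul,
      map_smul, map_add, map_add, map_smul, map_smul,
      trace_pop, trace_pop, trace_pop, card_triple, card_triple_rot, card_triple_rot2]
    simp only [smul_eq_mul]
    push_cast
    linear_combination (-(fx (X := X) 3 g⁻¹ : ℂ) / 3) * hω
  · have h1 : (pop c * pop (c * c) : (X × X × X → ℂ) →ₗ[ℂ] _) = 1 := by rw [pop_mul, hcc, pop_one]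
    have h2 : (pop (c * c) * pop c : (X × X × X → ℂ) →ₗ[ℂ] _) = 1 := by
      rw [pop_mul, ← mul_assoc, hcc, pop_one]
    have h3 : (pop (c * c) * pop (c * c) : (X × X × X → ℂ) →ₗ[ℂ] _) = pop c := by
      rw [pop_mul, ← mul_assoc, hcc, one_mul]
    have h4 : (pop c * pop c : (X × X × X → ℂ) →ₗ[ℂ] _) = pop (c * c) := by
      rw [pop_mul]
    have hω3 : ω ^ 3 = 1 := by linear_combination (ω - 1) * hω
    have e1 : ω * ω ^ 2 = 1 := by rw [← hω3]; ring
    have e2 : ω ^ 2 * ω = 1 := by rw [← hω3]; ring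
    have e3 : ω ^ 2 * ω ^ 2 = ω := by linear_combination ω * hω3
    have e4 : ω * ω = ω ^ 2 := by ring
    simp only [smul_mul_smul_comm, mul_add, add_mul, one_mul, mul_one, h1, h2, h3, h4, e1, e2, e3, e4]
    module
  · intro g
    change pop (MulAction.toPerm g⁻¹) * _ = _ * pop (MulAction.toPerm g⁻¹)
    simp only [smul_mul_assoc, mul_smul_comm, mul_add, add_mul, one_mul, mul_one, pop_mul]
    congr 3

end

section moments
variable {X : Type} [Fintype X] [DecidableEq X] [MulAction G X]

/-- multiple transitivity up to `K`. -/
def MTrans (G X : Type) [Group G] [Fintype X] [MulAction G X] (K : ℕ) : Prop :=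
  K ≤ Fintype.card X ∧ ∀ e e' : Fin K ↪ X, ∃ g : G, ∀ i, g • e i = e' i

lemma MTrans.emb {K : ℕ} (h : MTrans G X K) {ι : Type} [Fintype ι] (hι : Fintype.card ι ≤ K)
    (e e' : ι ↪ X) : ∃ g : G, ∀ i, g • e i = e' i := by
  have : MulAction.IsMultiplyPretransitive G X K := by
    refine ⟨fun a b => ?_⟩
    obtain ⟨g, hg⟩ := h.2 a b
    exact ⟨g, by ext i; exact hg i⟩
  have h2 : MulAction.IsMultiplyPretransitive G X (Fintype.card ι) :=
    MulAction.isMultiplyPretransitive_of_le hι (by rw [Nat.card_eq_fintype_card]; exact h.1)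
  let q := (Fintype.equivFin ι).symm
  obtain ⟨g, hg⟩ := h2.exists_smul_eq (q.toEmbedding.trans e) (q.toEmbedding.trans e')
  refine ⟨g, fun i => ?_⟩
  have := DFunLike.congr_fun hg (q.symm i)
  simpa using this

lemma moment [Fintype G] [DecidableEq G] {K : ℕ} (h : MTrans G X K) (ι : Type) [Fintype ι] [DecidableEq ι]
    (hι : Fintype.card ι ≤ K) (σ : Equiv.Perm ι) :
    ∑ g : G, Nat.card {e : ι ↪ X // ∀ i, g • e i = e (σ i)} = Fintype.card G := by
  simp only [Nat.card_eq_fintype_card]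
  have hne : Nonempty (ι ↪ X) := Function.Embedding.nonempty_of_card_le (hι.trans h.1)
  obtain ⟨e0⟩ := hne
  have hc : ∀ e e' : ι ↪ X, Fintype.card {g : G // ∀ i, g • e i = e' i}
      = Fintype.card {g : G // ∀ i, g • e0 i = e0 i} := by
    intro e e'
    obtain ⟨a, ha⟩ := h.emb hι e0 e
    obtain ⟨b, hb⟩ := h.emb hι e0 e'
    apply Fintype.card_congr
    refine (Equiv.subtypeEquiv ((Equiv.mulLeft b⁻¹).trans (Equiv.mulRight a)) ?_)
    intro g
    apply forall_congr'
    intro i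
    simp [mul_smul, ha, ← hb, inv_smul_eq_iff]
  have h1 : ∑ g : G, Fintype.card {e : ι ↪ X // ∀ i, g • e i = e (σ i)}
      = ∑ e : ι ↪ X, Fintype.card {g : G // ∀ i, g • e i = (σ.toEmbedding.trans e) i} := by
    simp only [Fintype.card_subtype, Finset.card_filter]
    rw [Finset.sum_comm]
    rfl
  have h2 : ∑ e' : ι ↪ X, Fintype.card {g : G // ∀ i, g • e0 i = e' i} = Fintype.card G := by
    rw [← Fintype.card_sigma]
    apply Fintype.card_congr
    refine ⟨fun z => z.2.1, fun g => ⟨⟨fun i => g • e0 i, ?_⟩, g, fun i => rfl⟩, ?_, ?_⟩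
    · intro i j hij
      exact e0.injective (MulAction.injective g hij)
    · rintro ⟨e', g, hg⟩
      obtain rfl : e' = ⟨fun i => g • e0 i, fun i j hij =>
        e0.injective (MulAction.injective g hij)⟩ := by
        ext i; exact (hg i).symm
      rfl
    · intro g; rfl
  rw [h1, ← h2]
  simp only [hc]

/-- Embedded cycles of length `m` of `g`. -/
abbrev Cyc (X : Type) [MulAction G X] (m : ℕ) [NeZero m] (g : G) : Type :=
  {e : Fin m ↪ X // ∀ i, g • e i = e (i + 1)}

/-- number of embedded cycles -/
noncomputable def cyc (X : Type) [Fintype X] [DecidableEq X] [MulAction G X] (m : ℕ) [NeZero m] (g : G) : ℕ :=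
  Nat.card (Cyc X m g)

lemma card_fixemb (k : ℕ) (g : G) :
    Nat.card {e : Fin k ↪ X // ∀ i, g • e i = e i} = (fx (X := X) 1 g).descFactorial k := by
  have : Nat.card (Fin k ↪ {x : X // g ^ 1 • x = x}) = (fx (X := X) 1 g).descFactorial k := by
    rw [Nat.card_eq_fintype_card, Fintype.card_embedding_eq, Fintype.card_fin]; rfl
  rw [← this]
  apply Nat.card_congr
  refine ⟨fun e => ⟨fun i => ⟨e.1 i, by simpa using e.2 i⟩, ?_⟩,
    fun e => ⟨e.trans (Function.Embedding.subtype _), fun i => by simpa using (e i).2⟩, ?_, ?_⟩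
  · intro i j hij
    exact e.1.injective (congrArg Subtype.val hij)
  · intro e; rfl
  · intro e; rfl

lemma m1 [Fintype G] [DecidableEq G] {K : ℕ} (h : MTrans G X K) (k : ℕ) (hk : k ≤ K) :
    ∑ g : G, (fx (X := X) 1 g).descFactorial k = Fintype.card G := by
  rw [← moment h (Fin k) (by simpa using hk) 1]
  refine Finset.sum_congr rfl fun g _ => ?_
  rw [← card_fixemb]; rfl

lemma card_sum {α β : Type} [Fintype α] [DecidableEq α] [Fintype β] [DecidableEq β]
    (σ : Equiv.Perm α) (τ : Equiv.Perm β) (g : G) :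
    Nat.card {e : α ⊕ β ↪ X // ∀ i, g • e i = e (Equiv.sumCongr σ τ i)}
     = Nat.card {z : {e : α ↪ X // ∀ i, g • e i = e (σ i)} ×
        {e : β ↪ X // ∀ i, g • e i = e (τ i)} // ∀ i j, z.1.1 i ≠ z.2.1 j} := by
  apply Nat.card_congr
  refine ⟨fun e => ⟨(⟨Function.Embedding.inl.trans e.1, ?_⟩,
      ⟨Function.Embedding.inr.trans e.1, ?_⟩), ?_⟩,
    fun z => ⟨⟨Sum.elim z.1.1.1 z.1.2.1, ?_⟩, ?_⟩, ?_, ?_⟩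
  · intro i; exact e.2 (Sum.inl i)
  · intro i; exact e.2 (Sum.inr i)
  · intro i j hij
    have := e.1.injective hij
    cases this
  · exact Function.Injective.sumElim z.1.1.1.injective z.1.2.1.injective z.2
  · rintro (i | i)
    · exact z.1.1.2 i
    · exact z.1.2.2 i
  · rintro e
    ext (i | i) <;> rfl
  · rintro z; rfl

lemma m2 [Fintype G] [DecidableEq G] {K : ℕ} (h : MTrans G X K) (k m : ℕ) [NeZero m] (hm : 2 ≤ m) (hk : k + m ≤ K) :
    ∑ g : G, (fx (X := X) 1 g).descFactorial k * cyc X m g = Fintype.card G := by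
  rw [← moment h (Fin k ⊕ Fin m) (by simpa using hk) (Equiv.sumCongr 1 (Equiv.addRight 1))]
  refine Finset.sum_congr rfl fun g _ => ?_
  rw [card_sum, ← card_fixemb, cyc, ← Nat.card_prod]
  symm
  apply Nat.card_congr
  refine (Equiv.subtypeUnivEquiv ?_)
  rintro ⟨e1, e2⟩ i j hij
  simp only at hij
  have h1 : g • e1.1 i = e1.1 i := e1.2 i
  have h2 : g • e2.1 j = e2.1 (j + 1) := e2.2 j
  rw [← hij, h1, hij] at h2
  have h3 := e2.1.injective h2
  have : Nontrivial (Fin m) := Fin.nontrivial_iff_two_le.mpr hm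
  simp at h3
  omega

open scoped Fin.NatCast Fin.CommRing in
lemma cyc_shift {m : ℕ} [NeZero m] {g : G} (e1 e2 : Cyc X m g) (i j : Fin m)
    (hij : e1.1 i = e2.1 j) (r : Fin m) : e2.1 r = e1.1 (r + (i - j)) := by
  have key : ∀ k : ℕ, e2.1 (j + k) = e1.1 (i + k) := by
    intro k
    induction k with
    | zero => simpa using hij.symm
    | succ k ih =>
      have h1 := e1.2 (i + k)
      have h2 := e2.2 (j + k)
      rw [ih, h1] at h2
      push_cast
      rw [← add_assoc, ← add_assoc, h2]
  have := key (r - j).val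
  simp only [Fin.cast_val_eq_self] at this
  rw [show j + (r - j) = r by abel, show i + (r - j) = r + (i - j) by abel] at this
  exact this

open scoped Fin.CommRing in
lemma cyc_sq (m : ℕ) [NeZero m] (g : G) :
    cyc X m g * cyc X m g = Nat.card {e : Fin m ⊕ Fin m ↪ X // ∀ i, g • e i =
      e (Equiv.sumCongr (Equiv.addRight 1) (Equiv.addRight 1) i)} + m * cyc X m g := by
  rw [card_sum, cyc, ← Nat.card_prod]
  rw [← Nat.card_congr (Equiv.sumCompl
    (fun z : Cyc X m g × Cyc X m g => ∀ i j, z.1.1 i ≠ z.2.1 j)), Nat.card_sum]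
  congr 1
  have : m * Nat.card (Cyc X m g) = Nat.card (Fin m × Cyc X m g) := by
    rw [Nat.card_prod, Nat.card_fin]
  rw [this]
  symm
  let F : Fin m × Cyc X m g →
      {z : Cyc X m g × Cyc X m g // ¬ ∀ i j, z.1.1 i ≠ z.2.1 j} := fun w =>
    ⟨(w.2, ⟨(Equiv.addRight w.1).toEmbedding.trans w.2.1, fun i => by
      have := w.2.2 (i + w.1)
      simp only [Function.Embedding.trans_apply, Equiv.coe_toEmbedding, Equiv.coe_addRight]
      rw [this]
      congr 1
      abel⟩), fun hh => hh w.1 0 (by simp)⟩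
  apply Nat.card_eq_of_bijective F
  constructor
  · rintro ⟨d, e⟩ ⟨d', e'⟩ hh
    have h1 : e = e' := congrArg (fun z => z.1.1) hh
    subst h1
    have h2 := congrArg (fun z => z.1.2.1 0) hh
    have h3 : e.1 (0 + d) = e.1 (0 + d') := h2
    have h4 := e.1.injective h3
    simp only [zero_add] at h4
    rw [h4]
  · rintro ⟨⟨e1, e2⟩, hz⟩
    push Not at hz
    obtain ⟨i, j, hij⟩ := hz
    refine ⟨(i - j, e1), ?_⟩
    apply Subtype.ext
    refine Prod.ext rfl ?_
    apply Subtype.ext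
    ext r
    exact (cyc_shift e1 e2 i j hij r).symm

lemma m3 [Fintype G] [DecidableEq G] {K : ℕ} (h : MTrans G X K) (m : ℕ) [NeZero m] (hm : 2 ≤ m) (hk : m + m ≤ K) :
    ∑ g : G, cyc X m g * cyc X m g = (1 + m) * Fintype.card G := by
  simp_rw [cyc_sq]
  rw [Finset.sum_add_distrib, moment h _ (by simpa using hk), ← Finset.mul_sum]
  have := m2 h 0 m hm (by omega)
  simp only [Nat.descFactorial_zero, one_mul] at this
  rw [this]; ring

lemma fx_two (g : G) : fx (X := X) 2 g = fx (X := X) 1 g + cyc X 2 g := by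
  have h1 : cyc X 2 g = Fintype.card {x : {x : X // g ^ 2 • x = x} // ¬ g • x.1 = x.1} := by
    unfold cyc
    rw [← Nat.card_eq_fintype_card]
    apply Nat.card_congr
    refine ⟨fun e => ⟨⟨e.1 0, ?_⟩, ?_⟩, fun x => ⟨⟨![x.1.1, g • x.1.1], ?_⟩, ?_⟩, ?_, ?_⟩
    · rw [pow_two, mul_smul, e.2, e.2]; rfl
    · simp only [e.2]
      intro hh
      have := e.1.injective hh
      simp at this
    · obtain ⟨⟨x, h1⟩, h2⟩ := x
      intro i j hij
      fin_cases i <;> fin_cases j <;> simp_all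
      exact h2 hij.symm
    · obtain ⟨⟨x, h1⟩, h2⟩ := x
      rw [pow_two, mul_smul] at h1
      intro i
      fin_cases i <;> simp [h1]
    · intro e
      ext i
      have := e.2 0
      fin_cases i <;> simp_all
    · intro x; rfl
  have h2 : fx (X := X) 1 g = Fintype.card {x : {x : X // g ^ 2 • x = x} // g • x.1 = x.1} := by
    unfold fx
    apply Fintype.card_congr
    refine ⟨fun x => ⟨⟨x.1, ?_⟩, ?_⟩, fun x => ⟨x.1.1, ?_⟩, ?_, ?_⟩
    · have := x.2; simp only [pow_one] at this; simp [pow_succ, mul_smul, this]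
    · simpa using x.2
    · simpa using x.2
    · intro x; rfl
    · intro x; rfl
  rw [h1, h2, ← Fintype.card_sum]
  exact (Fintype.card_congr (Equiv.sumCompl _)).symm

lemma fx_three (g : G) : fx (X := X) 3 g = fx (X := X) 1 g + cyc X 3 g := by
  have h1 : cyc X 3 g = Fintype.card {x : {x : X // g ^ 3 • x = x} // ¬ g • x.1 = x.1} := by
    unfold cyc
    rw [← Nat.card_eq_fintype_card]
    apply Nat.card_congr
    refine ⟨fun e => ⟨⟨e.1 0, ?_⟩, ?_⟩, fun x => ⟨⟨![x.1.1, g • x.1.1, g • g • x.1.1], ?_⟩, ?_⟩, ?_, ?_⟩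
    · rw [pow_succ, pow_two, mul_smul, mul_smul, e.2, e.2, e.2]; rfl
    · simp only [e.2]
      intro hh
      have := e.1.injective hh
      simp at this
    · obtain ⟨⟨x, h1⟩, h2⟩ := x
      simp only [pow_succ, pow_zero, one_mul, mul_smul] at h1
      simp only at h2
      have h3 : g • g • x ≠ x := by
        intro h3
        rw [h3] at h1
        exact h2 h1
      have h4 : g • g • x ≠ g • x := by
        intro h4
        exact h2 (MulAction.injective g h4)
      intro i j hij
      fin_cases i <;> fin_cases j <;> simp at hij ⊢
      all_goals first | exact h2 hij | exact h3 hij | exact h4 hij | exact h2 hij.symm | exact h3 hij.symm | exact h4 hij.symm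
    · obtain ⟨⟨x, h1⟩, h2⟩ := x
      simp only [pow_succ, pow_zero, one_mul, mul_smul] at h1
      intro i
      fin_cases i <;> simp [h1]
    · intro e
      have h0 := e.2 0
      have h1 := e.2 1
      have h2 : (1 : Fin 3) + 1 = 2 := rfl
      rw [h2] at h1
      simp only [zero_add] at h0
      ext i
      fin_cases i <;> simp [h0, h1]
    · intro x; rfl
  have h2 : fx (X := X) 1 g = Fintype.card {x : {x : X // g ^ 3 • x = x} // g • x.1 = x.1} := by
    unfold fx
    apply Fintype.card_congr
    refine ⟨fun x => ⟨⟨x.1, ?_⟩, ?_⟩, fun x => ⟨x.1.1, ?_⟩, ?_, ?_⟩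
    · have := x.2; simp only [pow_one] at this; simp [pow_succ, mul_smul, this]
    · simpa using x.2
    · simpa using x.2
    · intro x; rfl
    · intro x; rfl
  rw [h1, h2, ← Fintype.card_sum]
  exact (Fintype.card_congr (Equiv.sumCompl _)).symm

end moments

section norms
variable {X : Type} [Fintype X] [DecidableEq X] [MulAction G X] [Fintype G] [DecidableEq G]

lemma cast_desc (n k : ℕ) :
    ((n.descFactorial (k + 1) : ℕ) : ℂ) = ((n : ℂ) - k) * (n.descFactorial k : ℕ) := by
  rw [Nat.descFactorial_succ]
  push_cast
  by_cases h : k ≤ n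
  · rw [Nat.cast_sub h]
  · rw [Nat.descFactorial_eq_zero_iff_lt.mpr (by omega)]; simp

lemma c1 {K : ℕ} (h : MTrans G X K) (k : ℕ) (hk : k ≤ K) :
    ∑ g : G, (((fx (X := X) 1 g).descFactorial k : ℕ) : ℂ) = Nat.card G := by
  rw [Nat.card_eq_fintype_card, ← m1 h k hk]; push_cast; rfl

lemma c2 {K : ℕ} (h : MTrans G X K) (k m : ℕ) [NeZero m] (hm : 2 ≤ m) (hk : k + m ≤ K) :
    ∑ g : G, (((fx (X := X) 1 g).descFactorial k : ℕ) : ℂ) * (cyc X m g : ℂ) = Nat.card G := by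
  rw [Nat.card_eq_fintype_card, ← m2 h k m hm hk]; push_cast; rfl

lemma c3 {K : ℕ} (h : MTrans G X K) (m : ℕ) [NeZero m] (hm : 2 ≤ m) (hk : m + m ≤ K) :
    ∑ g : G, (cyc X m g : ℂ) * (cyc X m g : ℂ) = (1 + m) * Nat.card G := by
  rw [Nat.card_eq_fintype_card]; exact_mod_cast m3 h m hm hk

lemma norm1 {K : ℕ} (h : MTrans G X K) (hK : 2 ≤ K) :
    ∑ g : G, ((fx (X := X) 1 g : ℂ) - 1) * ((fx (X := X) 1 g⁻¹ : ℂ) - 1) = Nat.card G := by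
  have e0 := c1 h 0 (by omega)
  have e1 := c1 h 1 (by omega)
  have e2 := c1 h 2 (by omega)
  calc _ = ∑ g : G, ((((fx (X := X) 1 g).descFactorial 2 : ℕ) : ℂ)
        - (((fx (X := X) 1 g).descFactorial 1 : ℕ) : ℂ)
        + (((fx (X := X) 1 g).descFactorial 0 : ℕ) : ℂ)) := by
        refine Finset.sum_congr rfl fun g _ => ?_
        rw [fx_inv]
        simp only [cast_desc, Nat.descFactorial_zero]
        push_cast
        ring
    _ = _ := by
        rw [Finset.sum_add_distrib, Finset.sum_sub_distrib, e0, e1, e2]; ring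

lemma norm23 {K : ℕ} (h : MTrans G X K) (hK : 4 ≤ K) (ε : ℂ) (hε : ε = 1 ∨ ε = -1)
    (F : G → ℂ)
    (hF : ∀ g, F g = ((fx (X := X) 1 g : ℂ) ^ 2 + ε * fx (X := X) 2 g) / 2
      + (1 - ε) / 2 - (3 + ε) / 2 * fx (X := X) 1 g) :
    ∑ g : G, F g * F g⁻¹ = Nat.card G := by
  have e0 := c1 h 0 (by omega)
  have e1 := c1 h 1 (by omega)
  have e2 := c1 h 2 (by omega)
  have e3 := c1 h 3 (by omega)
  have e4 := c1 h 4 (by omega)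
  have d0 := c2 h 0 2 le_rfl (by omega)
  have d1 := c2 h 1 2 le_rfl (by omega)
  have d2 := c2 h 2 2 le_rfl (by omega)
  have s := c3 h 2 le_rfl (by omega)
  have hε2 : ε * ε = 1 := by rcases hε with rfl | rfl <;> norm_num
  let D : ℕ → G → ℂ := fun k g => (((fx (X := X) 1 g).descFactorial k : ℕ) : ℂ)
  calc _ = ∑ g : G, ((1/4) * D 4 g + 0 * D 3 g - (ε / 2) * D 2 g
        + ε * D 1 g + (1/2) * (1 - ε) * D 0 g
        + (ε/2) * (D 2 g * (cyc X 2 g : ℂ)) - ε * (D 1 g * (cyc X 2 g : ℂ))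
        + (ε - 1)/2 * (D 0 g * (cyc X 2 g : ℂ)) + (1/4) * ((cyc X 2 g : ℂ) * (cyc X 2 g : ℂ))) := by
        refine Finset.sum_congr rfl fun g _ => ?_
        rw [hF, hF, fx_inv, fx_inv, fx_two]
        simp only [D, cast_desc, Nat.descFactorial_zero]
        push_cast
        rcases hε with rfl | rfl <;> ring
    _ = _ := by
        simp only [Finset.sum_add_distrib, Finset.sum_sub_distrib, ← Finset.mul_sum, D, e0, e1, e2,
          e3, e4, d0, d1, d2, s]
        push_cast
        ring

lemma norm4 {K : ℕ} (h : MTrans G X K) (hK : 6 ≤ K)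
    (F : G → ℂ)
    (hF : ∀ g, F g = ((fx (X := X) 1 g : ℂ) ^ 3 - fx (X := X) 3 g) / 3
      + 3 * fx (X := X) 1 g - 2 * fx (X := X) 1 g * fx (X := X) 1 g) :
    ∑ g : G, F g * F g⁻¹ = Nat.card G := by
  have e0 := c1 h 0 (by omega)
  have e1 := c1 h 1 (by omega)
  have e2 := c1 h 2 (by omega)
  have e3 := c1 h 3 (by omega)
  have e4 := c1 h 4 (by omega)
  have e5 := c1 h 5 (by omega)
  have e6 := c1 h 6 (by omega)
  have d1 := c2 h 1 3 (by omega) (by omega)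
  have d2 := c2 h 2 3 (by omega) (by omega)
  have d3 := c2 h 3 3 (by omega) (by omega)
  have s := c3 h 3 (by omega) (by omega)
  let D : ℕ → G → ℂ := fun k g => (((fx (X := X) 1 g).descFactorial k : ℕ) : ℂ)
  calc _ = ∑ g : G, (1/9) * (D 6 g + 3 * D 5 g + 9 * D 1 g - 9 * D 2 g + 6 * D 3 g - 3 * D 4 g
        - 2 * (D 3 g * (cyc X 3 g : ℂ)) + 6 * (D 2 g * (cyc X 3 g : ℂ))
        - 6 * (D 1 g * (cyc X 3 g : ℂ)) + (cyc X 3 g : ℂ) * (cyc X 3 g : ℂ)) := by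
        refine Finset.sum_congr rfl fun g _ => ?_
        rw [hF, hF, fx_inv, fx_inv, fx_three]
        simp only [D, cast_desc, Nat.descFactorial_zero]
        push_cast
        ring
    _ = _ := by
        simp only [Finset.sum_add_distrib, Finset.sum_sub_distrib, ← Finset.mul_sum, D, e0, e1, e2,
          e3, e4, e5, e6, d1, d2, d3, s]
        push_cast
        ring
end norms

lemma fx_one (n k : ℕ) : fx (X := Fin n) k (1 : Equiv.Perm (Fin n)) = n := by
  simp [fx]

lemma fx_coe (n k : ℕ) (g : alternatingGroup (Fin n)) :
    fx (X := Fin n) k (g : Equiv.Perm (Fin n)) = fx (X := Fin n) k g := by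
  unfold fx
  apply Fintype.card_congr
  apply Equiv.subtypeEquivRight
  intro x
  rw [Subgroup.smul_def]
  simp

lemma mtrans_perm (n : ℕ) : MTrans (Equiv.Perm (Fin n)) (Fin n) (n - 2) := by
  refine ⟨by simp, fun e e' => ?_⟩
  obtain ⟨g, hg⟩ := (Equiv.Perm.isMultiplyPretransitive (Fin n) (n - 2)).exists_smul_eq e e'
  exact ⟨g, fun i => DFunLike.congr_fun hg i⟩

lemma mtrans_alt (n : ℕ) : MTrans (alternatingGroup (Fin n)) (Fin n) (n - 2) := by
  refine ⟨by simp, fun e e' => ?_⟩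
  have h := alternatingGroup.isMultiplyPretransitive (Fin n)
  rw [Nat.card_eq_fintype_card, Fintype.card_fin] at h
  obtain ⟨g, hg⟩ := h.exists_smul_eq e e'
  exact ⟨g, fun i => DFunLike.congr_fun hg i⟩

lemma mem_cd (n p d : ℕ) (a b : Equiv.Perm (Fin n) → ℂ) (ha : IsCh a) (hb : IsCh b)
    (hd : 0 < d) (h1 : a 1 - b 1 = d)
    (hS : ∑ g, (a g - b g) * (a g⁻¹ - b g⁻¹) = Nat.card (Equiv.Perm (Fin n)))
    (hA : ∑ g : alternatingGroup (Fin n), (a g - b g) * (a (g⁻¹ : alternatingGroup (Fin n))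
      - b (g⁻¹ : alternatingGroup (Fin n))) = Nat.card (alternatingGroup (Fin n)))
    (hp : ¬ p ∣ d) : d ∈ cdExtp' n p := by
  obtain ⟨W, hW⟩ := exists_irr a b ha hb d hd h1 hS
  have hW' : ∀ g, W.character g = a g - b g := fun g => congrFun hW g
  let V : FDRep ℂ (alternatingGroup (Fin n)) :=
    FDRep.of (V := W) (W.ρ.comp (alternatingGroup (Fin n)).subtype)
  have hV : ∀ g : alternatingGroup (Fin n), V.character g = W.character g := fun g => rfl
  refine ⟨hp, V, ?_, ?_, W, fun g => (hV g).symm⟩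
  · rw [FDRep.simple_iff_char_is_norm_one, ← hA]
    refine Finset.sum_congr rfl fun g _ => ?_
    rw [hV, hV, hW', hW']
  · have : ((Module.finrank ℂ V : ℕ) : ℂ) = d := by
      rw [← FDRep.char_one, hV, hW', ← h1]; rfl
    exact_mod_cast this

lemma mem_triv (n p : ℕ) (hp : p.Prime) : 1 ∈ cdExtp' n p := by
  refine mem_cd n p 1 _ _ isCh_one (isCh_nat 0) one_pos (by simp) (by simp) (by simp) ?_
  exact fun h => hp.one_lt.ne' (Nat.dvd_one.mp h)

lemma mem_std (n p d : ℕ) (hn : 7 ≤ n) (hd : d + 1 = n) (hp : ¬ p ∣ d) : d ∈ cdExtp' n p := by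
  refine mem_cd n p d _ _ (isCh_fix (X := Fin n)) isCh_one (by omega) ?_ ?_ ?_ hp
  · rw [fx_one, ← hd]; push_cast; ring
  · exact norm1 (mtrans_perm n) (by omega)
  · simp only [fx_coe]
    exact norm1 (mtrans_alt n) (by omega)

lemma mem_two (n p d : ℕ) (hn : 7 ≤ n) (hd : 2 * d + 3 * n = n * n) (hp : ¬ p ∣ d) :
    d ∈ cdExtp' n p := by
  refine mem_cd n p d _ _ (isCh_two (X := Fin n) 1 (by norm_num))
    ((isCh_nat 2).mul (isCh_fix (X := Fin n))) (by nlinarith) ?_ ?_ ?_ hp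
  · have : (2 * d + 3 * n : ℂ) = n * n := by exact_mod_cast hd
    simp only [fx_one]; push_cast; linear_combination (-1/2 : ℂ) * this
  · refine norm23 (mtrans_perm n) (by omega) 1 (Or.inl rfl)
      (fun g => ((fx (X := Fin n) 1 g : ℂ) ^ 2 + 1 * fx (X := Fin n) 2 g) / 2
        - ((2 : ℕ) : ℂ) * fx (X := Fin n) 1 g) ?_
    intro g; push_cast; ring
  · simp only [fx_coe]
    refine norm23 (mtrans_alt n) (by omega) 1 (Or.inl rfl)
      (fun g => ((fx (X := Fin n) 1 g : ℂ) ^ 2 + 1 * fx (X := Fin n) 2 g) / 2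
        - ((2 : ℕ) : ℂ) * fx (X := Fin n) 1 g) ?_
    intro g; push_cast; ring

lemma mem_wedge (n p d : ℕ) (hn : 7 ≤ n) (hd : 2 * d + 3 * n = n * n + 2) (hp : ¬ p ∣ d) :
    d ∈ cdExtp' n p := by
  refine mem_cd n p d _ _ ((isCh_two (X := Fin n) (-1) (by norm_num)).add isCh_one)
    (isCh_fix (X := Fin n)) (by nlinarith) ?_ ?_ ?_ hp
  · have : (2 * d + 3 * n : ℂ) = n * n + 2 := by exact_mod_cast hd
    simp only [fx_one]; linear_combination (-1/2 : ℂ) * this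
  · refine norm23 (mtrans_perm n) (by omega) (-1) (Or.inr rfl)
      (fun g => ((fx (X := Fin n) 1 g : ℂ) ^ 2 + (-1) * fx (X := Fin n) 2 g) / 2 + 1
        - fx (X := Fin n) 1 g) ?_
    intro g; ring
  · simp only [fx_coe]
    refine norm23 (mtrans_alt n) (by omega) (-1) (Or.inr rfl)
      (fun g => ((fx (X := Fin n) 1 g : ℂ) ^ 2 + (-1) * fx (X := Fin n) 2 g) / 2 + 1
        - fx (X := Fin n) 1 g) ?_
    intro g; ring

lemma mem_three (n p d : ℕ) (hn : 8 ≤ n) (hd0 : 0 < d) (hd : 3 * d + 6 * n ^ 2 = n ^ 3 + 8 * n)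
    (hp : ¬ p ∣ d) : d ∈ cdExtp' n p := by
  refine mem_cd n p d _ _ ((isCh_three (X := Fin n)).add ((isCh_nat 3).mul (isCh_fix (X := Fin n))))
    (((isCh_nat 2).mul (isCh_fix (X := Fin n))).mul (isCh_fix (X := Fin n))) hd0 ?_ ?_ ?_ hp
  · have : (3 * d + 6 * n ^ 2 : ℂ) = n ^ 3 + 8 * n := by exact_mod_cast hd
    simp only [fx_one]; push_cast; linear_combination (-1/3 : ℂ) * this
  · refine norm4 (mtrans_perm n) (by omega)
      (fun g => ((fx (X := Fin n) 1 g : ℂ) ^ 3 - fx (X := Fin n) 3 g) / 3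
        + ((3 : ℕ) : ℂ) * fx (X := Fin n) 1 g
        - ((2 : ℕ) : ℂ) * fx (X := Fin n) 1 g * fx (X := Fin n) 1 g) ?_
    intro g; push_cast; ring
  · simp only [fx_coe]
    refine norm4 (mtrans_alt n) (by omega)
      (fun g => ((fx (X := Fin n) 1 g : ℂ) ^ 3 - fx (X := Fin n) 3 g) / 3
        + ((3 : ℕ) : ℂ) * fx (X := Fin n) 1 g
        - ((2 : ℕ) : ℂ) * fx (X := Fin n) 1 g * fx (X := Fin n) 1 g) ?_
    intro g; push_cast; ring

theorem stmt9 (n : ℕ) (hn : 7 ≤ n) (p : ℕ) (hp : p.Prime) (hp3 : 3 < p) :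
    ∃ d₁ d₂ d₃ : ℕ, d₁ ≠ d₂ ∧ d₁ ≠ d₃ ∧ d₂ ≠ d₃ ∧
      d₁ ∈ cdExtp' n p ∧ d₂ ∈ cdExtp' n p ∧ d₃ ∈ cdExtp' n p := by
  obtain ⟨m, rfl⟩ : ∃ m, n = m + 1 := ⟨n - 1, by omega⟩
  have hsmall : ∀ k : ℕ, 0 < k → k ≤ 3 → ¬ p ∣ k := fun k h0 h3 h => by
    have := Nat.le_of_dvd h0 h; omega
  -- the degree `n (n - 3) / 2`
  obtain ⟨a, ha⟩ : ∃ a, 2 * a + 2 = m * (m - 1) := by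
    obtain ⟨r, hr⟩ : 2 ∣ m * (m - 1) := (Nat.even_mul_pred_self m).two_dvd
    have : 0 < m * (m - 1) := Nat.mul_pos (by omega) (by omega)
    exact ⟨r - 1, by omega⟩
  obtain ⟨q, rfl⟩ : ∃ q, m = q + 1 := ⟨m - 1, by omega⟩
  simp only [Nat.add_sub_cancel] at ha
  have ha2 : 2 * a + 3 * (q + 1 + 1) = (q + 1 + 1) * (q + 1 + 1) := by nlinarith
  have hw2 : 2 * (a + 1) + 3 * (q + 1 + 1) = (q + 1 + 1) * (q + 1 + 1) + 2 := by nlinarith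
  have hq : 5 ≤ q := by omega
  have ha3 : q + 1 < a := by nlinarith
  by_cases hm : p ∣ q + 1
  · -- `n ≡ 1`
    have hq6 : 6 ≤ q := by
      rcases Nat.lt_or_ge q 6 with h | h
      · have : q = 5 := by omega
        subst this
        have h6 : p ∣ 2 * 3 := hm
        rcases (Nat.Prime.dvd_mul hp).mp h6 with h | h
        · exact absurd h (hsmall 2 (by omega) (by omega))
        · exact absurd h (hsmall 3 (by omega) (by omega))
      · exact h
    obtain ⟨b, hb⟩ : ∃ b, 3 * b = (q + 2) * q * (q - 2) := by
      have : 3 ∣ (q + 2) * q * (q - 2) := by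
        obtain ⟨r, rfl⟩ : ∃ r, q = r + 2 := ⟨q - 2, by omega⟩
        simp only [Nat.add_sub_cancel]
        have h3 : r % 3 = 0 ∨ r % 3 = 1 ∨ r % 3 = 2 := by omega
        rcases h3 with h | h | h <;> simp [Nat.dvd_iff_mod_eq_zero, Nat.mul_mod, Nat.add_mod, h]
      obtain ⟨b, hb⟩ := this
      exact ⟨b, hb.symm⟩
    obtain ⟨r, rfl⟩ : ∃ r, q = r + 2 := ⟨q - 2, by omega⟩
    simp only [Nat.add_sub_cancel] at hb
    have hab : a < b := by nlinarith
    have hbd : 3 * b + 6 * (r + 2 + 1 + 1) ^ 2 = (r + 2 + 1 + 1) ^ 3 + 8 * (r + 2 + 1 + 1) := by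
      rw [hb]; ring
    have hpa : ¬ p ∣ a := by
      intro h
      have h1 : p ∣ 2 * a + 2 := ha ▸ Dvd.dvd.mul_right hm _
      exact hsmall 2 (by omega) (by omega) ((Nat.dvd_add_right (Dvd.dvd.mul_left h 2)).mp h1)
    have hpb : ¬ p ∣ b := by
      intro h
      have h1 : p ∣ (r + 2 + 2) * (r + 2) * r := hb ▸ Dvd.dvd.mul_left h 3
      rcases (Nat.Prime.dvd_mul hp).mp h1 with h2 | h2
      · rcases (Nat.Prime.dvd_mul hp).mp h2 with h3 | h3
        · exact hsmall 1 (by omega) (by omega)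
            ((Nat.dvd_add_right hm).mp (by convert h3 using 1))
        · exact hsmall 1 (by omega) (by omega)
            ((Nat.dvd_add_right h3).mp (by convert hm using 1))
      · exact hsmall 3 (by omega) (by omega)
            ((Nat.dvd_add_right h2).mp (by convert hm using 1))
    exact ⟨1, a, b, by omega, by omega, by omega, mem_triv _ _ hp,
      mem_two _ p a hn ha2 hpa, mem_three _ p b (by omega) (by omega) hbd hpb⟩
  · have hstd := mem_std (q + 1 + 1) p (q + 1) hn rfl hm
    by_cases hpa : p ∣ a
    · have hpa1 : ¬ p ∣ a + 1 := fun h =>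
        hsmall 1 (by omega) (by omega) ((Nat.dvd_add_right hpa).mp h)
      exact ⟨1, q + 1, a + 1, by omega, by omega, by omega, mem_triv _ _ hp, hstd,
        mem_wedge _ p (a + 1) hn hw2 hpa1⟩
    · exact ⟨1, q + 1, a, by omega, by omega, by omega, mem_triv _ _ hp, hstd,
        mem_two _ p a hn ha2 hpa⟩
end

section
/- Let p > 5 be a prime and let q = p^a for some a ≥ 1, and let S = PSL_2(q) be the quotient of SL_2(F_q) by its center, where F_q is the finite field with q elements. Then there exist irreducible complex characters χ_1 and χ_2 of S with χ_1(1) = q + 1 and χ_2(1) = q − 1 (both coprime to p), such that χ_1 extends to Aut(S) and χ_2 is invariant under every automorphism of S of p-power order. -/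
open CategoryTheory

/-- The projective special linear group `PSL_n(F_q)` with `q = p^a`, defined as
`SL_n(F_q)` modulo its center, where `F_q = GaloisField p a` is the field with `p^a` elements. -/
abbrev PSL (n p a : ℕ) [Fact p.Prime] : Type :=
  Matrix.SpecialLinearGroup (Fin n) (GaloisField p a) ⧸
    Subgroup.center (Matrix.SpecialLinearGroup (Fin n) (GaloisField p a))

open CategoryTheory

namespace Stmt12

theorem trace_add_quot {V : Type*} [AddCommGroup V] [Module ℂ V] [FiniteDimensional ℂ V]
    (W : Submodule ℂ V) (f : V →ₗ[ℂ] V) (h : W ≤ W.comap f) :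
    LinearMap.trace ℂ V f = LinearMap.trace ℂ W (f.restrict h) +
      LinearMap.trace ℂ (V ⧸ W) (W.mapQ W f h) := by
  obtain ⟨s, hs⟩ := W.mkQ.exists_rightInverse_of_surjective (by simp)
  have hs' : ∀ x, W.mkQ (s x) = x := fun x => LinearMap.congr_fun hs x
  let π : V →ₗ[ℂ] W := LinearMap.codRestrict W (LinearMap.id - s ∘ₗ W.mkQ) (by
    intro v
    rw [← Submodule.Quotient.mk_eq_zero]
    change W.mkQ (v - s (W.mkQ v)) = 0
    rw [map_sub, hs', sub_self])
  have h1 : W.subtype ∘ₗ π + s ∘ₗ W.mkQ = LinearMap.id := by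
    ext v; simp [π]
  have h2 : π ∘ₗ (f ∘ₗ W.subtype) = f.restrict h := by
    ext v
    have hv : f v ∈ W := h v.2
    have : W.mkQ (f v) = 0 := by simpa using hv
    simp only [π, LinearMap.comp_apply, LinearMap.codRestrict_apply, LinearMap.sub_apply,
      LinearMap.id_apply, Submodule.subtype_apply, this, map_zero, sub_zero, LinearMap.restrict_apply]
  have h3 : W.mkQ ∘ₗ (f ∘ₗ s) = W.mapQ W f h := by
    ext v
    have : W.mapQ W f h (W.mkQ (s (W.mkQ v))) = W.mkQ (f (s (W.mkQ v))) := rfl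
    simp only [LinearMap.comp_apply]
    rw [← this, hs']
  calc LinearMap.trace ℂ V f = LinearMap.trace ℂ V (f ∘ₗ (W.subtype ∘ₗ π + s ∘ₗ W.mkQ)) := by
        rw [h1]; rfl
    _ = _ := by
        rw [LinearMap.comp_add, map_add, ← LinearMap.comp_assoc, ← LinearMap.comp_assoc,
          LinearMap.trace_comp_comm' π, LinearMap.trace_comp_comm' W.mkQ, h2, h3]

variable {G : Type} [Group G] [Fintype G]

theorem virt : ∀ (n : ℕ) (V W : Type) [AddCommGroup V] [Module ℂ V] [FiniteDimensional ℂ V]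
    [AddCommGroup W] [Module ℂ W] [FiniteDimensional ℂ W]
    (ρ : Representation ℂ G V) (σ : Representation ℂ G W),
    Module.finrank ℂ V ≤ n →
    ∑ g : G, (ρ.character g - σ.character g) * (ρ.character g⁻¹ - σ.character g⁻¹) = Nat.card G →
    ∃ U : FDRep ℂ G, Simple U ∧ ((∀ g, U.character g = ρ.character g - σ.character g) ∨
      (∀ g, U.character g = σ.character g - ρ.character g)) := by
  intro n
  induction n with
  | zero =>
    intro V W _ _ _ _ _ _ ρ σ hn hsum
    have : Subsingleton V := Module.finrank_zero_iff.1 (Nat.le_zero.1 hn)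
    have h0 : ∀ g, ρ.character g = 0 := by
      intro g
      have : ρ g = 0 := Subsingleton.elim _ _
      simp [Representation.character, this]
    refine ⟨FDRep.of σ, ?_, Or.inr ?_⟩
    · rw [FDRep.simple_iff_char_is_norm_one, ← hsum]
      refine Finset.sum_congr rfl fun g _ => ?_
      rw [h0, h0]
      change σ.character g * σ.character g⁻¹ = _
      ring
    · intro g
      rw [h0, sub_zero]
      rfl
  | succ n ih =>
    intro V W _ _ _ _ _ _ ρ σ hn hsum
    have : Invertible (Nat.card G : ℂ) := invertibleOfNonzero (NeZero.ne (Nat.card G : ℂ))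
    by_cases hf : ∃ f : Representation.IntertwiningMap ρ σ, f ≠ 0
    · obtain ⟨f, hf⟩ := hf
      have hk : ∀ g, LinearMap.ker f.toLinearMap ≤ (LinearMap.ker f.toLinearMap).comap (ρ g) := by
        intro g v hv
        have h := Representation.IntertwiningMap.isIntertwining _ _ f g v
        have hv' : f v = 0 := hv
        change f (ρ g v) = 0
        rw [h, hv', map_zero]
      have hr : ∀ g, LinearMap.range f.toLinearMap ≤
          (LinearMap.range f.toLinearMap).comap (σ g) := by
        rintro g _ ⟨v, rfl⟩
        exact ⟨ρ g v, Representation.IntertwiningMap.isIntertwining _ _ f g v⟩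
      have key : ∀ g, ρ.character g - σ.character g =
          (ρ.subrepresentation _ hk).character g - (σ.quotient _ hr).character g := by
        intro g
        have e1 := trace_add_quot _ (ρ g) (hk g)
        have e2 := trace_add_quot _ (σ g) (hr g)
        have e3 : LinearMap.trace ℂ _ (Submodule.mapQ _ _ (ρ g) (hk g)) =
            LinearMap.trace ℂ _ ((σ g).restrict (hr g)) := by
          rw [← LinearMap.trace_conj' _ f.toLinearMap.quotKerEquivRange]
          congr 1
          ext ⟨_, v, rfl⟩
          have : f.toLinearMap.quotKerEquivRange.symm ⟨f.toLinearMap v, v, rfl⟩ =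
              Submodule.Quotient.mk v := by
            rw [LinearEquiv.symm_apply_eq]; rfl
          simp only [LinearEquiv.conj_apply, LinearMap.comp_apply, LinearEquiv.coe_coe, this]
          exact Representation.IntertwiningMap.isIntertwining _ _ f g v
        simp only [Representation.character, Representation.subrepresentation_apply,
          Representation.quotient_apply]
        rw [e1, e2, e3]; ring
      have hlt : Module.finrank ℂ (LinearMap.ker f.toLinearMap) ≤ n := by
        have : Module.finrank ℂ (LinearMap.ker f.toLinearMap) < Module.finrank ℂ V := by
          apply Submodule.finrank_lt
          intro h
          apply hf
          ext v
          have : v ∈ LinearMap.ker f.toLinearMap := by rw [h]; trivial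
          exact this
        omega
      obtain ⟨U, hU, h⟩ := ih _ _ (ρ.subrepresentation _ hk) (σ.quotient _ hr) hlt (by
        rw [← hsum]
        exact Finset.sum_congr rfl fun g _ => by rw [key, key])
      refine ⟨U, hU, h.imp (fun h g => by rw [h, key]) (fun h g => by
        rw [h]; linear_combination key g)⟩
    · push Not at hf
      have e0 : Module.finrank ℂ (Representation.IntertwiningMap ρ σ) = 0 := by
        have : Subsingleton (Representation.IntertwiningMap ρ σ) :=
          ⟨fun a b => by rw [hf a, hf b]⟩
        exact Module.finrank_zero_of_subsingleton
      have c1 := Representation.card_inv_mul_sum_char_mul_char_eq_finrank ρ σ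
      have c2 := Representation.card_inv_mul_sum_char_mul_char_eq_finrank ρ ρ
      have c3 := Representation.card_inv_mul_sum_char_mul_char_eq_finrank σ σ
      have hc : (Nat.card G : ℂ) ≠ 0 := NeZero.ne _
      rw [e0, Nat.cast_zero, mul_eq_zero, or_iff_right (inv_ne_zero hc)] at c1
      have c1' : ∑ g : G, ρ.character g * σ.character g⁻¹ = 0 := by
        rw [← c1, ← Equiv.sum_comp (Equiv.inv G)]
        exact Finset.sum_congr rfl fun g _ => by simp [mul_comm]
      rw [inv_mul_eq_iff_eq_mul₀ hc] at c2 c3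
      have hs : ∑ g : G, (ρ.character g - σ.character g) * (ρ.character g⁻¹ - σ.character g⁻¹) =
          ∑ g : G, ρ.character g * ρ.character g⁻¹ - ∑ g : G, ρ.character g * σ.character g⁻¹
          - ∑ g : G, σ.character g * ρ.character g⁻¹ + ∑ g : G, σ.character g * σ.character g⁻¹ := by
        rw [← Finset.sum_sub_distrib, ← Finset.sum_sub_distrib, ← Finset.sum_add_distrib]
        exact Finset.sum_congr rfl fun g _ => by ring
      rw [hs, c1, c1', c2, c3] at hsum
      have hn1 : Module.finrank ℂ (Representation.IntertwiningMap ρ ρ) +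
          Module.finrank ℂ (Representation.IntertwiningMap σ σ) = 1 := by
        have : (Nat.card G : ℂ) * ((Module.finrank ℂ (Representation.IntertwiningMap ρ ρ) : ℂ) +
          Module.finrank ℂ (Representation.IntertwiningMap σ σ)) = Nat.card G * 1 := by
          linear_combination hsum
        exact_mod_cast mul_left_cancel₀ hc this
      have zero_of : ∀ (X : Type) [AddCommGroup X] [Module ℂ X] [FiniteDimensional ℂ X]
          (τ : Representation ℂ G X), Module.finrank ℂ (Representation.IntertwiningMap τ τ) = 0 →
          ∀ g, τ.character g = 0 := by
        intro X _ _ _ τ h g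
        have c2 := Representation.card_inv_mul_sum_char_mul_char_eq_finrank τ τ
        have : Module.Finite ℂ (Representation.IntertwiningMap τ τ) :=
          Module.Finite.equiv (Representation.invariantsEquivIntertwiningMap τ τ)
        have := Module.finrank_zero_iff.1 h
        have hid : Representation.IntertwiningMap.id τ = 0 := Subsingleton.elim _ _
        have : τ g = 0 := by
          ext x
          have := congrArg (fun f : Representation.IntertwiningMap τ τ => f (τ g x)) hid
          simpa using this
        simp [Representation.character, this]
      rcases Nat.eq_zero_or_pos (Module.finrank ℂ (Representation.IntertwiningMap σ σ)) with h | h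
      · refine ⟨FDRep.of ρ, ?_, Or.inl ?_⟩
        · rw [FDRep.simple_iff_char_is_norm_one]
          change ∑ g : G, ρ.character g * ρ.character g⁻¹ = _
          rw [c2]
          have : Module.finrank ℂ (Representation.IntertwiningMap ρ ρ) = 1 := by omega
          rw [this]; simp
        · intro g
          rw [zero_of _ σ h, sub_zero]; rfl
      · have h' : Module.finrank ℂ (Representation.IntertwiningMap ρ ρ) = 0 := by omega
        have h'' : Module.finrank ℂ (Representation.IntertwiningMap σ σ) = 1 := by omega
        refine ⟨FDRep.of σ, ?_, Or.inr ?_⟩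
        · rw [FDRep.simple_iff_char_is_norm_one]
          change ∑ g : G, σ.character g * σ.character g⁻¹ = _
          rw [c3, h'']; simp
        · intro g
          rw [zero_of _ ρ h', sub_zero]; rfl

end Stmt12

open CategoryTheory

namespace Stmt12
set_option linter.unusedSectionVars false
section ind
variable {G : Type} [Group G] [Fintype G] {H : Type} [Group H] [Fintype H]

/-- the underlying space of the induced representation -/
def indSpace (j : H →* G) (θ : H →* ℂˣ) : Submodule ℂ (G → ℂ) where
  carrier := {f | ∀ h g, f (j h * g) = θ h * f g}
  add_mem' := by
    intro a b ha hb h g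
    simp only [Pi.add_apply, ha h g, hb h g]; ring
  zero_mem' := by intro h g; simp
  smul_mem' := by
    intro c a ha h g
    simp only [Pi.smul_apply, ha h g, smul_eq_mul]; ring

/-- right translation -/
def rtr (G : Type) [Group G] : Representation ℂ G (G → ℂ) where
  toFun g := LinearMap.funLeft ℂ ℂ (fun x => x * g)
  map_one' := by ext; simp [LinearMap.funLeft]
  map_mul' a b := by ext; simp [LinearMap.funLeft, mul_assoc]

theorem rtr_apply (g x : G) (f : G → ℂ) : rtr G g f x = f (x * g) := rfl

/-- induced representation -/
noncomputable def indRep (j : H →* G) (θ : H →* ℂˣ) : Representation ℂ G (indSpace j θ) :=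
  (rtr G).subrepresentation (indSpace j θ) (by
    intro g f hf h x
    simp only [rtr_apply, mul_assoc]
    exact hf h _)

theorem indRep_apply (j : H →* G) (θ : H →* ℂˣ) (g x : G) (f : indSpace j θ) :
  (indRep j θ g f).1 x = f.1 (x * g) := rfl

open Classical in
/-- Frobenius formula -/
noncomputable def indChar (j : H →* G) (θ : H →* ℂˣ) (g : G) : ℂ :=
  (Fintype.card H : ℂ)⁻¹ * ∑ x : G, ∑ h : H, if j h = x * g * x⁻¹ then (θ h : ℂ) else 0

/-- projection to the induced space -/
noncomputable def indProj (j : H →* G) (θ : H →* ℂˣ) : (G → ℂ) →ₗ[ℂ] indSpace j θ where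
  toFun f := ⟨fun g => (Fintype.card H : ℂ)⁻¹ * ∑ h : H, (((θ h)⁻¹ : ℂˣ) : ℂ) * f (j h * g), by
    intro k g
    rw [← mul_assoc, mul_comm (θ k : ℂ), mul_assoc, Finset.mul_sum]
    refine congrArg _ ?_
    rw [← Equiv.sum_comp (Equiv.mulRight k) (fun h => (θ k : ℂ) * ((((θ h)⁻¹ : ℂˣ) : ℂ) * f (j h * g)))]
    refine Finset.sum_congr rfl fun h _ => ?_
    simp only [Equiv.coe_mulRight, map_mul, mul_inv, Units.val_mul, mul_assoc]
    rw [mul_left_comm (((θ h)⁻¹ : ℂˣ) : ℂ), ← mul_assoc (θ k : ℂ), Units.mul_inv, one_mul]⟩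
  map_add' a b := by
    ext g
    simp [mul_add, Finset.sum_add_distrib]
  map_smul' c a := by
    ext g
    simp only [Pi.smul_apply, smul_eq_mul, RingHom.id_apply, Submodule.coe_smul, Finset.mul_sum]
    refine Finset.sum_congr rfl fun h _ => ?_
    ring

theorem indRep_character (j : H →* G) (θ : H →* ℂˣ) (g : G) :
    (indRep j θ).character g = indChar j θ g := by
  classical
  have hH : (Fintype.card H : ℂ) ≠ 0 := Nat.cast_ne_zero.2 Fintype.card_ne_zero
  have h1 : indProj j θ ∘ₗ ((rtr G g) ∘ₗ (indSpace j θ).subtype) = indRep j θ g := by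
    ext f x
    change (Fintype.card H : ℂ)⁻¹ * ∑ h : H, ((θ h)⁻¹ : ℂˣ) * f.1 (j h * x * g) = f.1 (x * g)
    have : ∀ h : H, (((θ h)⁻¹ : ℂˣ) : ℂ) * f.1 (j h * x * g) = f.1 (x * g) := by
      intro h
      rw [mul_assoc, f.2 h, ← mul_assoc, Units.inv_mul, one_mul]
    rw [Finset.sum_congr rfl fun h _ => this h]
    simp [hH]
  rw [Representation.character, ← h1, LinearMap.trace_comp_comm',
    LinearMap.trace_eq_matrix_trace ℂ (Pi.basisFun ℂ G), Matrix.trace, indChar, Finset.mul_sum]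
  refine Finset.sum_congr rfl fun x _ => ?_
  rw [Matrix.diag_apply, LinearMap.toMatrix_apply]
  simp only [Pi.basisFun_apply, Pi.basisFun_repr]
  change (Fintype.card H : ℂ)⁻¹ * ∑ h : H, ((θ h)⁻¹ : ℂˣ) * (Pi.single x 1 : G → ℂ) (j h * (x * g)) = _
  congr 1
  rw [← Equiv.sum_comp (Equiv.inv H)]
  refine Finset.sum_congr rfl fun h _ => ?_
  have : ((j h)⁻¹ * (x * g) = x) ↔ j h = x * g * x⁻¹ := by
    constructor
    · intro e
      rw [inv_mul_eq_iff_eq_mul] at e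
      rw [e]; group
    · intro e; rw [e]; group
  simp [Pi.single_apply, this]

/-- reciprocity -/
theorem indChar_sum (j : H →* G) (θ : H →* ℂˣ) (F : G → ℂ)
    (hF : ∀ x g, F (x * g * x⁻¹) = F g) :
    ∑ g, indChar j θ g * F g =
      (Fintype.card G : ℂ) * (Fintype.card H : ℂ)⁻¹ * ∑ h, θ h * F (j h) := by
  classical
  have e0 : ∀ g, indChar j θ g * F g = (Fintype.card H : ℂ)⁻¹ *
      ((∑ x : G, ∑ h : H, if j h = x * g * x⁻¹ then (θ h : ℂ) else 0) * F g) := fun g => by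
    rw [indChar, mul_assoc]
  rw [Finset.sum_congr rfl fun g _ => e0 g, ← Finset.mul_sum, mul_comm (Fintype.card G : ℂ), mul_assoc]
  congr 1
  simp only [Finset.sum_mul]
  rw [Finset.sum_comm]
  have : ∀ x : G, (∑ g : G, ∑ h : H, (if j h = x * g * x⁻¹ then (θ h : ℂ) else 0) * F g) =
      ∑ h, θ h * F (j h) := by
    intro x
    rw [Finset.sum_comm]
    refine Finset.sum_congr rfl fun h _ => ?_
    rw [Finset.sum_eq_single (x⁻¹ * j h * x)]
    · have : x⁻¹ * j h * x = x⁻¹ * j h * x⁻¹⁻¹ := by simp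
      rw [if_pos (by group), this, hF]
    · intro b _ hb
      rw [if_neg, zero_mul]
      intro e; apply hb; rw [e]; group
    · simp
  rw [Finset.sum_congr rfl fun x _ => this x]
  simp

theorem indChar_conj (j : H →* G) (θ : H →* ℂˣ) (y g : G) :
    indChar j θ (y * g * y⁻¹) = indChar j θ g := by
  rw [← indRep_character, ← indRep_character, Representation.char_conj]

/-- comparison with a quotient -/
theorem indChar_quot {S : Type} [Group S] [Fintype S] (m : G →* S) (hm : Function.Surjective m)
    (j : H →* G) (θ : H →* ℂˣ)
    (hk : ∀ k ∈ m.ker, ∃ h, j h = k ∧ θ h = 1) (g : G) :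
    indChar (m.comp j) θ (m g) = indChar j θ g := by
  classical
  have hfib : ∀ F : S → ℂ, ∑ x : G, F (m x) = Nat.card m.ker * ∑ s, F s := by
    intro F
    rw [← Finset.sum_fiberwise (s := Finset.univ) (g := m) (f := fun x => F (m x)), Finset.mul_sum]
    refine Finset.sum_congr rfl fun s _ => ?_
    rw [Finset.sum_congr rfl (g := fun _ => F s) (by
      intro x hx; rw [(Finset.mem_filter.1 hx).2])]
    rw [Finset.sum_const, nsmul_eq_mul]
    congr 2
    obtain ⟨y, rfl⟩ := hm s
    rw [Nat.card_eq_fintype_card, Fintype.card_subtype]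
    refine Finset.card_bij (fun x _ => x * y⁻¹) ?_ ?_ ?_
    · intro a ha
      simp only [Finset.mem_filter, Finset.mem_univ, true_and] at ha ⊢
      simp [MonoidHom.mem_ker, ha]
    · intro a _ b _ h; simpa using h
    · intro b hb
      simp only [Finset.mem_filter, Finset.mem_univ, true_and, MonoidHom.mem_ker] at hb
      exact ⟨b * y, by simp [hb], by simp⟩
  have hker : (Nat.card m.ker : ℂ) ≠ 0 := Nat.cast_ne_zero.2 Nat.card_pos.ne'
  unfold indChar
  congr 1
  apply mul_left_cancel₀ hker
  rw [← hfib (fun s => ∑ h : H, if (m.comp j) h = s * m g * s⁻¹ then (θ h : ℂ) else 0), Finset.mul_sum]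
  refine Finset.sum_congr rfl fun x _ => ?_
  have hsplit : ∀ h : H, (if (m.comp j) h = m x * m g * (m x)⁻¹ then (θ h : ℂ) else 0) =
      ∑ k : m.ker, if j h = k * (x * g * x⁻¹) then (θ h : ℂ) else 0 := by
    intro h
    split_ifs with e
    · have hmem : j h * (x * g * x⁻¹)⁻¹ ∈ m.ker := by
        rw [MonoidHom.mem_ker]
        simp only [MonoidHom.comp_apply] at e
        rw [map_mul, e, ← map_mul, ← map_inv, ← map_mul, ← map_mul, mul_inv_cancel, map_one]
      rw [Finset.sum_eq_single ⟨_, hmem⟩]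
      · rw [if_pos]; group
      · intro k _ hk
        rw [if_neg]
        intro e'; apply hk; ext; simp only [e']; group
      · simp
    · symm
      apply Finset.sum_eq_zero
      intro k _
      rw [if_neg]
      intro e'; apply e
      rw [MonoidHom.comp_apply, e', map_mul, MonoidHom.mem_ker.1 k.2]; simp
  simp only [hsplit]
  rw [Finset.sum_comm]
  have : ∀ k : m.ker, (∑ h : H, if j h = k * (x * g * x⁻¹) then (θ h : ℂ) else 0) =
      ∑ h : H, if j h = (x * g * x⁻¹) then (θ h : ℂ) else 0 := by
    intro k
    obtain ⟨h0, e1, e2⟩ := hk k.1 k.2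
    rw [← Equiv.sum_comp (Equiv.mulLeft h0)]
    refine Finset.sum_congr rfl fun h _ => ?_
    simp [e1, e2]
  simp [this, Nat.card_eq_fintype_card]

end ind
end Stmt12

open CategoryTheory

namespace Stmt12
set_option linter.unusedSectionVars false
section sl
variable {F : Type} [Field F]

/-- SL2 -/
abbrev SL (F : Type) [Field F] := Matrix.SpecialLinearGroup (Fin 2) F

/-- PSL2 -/
abbrev PS (F : Type) [Field F] := SL F ⧸ Subgroup.center (SL F)

/-- quotient map -/
def mkS : SL F →* PS F := QuotientGroup.mk' _

theorem mkS_surj : Function.Surjective (mkS (F := F)) := QuotientGroup.mk'_surjective _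

/-- matrix by entries -/
def mk2 (a b c d : F) (h : a * d - b * c = 1) : SL F :=
  ⟨!![a, b; c, d], by rw [Matrix.det_fin_two_of, h]⟩

theorem ext4 {g h : SL F} (h00 : g.1 0 0 = h.1 0 0) (h01 : g.1 0 1 = h.1 0 1)
    (h10 : g.1 1 0 = h.1 1 0) (h11 : g.1 1 1 = h.1 1 1) : g = h := by
  ext i j
  fin_cases i <;> fin_cases j <;> assumption

theorem det4 (g : SL F) : g.1 0 0 * g.1 1 1 - g.1 0 1 * g.1 1 0 = 1 := by
  rw [← Matrix.det_fin_two, g.2]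

section entries
variable (a b c d : F) (h : a * d - b * c = 1)
@[simp] theorem mk2_00 : (mk2 a b c d h).1 0 0 = a := rfl
@[simp] theorem mk2_01 : (mk2 a b c d h).1 0 1 = b := rfl
@[simp] theorem mk2_10 : (mk2 a b c d h).1 1 0 = c := rfl
@[simp] theorem mk2_11 : (mk2 a b c d h).1 1 1 = d := rfl
end entries
theorem mul_00 (g h : SL F) : (g * h).1 0 0 = g.1 0 0 * h.1 0 0 + g.1 0 1 * h.1 1 0 := by
  simp [Matrix.mul_apply, Fin.sum_univ_two]
theorem mul_01 (g h : SL F) : (g * h).1 0 1 = g.1 0 0 * h.1 0 1 + g.1 0 1 * h.1 1 1 := by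
  simp [Matrix.mul_apply, Fin.sum_univ_two]
theorem mul_10 (g h : SL F) : (g * h).1 1 0 = g.1 1 0 * h.1 0 0 + g.1 1 1 * h.1 1 0 := by
  simp [Matrix.mul_apply, Fin.sum_univ_two]
theorem mul_11 (g h : SL F) : (g * h).1 1 1 = g.1 1 0 * h.1 0 1 + g.1 1 1 * h.1 1 1 := by
  simp [Matrix.mul_apply, Fin.sum_univ_two]
theorem inv_00 (g : SL F) : (g⁻¹).1 0 0 = g.1 1 1 := by
  simp [Matrix.SpecialLinearGroup.coe_inv, Matrix.adjugate_fin_two]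
theorem inv_01 (g : SL F) : (g⁻¹).1 0 1 = - g.1 0 1 := by
  simp [Matrix.SpecialLinearGroup.coe_inv, Matrix.adjugate_fin_two]
theorem inv_10 (g : SL F) : (g⁻¹).1 1 0 = - g.1 1 0 := by
  simp [Matrix.SpecialLinearGroup.coe_inv, Matrix.adjugate_fin_two]
theorem inv_11 (g : SL F) : (g⁻¹).1 1 1 = g.1 0 0 := by
  simp [Matrix.SpecialLinearGroup.coe_inv, Matrix.adjugate_fin_two]
theorem neg_00 (g : SL F) : (-g).1 0 0 = - g.1 0 0 := rfl
theorem neg_01 (g : SL F) : (-g).1 0 1 = - g.1 0 1 := rfl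
theorem neg_10 (g : SL F) : (-g).1 1 0 = - g.1 1 0 := rfl
theorem neg_11 (g : SL F) : (-g).1 1 1 = - g.1 1 1 := rfl
theorem one_00 : (1 : SL F).1 0 0 = 1 := rfl
theorem one_01 : (1 : SL F).1 0 1 = 0 := rfl
theorem one_10 : (1 : SL F).1 1 0 = 0 := rfl
theorem one_11 : (1 : SL F).1 1 1 = 1 := rfl

/-- upper unipotent -/
def uu (x : F) : SL F := mk2 1 x 0 1 (by ring)
/-- lower unipotent -/
def ll (x : F) : SL F := mk2 1 0 x 1 (by ring)
/-- diagonal -/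
def dd (t : Fˣ) : SL F := mk2 t 0 0 (t⁻¹ : Fˣ) (by simp)
/-- Weyl element -/
def ww : SL F := mk2 0 1 (-1) 0 (by ring)

@[simp] theorem uu_00 (x : F) : (uu x).1 0 0 = 1 := rfl
@[simp] theorem uu_01 (x : F) : (uu x).1 0 1 = x := rfl
@[simp] theorem uu_10 (x : F) : (uu x).1 1 0 = 0 := rfl
@[simp] theorem uu_11 (x : F) : (uu x).1 1 1 = 1 := rfl
@[simp] theorem ll_00 (x : F) : (ll x).1 0 0 = 1 := rfl
@[simp] theorem ll_01 (x : F) : (ll x).1 0 1 = 0 := rfl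
@[simp] theorem ll_10 (x : F) : (ll x).1 1 0 = x := rfl
@[simp] theorem ll_11 (x : F) : (ll x).1 1 1 = 1 := rfl
@[simp] theorem dd_00 (x : Fˣ) : (dd x).1 0 0 = x := rfl
@[simp] theorem dd_01 (x : Fˣ) : (dd x).1 0 1 = 0 := rfl
@[simp] theorem dd_10 (x : Fˣ) : (dd x).1 1 0 = 0 := rfl
@[simp] theorem dd_11 (x : Fˣ) : (dd x).1 1 1 = (x⁻¹ : Fˣ) := rfl
@[simp] theorem ww_00 : (ww : SL F).1 0 0 = 0 := rfl
@[simp] theorem ww_01 : (ww : SL F).1 0 1 = 1 := rfl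
@[simp] theorem ww_10 : (ww : SL F).1 1 0 = -1 := rfl
@[simp] theorem ww_11 : (ww : SL F).1 1 1 = 0 := rfl

/-- solve an identity by entries -/
theorem uu_add (x y : F) : uu (x + y) = uu x * uu y := by
  apply ext4 <;> simp [mul_00, mul_01, mul_10, mul_11, add_comm]
theorem uu_inv (x : F) : (uu x)⁻¹ = uu (-x) := by
  apply ext4 <;> simp only [inv_00, inv_01, inv_10, inv_11] <;> simp
theorem uu_zero : uu (0 : F) = 1 := by
  apply ext4 <;> simp only [one_00, one_01, one_10, one_11] <;> simp
theorem ll_conj (x : F) : ww * uu x * ww⁻¹ = ll (-x) := by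
  apply ext4 <;> simp only [mul_00, mul_01, mul_10, mul_11, inv_00, inv_01, inv_10, inv_11] <;> simp
theorem uu_conj (x : F) : ww * ll x * ww⁻¹ = uu (-x) := by
  apply ext4 <;> simp only [mul_00, mul_01, mul_10, mul_11, inv_00, inv_01, inv_10, inv_11] <;> simp
theorem dd_conj (t : Fˣ) (x : F) : dd t * uu x * (dd t)⁻¹ = uu ((t : F) * t * x) := by
  apply ext4 <;> simp only [mul_00, mul_01, mul_10, mul_11, inv_00, inv_01, inv_10, inv_11] <;>
    simp [mul_comm, mul_left_comm, mul_assoc]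
theorem dd_ww (t : Fˣ) : ww * dd t = dd t⁻¹ * ww := by
  apply ext4 <;> simp only [mul_00, mul_01, mul_10, mul_11] <;> simp
theorem ww_eq : (ww : SL F) = uu 1 * ll (-1) * uu 1 := by
  apply ext4 <;> simp only [mul_00, mul_01, mul_10, mul_11] <;> simp

theorem gen_decomp (g : SL F) (hc : g.1 1 0 ≠ 0) :
    g = uu ((g.1 0 0 - 1) / g.1 1 0) * ll (g.1 1 0) * uu ((g.1 1 1 - 1) / g.1 1 0) := by
  have := det4 g
  apply ext4 <;> simp only [mul_00, mul_01, mul_10, mul_11] <;> simp <;> field_simp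
  · ring
  · linear_combination -this
  · ring

theorem hom_ext_gen {X : Type} [Group X] (f1 f2 : SL F →* X) (hu : ∀ x, f1 (uu x) = f2 (uu x))
    (hl : ∀ x, f1 (ll x) = f2 (ll x)) (g : SL F) : f1 g = f2 g := by
  have main : ∀ g : SL F, g.1 1 0 ≠ 0 → f1 g = f2 g := by
    intro g hg
    rw [gen_decomp g hg]
    simp only [map_mul, hu, hl]
  by_cases hc : g.1 1 0 = 0
  · have hd : (g * ll 1).1 1 0 ≠ 0 := by
      have := det4 g
      rw [mul_10, hc]
      simp only [ll_10, ll_00]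
      intro h
      have h' : g.1 1 1 = 0 := by simpa using h
      rw [hc, h'] at this; simp at this
    have := main _ hd
    rw [map_mul, map_mul, hl] at this
    exact mul_right_cancel this
  · exact main g hc

/-- Bruhat -/
theorem bruhat (g : SL F) (hc : g.1 1 0 ≠ 0) :
    ∃ b x, (b : SL F).1 1 0 = 0 ∧ g = b * ww * uu x := by
  refine ⟨g * (ww * uu (g.1 1 1 / g.1 1 0))⁻¹, g.1 1 1 / g.1 1 0, ?_, by group⟩
  simp only [mul_10, mul_00, mul_01, mul_11, inv_00, inv_10]
  simp
  field_simp
  ring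

theorem mem_center (g : SL F) : g ∈ Subgroup.center (SL F) ↔ g = 1 ∨ g = -1 := by
  constructor
  · intro hg
    rw [Subgroup.mem_center_iff] at hg
    have h1 := hg (uu 1)
    have h2 := hg (ll 1)
    have e1 := congrArg (fun m : SL F => m.1 0 0) h1
    have e2 := congrArg (fun m : SL F => m.1 0 1) h1
    have e3 := congrArg (fun m : SL F => m.1 0 0) h2
    simp only [mul_00, mul_01] at e1 e2 e3
    simp at e1 e2 e3
    have hd := det4 g
    have e4 : g.1 1 1 = g.1 0 0 := by linear_combination e2
    rw [e1, e4] at hd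
    have : (g.1 0 0 - 1) * (g.1 0 0 + 1) = 0 := by linear_combination hd
    rcases mul_eq_zero.1 this with h | h
    · left
      apply ext4 <;> simp only [one_00, one_01, one_10, one_11]
      · linear_combination h
      · exact e3
      · exact e1
      · linear_combination h + e4
    · right
      apply ext4 <;> simp only [neg_00, neg_01, neg_10, neg_11, one_00, one_01, one_10, one_11]
      · linear_combination h
      · rw [e3]; simp
      · rw [e1]; simp
      · linear_combination h + e4
  · rintro (rfl | rfl)
    · exact one_mem _
    · rw [Subgroup.mem_center_iff]
      intro g; simp

theorem mkS_eq (g h : SL F) : mkS g = mkS h ↔ g = h ∨ g = -h := by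
  change (g : PS F) = (h : PS F) ↔ _
  rw [QuotientGroup.eq, mem_center]
  constructor
  · rintro (h1 | h1)
    · left; exact inv_mul_eq_one.1 h1
    · right
      rw [inv_mul_eq_iff_eq_mul] at h1
      rw [h1]; simp
  · rintro (rfl | rfl)
    · left; simp
    · right
      rw [inv_mul_eq_iff_eq_mul]; simp

theorem mkS_ker (g : SL F) : g ∈ (mkS (F := F)).ker ↔ g = 1 ∨ g = -1 := by
  rw [MonoidHom.mem_ker, ← map_one mkS, mkS_eq]

theorem mkS_uu_inj (h2 : (2 : F) ≠ 0) {x y : F} (h : mkS (uu x) = mkS (uu y)) : x = y := by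
  rcases (mkS_eq _ _).1 h with h | h
  · simpa using congrArg (fun m : SL F => m.1 0 1) h
  · exfalso
    have := congrArg (fun m : SL F => m.1 0 0) h
    simp only [neg_00, uu_00] at this
    apply h2; linear_combination this

/-- being upper triangular, in PSL2 -/
theorem upper_of_conj {g : SL F} {x y : F} (hx : x ≠ 0)
    (h : mkS g * mkS (uu x) * (mkS g)⁻¹ = mkS (uu y)) : g.1 1 0 = 0 := by
  rw [← map_inv, ← map_mul, ← map_mul, mkS_eq] at h
  have : (g * uu x * g⁻¹).1 1 0 = 0 := by
    rcases h with h | h <;> rw [h]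
    · rfl
    · simp [neg_10]
  simp only [mul_10, mul_00, mul_01, mul_11, inv_00, inv_10] at this
  simp at this
  have h' : x * (g.1 1 0 * g.1 1 0) = 0 := by linear_combination -this
  simpa [hx] using h'

/-- upper triangular matrices act on the unipotents -/
theorem upper_conj {g : SL F} (hg : g.1 1 0 = 0) (x : F) :
    g * uu x * g⁻¹ = uu (g.1 0 0 * g.1 0 0 * x) := by
  have hd := det4 g
  rw [hg] at hd
  apply ext4 <;> simp only [mul_00, mul_01, mul_10, mul_11, inv_00, inv_01, inv_10, inv_11, hg] <;>
    simp
  · linear_combination hd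
  · ring
  · linear_combination hd

/-- twisted automorphism -/
def twist (c : Fˣ) (σ : F ≃+* F) : SL F →* SL F where
  toFun g := mk2 (σ (g.1 0 0)) (c * σ (g.1 0 1)) ((c⁻¹ : Fˣ) * σ (g.1 1 0)) (σ (g.1 1 1)) (by
    have h1 := congrArg σ (det4 g)
    simp only [map_sub, map_mul, map_one] at h1
    have h3 : (c : F) * (c⁻¹ : Fˣ) = 1 := by simp
    linear_combination h1 - σ (g.1 0 1) * σ (g.1 1 0) * h3)
  map_one' := by
    apply ext4 <;> simp only [mk2_00, mk2_01, mk2_10, mk2_11, one_00, one_01, one_10, one_11] <;> simp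
  map_mul' g h := by
    have : (c : F) * (c⁻¹ : Fˣ) = 1 := by simp
    apply ext4 <;> simp only [mk2_00, mk2_01, mk2_10, mk2_11, mul_00, mul_01, mul_10, mul_11,
      map_mul, map_add]
    · linear_combination (- σ (g.1 0 1) * σ (h.1 1 0)) * this
    · ring
    · ring
    · linear_combination (- σ (g.1 1 0) * σ (h.1 0 1)) * this

theorem twist_uu (c : Fˣ) (σ : F ≃+* F) (x : F) : twist c σ (uu x) = uu (c * σ x) := by
  apply ext4 <;> simp [twist]
theorem twist_ll (c : Fˣ) (σ : F ≃+* F) (x : F) : twist c σ (ll x) = ll ((c⁻¹ : Fˣ) * σ x) := by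
  apply ext4 <;> simp [twist]

/-- count -/
noncomputable def slEquiv : SL F ≃ (F × Fˣ × F) ⊕ (Fˣ × F) := by
  classical
  exact {
  toFun := fun g => if hc : g.1 1 0 = 0 then
      Sum.inr (Units.mkOfMulEqOne (g.1 0 0) (g.1 1 1) (by
        have := det4 g; rw [hc] at this; linear_combination this), g.1 0 1)
    else Sum.inl (g.1 0 0, Units.mk0 _ hc, g.1 1 1)
  invFun := Sum.elim (fun x => mk2 x.1 ((x.1 * x.2.2 - 1) * (x.2.1⁻¹ : Fˣ)) x.2.1 x.2.2 (by
      rw [mul_assoc, Units.inv_mul]; ring)) (fun x => mk2 x.1 x.2 0 (x.1⁻¹ : Fˣ) (by simp))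
  left_inv := by
    intro g
    have := det4 g
    by_cases hc : g.1 1 0 = 0
    · simp only [hc, dite_true, Sum.elim_inr]
      apply ext4 <;> simp [hc, Units.mkOfMulEqOne]
    · simp only [hc, dite_false, Sum.elim_inl]
      apply ext4 <;> simp [hc]
      field_simp
      linear_combination this
  right_inv := by
    rintro (⟨a, c, d⟩ | ⟨a, b⟩)
    · simp [Units.mk0]
    · simp [Units.mkOfMulEqOne] }

end sl
end Stmt12

open CategoryTheory

namespace Stmt12
set_option linter.unusedSectionVars false
section auts
variable {F : Type} [Field F] [Fintype F]

theorem semil (h2 : (2 : F) ≠ 0) (α : MulAut (PS F))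
    (h : ∀ x : F, ∃ y : F, α (mkS (uu x)) = mkS (uu y)) :
    ∃ (c : Fˣ) (σ : F ≃+* F), ∀ x, α (mkS (uu x)) = mkS (uu (c * σ x)) := by
  choose φ hφ using h
  have hadd : ∀ x y, φ (x + y) = φ x + φ y := by
    intro x y
    apply mkS_uu_inj h2
    rw [← hφ, uu_add, uu_add, map_mul, map_mul, map_mul, hφ, hφ]
  have hinj : Function.Injective φ := by
    intro x y hxy
    have : α (mkS (uu x)) = α (mkS (uu y)) := by rw [hφ, hφ, hxy]
    exact mkS_uu_inj h2 (α.injective this)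
  have h0 : φ 0 = 0 := by
    have := hadd 0 0
    rw [add_zero] at this
    linear_combination -this
  have h1 : φ 1 ≠ 0 := by
    intro h; rw [← h0] at h; exact one_ne_zero (hinj h)
  have hsub : ∀ x y, φ (x - y) = φ x - φ y := by
    intro x y
    have := hadd (x - y) y
    rw [sub_add_cancel] at this
    linear_combination -this
  have hsq : ∀ t x, φ (t * t * x) * φ 1 = φ (t * t) * φ x := by
    intro t x
    by_cases ht : t = 0
    · subst ht; simp [h0]
    · obtain ⟨g, hg⟩ := mkS_surj (α (mkS (dd (Units.mk0 t ht))))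
      have key : ∀ x, mkS g * mkS (uu (φ x)) * (mkS g)⁻¹ = mkS (uu (φ (t * t * x))) := by
        intro x
        rw [← hφ x, ← hφ, hg, ← map_inv, ← map_mul, ← map_mul, ← map_inv, ← map_mul, ← map_mul,
          dd_conj]
        rfl
      have hu := upper_of_conj h1 (key 1)
      have k2 : ∀ x, g.1 0 0 * g.1 0 0 * φ x = φ (t * t * x) := by
        intro x
        apply mkS_uu_inj h2
        rw [← key, ← upper_conj hu, map_mul, map_mul, map_inv]
      have := k2 1
      rw [mul_one] at this
      rw [← k2, ← this]; ring
  have hmul4 : ∀ c x, φ ((2 * 2) * (c * x)) * φ 1 = φ ((2 * 2) * c) * φ x := by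
    intro c x
    have e1 : (2 * 2) * (c * x) = (c + 1) * (c + 1) * x - (c - 1) * (c - 1) * x := by ring
    have e2 : (2 * 2) * c = (c + 1) * (c + 1) - (c - 1) * (c - 1) := by ring
    rw [e1, e2, hsub, hsub]
    linear_combination hsq (c + 1) x - hsq (c - 1) x
  have hmul : ∀ c x, φ (c * x) * φ 1 = φ c * φ x := by
    intro c x
    have := hmul4 (c / (2 * 2)) x
    have e1 : (2 * 2) * (c / (2 * 2) * x) = c * x := by field_simp
    have e2 : (2 * 2) * (c / (2 * 2)) = c := by field_simp
    rwa [e1, e2] at this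
  let σ0 : F →+* F :=
    { toFun := fun x => φ x / φ 1
      map_one' := by simp [h1]
      map_zero' := by simp [h0]
      map_add' := by intro x y; rw [hadd]; ring
      map_mul' := by
        intro x y
        have := hmul x y
        field_simp
        linear_combination this }
  refine ⟨Units.mk0 _ h1, RingEquiv.ofBijective σ0 (Finite.injective_iff_bijective.1 σ0.injective), ?_⟩
  intro x
  rw [hφ]
  congr 2
  change φ x = φ 1 * (φ x / φ 1)
  field_simp

/-- the unipotent subgroup -/
def Ubar (F : Type) [Field F] : Subgroup (PS F) where
  carrier := Set.range (fun x => mkS (uu x))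
  mul_mem' := by
    rintro _ _ ⟨x, rfl⟩ ⟨y, rfl⟩
    exact ⟨x + y, by simp [uu_add]⟩
  one_mem' := ⟨0, by simp [uu_zero]⟩
  inv_mem' := by
    rintro _ ⟨x, rfl⟩
    exact ⟨-x, by simp [← uu_inv]⟩

theorem mem_Ubar (s : PS F) : s ∈ Ubar F ↔ ∃ x, mkS (uu x) = s := Iff.rfl

open Pointwise

theorem stab_iff (α : MulAut (PS F)) : α ∈ MulAction.stabilizer (MulAut (PS F)) (Ubar F) ↔
    ∀ x : F, ∃ y : F, α (mkS (uu x)) = mkS (uu y) := by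
  rw [MulAction.mem_stabilizer_iff]
  constructor
  · intro h x
    have : α (mkS (uu x)) ∈ α • Ubar F := Subgroup.smul_mem_pointwise_smul _ α _ ⟨x, rfl⟩
    rw [h] at this
    obtain ⟨y, hy⟩ := this
    exact ⟨y, hy.symm⟩
  · intro h
    have hle : α • Ubar F ≤ Ubar F := by
      intro s hs
      rw [Subgroup.mem_smul_pointwise_iff_exists] at hs
      obtain ⟨_, ⟨x, rfl⟩, rfl⟩ := hs
      obtain ⟨y, hy⟩ := h x
      exact ⟨y, hy.symm⟩
    have hc : Nat.card (α • Ubar F : Subgroup (PS F)) = Nat.card (Ubar F) :=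
      (Nat.card_congr (Subgroup.equivSMul α (Ubar F)).toEquiv).symm
    exact Subgroup.eq_of_le_of_card_ge hle hc.ge

theorem conj_stab_iff (h2 : (2 : F) ≠ 0) (g : SL F) :
    MulAut.conj (mkS g) ∈ MulAction.stabilizer (MulAut (PS F)) (Ubar F) ↔ g.1 1 0 = 0 := by
  rw [stab_iff]
  constructor
  · intro h
    obtain ⟨y, hy⟩ := h 1
    rw [MulAut.conj_apply] at hy
    exact upper_of_conj one_ne_zero hy
  · intro h x
    refine ⟨g.1 0 0 * g.1 0 0 * x, ?_⟩
    rw [MulAut.conj_apply, ← map_inv, ← map_mul, ← map_mul, upper_conj h]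

theorem card_Ubar (h2 : (2 : F) ≠ 0) : Nat.card (Ubar F) = Nat.card F := by
  refine (Nat.card_congr (Equiv.ofBijective (fun x : F => (⟨mkS (uu x), x, rfl⟩ : Ubar F)) ⟨?_, ?_⟩)).symm
  · intro x y h
    exact mkS_uu_inj h2 (congrArg Subtype.val h)
  · rintro ⟨_, x, rfl⟩
    exact ⟨x, rfl⟩

theorem card_SL : Nat.card (SL F) = Nat.card F * (Nat.card F - 1) * (Nat.card F + 1) := by
  rw [Nat.card_congr slEquiv, Nat.card_sum, Nat.card_prod, Nat.card_prod,
    Nat.card_units]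
  ring

theorem neg_one_ne (h2 : (2 : F) ≠ 0) : (1 : SL F) ≠ -1 := by
  intro h
  have := congrArg (fun m : SL F => m.1 0 0) h
  simp only [neg_00, one_00] at this
  apply h2; linear_combination this

theorem card_center (h2 : (2 : F) ≠ 0) : Nat.card (Subgroup.center (SL F)) = 2 := by
  have : ((Subgroup.center (SL F) : Subgroup (SL F)) : Set (SL F)) = {1, -1} := by
    ext g
    exact mem_center g
  change Nat.card ((Subgroup.center (SL F) : Subgroup (SL F)) : Set (SL F)) = 2
  rw [this, Nat.card_coe_set_eq, Set.ncard_pair (neg_one_ne h2)]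

theorem card_PS (h2 : (2 : F) ≠ 0) :
    Nat.card (PS F) * 2 = Nat.card F * (Nat.card F - 1) * (Nat.card F + 1) := by
  rw [← card_SL, ← card_center h2, ← Subgroup.card_eq_card_quotient_mul_card_subgroup]

variable {p a : ℕ} [Fact p.Prime]

theorem aut_conj (ha : 1 ≤ a) (hF : Nat.card F = p ^ a) (h2 : (2 : F) ≠ 0)
    (α : MulAut (PS F)) : ∃ s : PS F, α • Ubar F = MulAut.conj s • Ubar F := by
  have hpp : p.Prime := Fact.out
  have hd : p ∣ p ^ a := dvd_pow_self p (by omega)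
  have hpos : 0 < p ^ a := pow_pos hpp.pos a
  have hcop : ¬ p ∣ (Ubar F).index := by
    intro h
    have hc := (Ubar F).card_mul_index
    rw [card_Ubar h2, hF] at hc
    have e := card_PS h2
    rw [← hc, hF, mul_assoc, mul_assoc] at e
    have e2 := Nat.eq_of_mul_eq_mul_left hpos e
    have : p ∣ (p ^ a - 1) * (p ^ a + 1) := e2 ▸ h.mul_right 2
    rcases hpp.dvd_mul.1 this with h | h
    · have := (Nat.dvd_sub_iff_right (by omega) hd).1 h
      exact hpp.one_lt.ne' (Nat.dvd_one.1 this)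
    · have := (Nat.dvd_add_right hd).1 h
      exact hpp.one_lt.ne' (Nat.dvd_one.1 this)
  have hpg : IsPGroup p (Ubar F) := IsPGroup.of_card ((card_Ubar h2).trans hF)
  let P : Sylow p (PS F) := hpg.toSylow hcop
  obtain ⟨s, hs⟩ := MulAction.exists_smul_eq (PS F) P (α • P)
  refine ⟨s, ?_⟩
  have := congrArg (fun Q : Sylow p (PS F) => (Q : Subgroup (PS F))) hs
  exact this.symm

theorem aut_form (ha : 1 ≤ a) (hF : Nat.card F = p ^ a) (h2 : (2 : F) ≠ 0)
    (α : MulAut (PS F)) : ∃ (s : PS F) (c : Fˣ) (σ : F ≃+* F),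
      ∀ g, α (mkS g) = s * mkS (twist c σ g) * s⁻¹ := by
  obtain ⟨s, hs⟩ := aut_conj ha hF h2 α
  have hst : (MulAut.conj s)⁻¹ * α ∈ MulAction.stabilizer (MulAut (PS F)) (Ubar F) := by
    rw [MulAction.mem_stabilizer_iff, mul_smul, hs, inv_smul_smul]
  set β := (MulAut.conj s)⁻¹ * α with hβ
  obtain ⟨w', hw'⟩ := mkS_surj (β (mkS ww))
  have hwn : w'.1 1 0 ≠ 0 := by
    rw [Ne, ← conj_stab_iff h2, hw']
    have : MulAut.conj (β (mkS ww)) = β * MulAut.conj (mkS (ww : SL F)) * β⁻¹ := by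
      ext x; simp [MulAut.conj_apply]
    rw [this]
    intro hh
    have h3 : MulAut.conj (mkS (ww : SL F)) ∈ MulAction.stabilizer (MulAut (PS F)) (Ubar F) := by
      have := mul_mem (mul_mem (inv_mem hst) hh) hst
      convert this using 1
      group
    rw [conj_stab_iff h2] at h3
    simp at h3
  obtain ⟨b, x0, hb, hbw⟩ := bruhat w' hwn
  have hst2 : (MulAut.conj (mkS b))⁻¹ * β ∈ MulAction.stabilizer (MulAut (PS F)) (Ubar F) :=
    mul_mem (inv_mem ((conj_stab_iff h2 b).2 hb)) hst
  set γ := (MulAut.conj (mkS b))⁻¹ * β with hγ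
  have hγw : γ (mkS ww) = mkS (ww * uu x0 * b) := by
    rw [hγ, MulAut.mul_apply, ← hw', hbw, MulAut.conj_inv_apply, ← map_inv, ← map_mul, ← map_mul]
    congr 1; group
  obtain ⟨c, σ, hcσ⟩ := semil h2 γ ((stab_iff _).1 hst2)
  have hl : ∀ x : F, ∃ y, γ (mkS (ll x)) = mkS (ll y) := by
    intro x
    refine ⟨- (b.1 0 0 * b.1 0 0 * (c * σ (-x)) ), ?_⟩
    have e1 : (ll x) = ww * uu (-x) * ww⁻¹ := by rw [ll_conj, neg_neg]
    rw [e1, ← ll_conj, ← upper_conj hb]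
    simp only [map_mul, map_inv, hγw, hcσ]
    have hc : ∀ y z : F, mkS (uu y) * mkS (uu z) * (mkS (uu y))⁻¹ = mkS (uu z) := by
      intro y z
      rw [← map_mul, ← uu_add, add_comm, uu_add, map_mul, mul_inv_cancel_right]
    have := hc x0 (b.1 0 0 * b.1 0 0 * (c * σ (-x)))
    rw [← upper_conj hb] at this
    simp only [map_mul, map_inv] at this
    conv_rhs => rw [← this]
    group
  choose ψ hψ using hl
  have hψv : ∀ x : F, x ≠ 0 → ψ (-x⁻¹) = - (c * σ x)⁻¹ := by
    intro x hx
    have hcx : c * σ x ≠ 0 := mul_ne_zero c.ne_zero (by simpa using hx)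
    -- the element n(x)
    have hn : ∀ y : F, uu x * ll (-x⁻¹) * uu x * uu y * (uu x * ll (-x⁻¹) * uu x)⁻¹ =
        ll (-(x⁻¹ * x⁻¹ * y)) := by
      intro y
      apply ext4 <;> simp only [mul_00, mul_01, mul_10, mul_11, inv_00, inv_01, inv_10, inv_11] <;>
        simp <;> field_simp <;> ring
    have e := congrArg (fun g => γ (mkS g)) (hn 1)
    simp only [map_mul, map_inv, hcσ, hψ] at e
    simp only [← map_mul, ← map_inv] at e
    rw [mkS_eq] at e
    set A := c * σ x with hA
    set Bb := ψ (-x⁻¹) with hB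
    have e2 : (uu A * ll Bb * uu A * uu (c * σ 1) * (uu A * ll Bb * uu A)⁻¹).1 0 1 = 0 := by
      rcases e with e | e <;> rw [e]
      · rfl
      · simp [neg_01]
    simp only [mul_00, mul_01, mul_10, mul_11, inv_00, inv_01, inv_10, inv_11] at e2
    simp at e2
    have e3 : (c : F) * ((1 + A * Bb) * (1 + A * Bb)) = 0 := by linear_combination e2
    have e4 : 1 + A * Bb = 0 := by simpa using e3
    field_simp
    linear_combination e4
  have hgen : ∀ g, γ (mkS g) = mkS (twist c σ g) := by
    intro g
    refine hom_ext_gen ((γ : PS F →* PS F).comp mkS) (mkS.comp (twist c σ)) ?_ ?_ g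
    · intro x
      change γ (mkS (uu x)) = mkS (twist c σ (uu x))
      rw [hcσ, twist_uu]
    · intro x
      change γ (mkS (ll x)) = mkS (twist c σ (ll x))
      rw [twist_ll]
      by_cases hx : x = 0
      · subst hx
        have : ll (0 : F) = 1 := by
          apply ext4 <;> simp only [one_00, one_01, one_10, one_11] <;> simp
        simp [this]
      · rw [hψ]
        have := hψv (-x⁻¹) (by simpa using hx)
        rw [inv_neg, inv_inv, neg_neg] at this
        rw [this]
        congr 2
        simp [mul_comm]
  refine ⟨s * mkS b, c, σ, ?_⟩
  intro g
  rw [← hgen, hγ, hβ]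
  simp [MulAut.conj_apply, MulAut.conj_inv_apply, mul_assoc]

end auts
end Stmt12

open CategoryTheory

namespace Stmt12
set_option linter.unusedSectionVars false

theorem simple_of_end {G : Type} [Group G] [Fintype G] {V : Type} [AddCommGroup V] [Module ℂ V]
    [FiniteDimensional ℂ V] (ρ : Representation ℂ G V) (hne : ∃ v : V, v ≠ 0)
    (h : ∀ T : V →ₗ[ℂ] V, (∀ g v, T (ρ g v) = ρ g (T v)) → ∃ c : ℂ, ∀ v, T v = c • v) :
    Simple (FDRep.of ρ) := by
  rw [FDRep.simple_iff_char_is_norm_one]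
  change ∑ g : G, ρ.character g * ρ.character g⁻¹ = _
  have c2 := Representation.card_inv_mul_sum_char_mul_char_eq_finrank ρ ρ
  have : Module.finrank ℂ (Representation.IntertwiningMap ρ ρ) = 1 := by
    rw [finrank_eq_one_iff']
    refine ⟨Representation.IntertwiningMap.id ρ, ?_, ?_⟩
    · intro h0
      obtain ⟨v, hv⟩ := hne
      have := congrArg (fun f : Representation.IntertwiningMap ρ ρ => f v) h0
      exact hv (by simpa using this)
    · intro w
      obtain ⟨c, hc⟩ := h w.toLinearMap (fun g v =>
        Representation.IntertwiningMap.isIntertwining _ _ w g v)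
      refine ⟨c, ?_⟩
      ext v
      have := hc v
      simp at this ⊢
      exact this.symm
  rw [this] at c2
  have hG : (Nat.card G : ℂ) ≠ 0 := Nat.cast_ne_zero.2 Nat.card_pos.ne'
  simp only [Nat.cast_one] at c2
  rw [Nat.card_eq_fintype_card] at hG
  rw [Nat.card_eq_fintype_card]
  have c3 : (Fintype.card G : ℂ)⁻¹ * ∑ g : G, ρ.character g * ρ.character g⁻¹ = 1 := by
    rw [← c2, Nat.card_eq_fintype_card]
  field_simp at c3
  exact c3

theorem indChar_one {G H : Type} [Group G] [Fintype G] [Group H] [Fintype H]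
    (j : H →* G) (θ : H →* ℂˣ) (hj : Function.Injective j) :
    indChar j θ 1 = (Fintype.card H : ℂ)⁻¹ * (Fintype.card G : ℂ) := by
  rw [indChar]
  congr 1
  refine (Finset.sum_congr rfl fun x _ => ?_).trans (by simp : ∑ x : G, (1 : ℂ) = _)
  rw [Finset.sum_eq_single 1]
  · rw [if_pos (by simp)]; simp
  · intro b _ hb
    rw [if_neg]
    intro h
    apply hb
    apply hj
    rw [h]; simp
  · simp

section auts
open Pointwise
variable {F : Type} [Field F] [Fintype F]

/-- stabilizer of the unipotent group -/
abbrev Bh (F : Type) [Field F] : Subgroup (MulAut (PS F)) :=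
  MulAction.stabilizer (MulAut (PS F)) (Ubar F)

/-- Character of the stabilizer -/
noncomputable def thh (h2 : (2 : F) ≠ 0) (θ : Fˣ →* ℂˣ)
    (hθ : ∀ (σ : F ≃+* F) (c : Fˣ), θ (Units.map (σ : F →* F) c) = θ c) : Bh F →* ℂˣ :=
  MonoidHom.mk' (fun α => θ (semil h2 α.1 ((stab_iff α.1).1 α.2)).choose) (by
    intro α β
    obtain ⟨σ1, h1⟩ := (semil h2 α.1 ((stab_iff α.1).1 α.2)).choose_spec
    obtain ⟨σ2, h2'⟩ := (semil h2 β.1 ((stab_iff β.1).1 β.2)).choose_spec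
    obtain ⟨σ3, h3⟩ := (semil h2 (α * β).1 ((stab_iff (α * β).1).1 (α * β).2)).choose_spec
    generalize (semil h2 α.1 ((stab_iff α.1).1 α.2)).choose = c1 at *
    generalize (semil h2 β.1 ((stab_iff β.1).1 β.2)).choose = c2 at *
    generalize (semil h2 (α * β).1 ((stab_iff (α * β).1).1 (α * β).2)).choose = c3 at *
    have e := h3 1
    rw [Subgroup.coe_mul, MulAut.mul_apply, h2', h1] at e
    have e2 := mkS_uu_inj h2 e
    have e3 : c3 = c1 * Units.map (σ1 : F →* F) c2 := by
      ext
      simp at e2 ⊢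
      exact e2.symm
    rw [e3, map_mul, hθ])

theorem thh_eq (h2 : (2 : F) ≠ 0) (θ : Fˣ →* ℂˣ)
    (hθ : ∀ (σ : F ≃+* F) (c : Fˣ), θ (Units.map (σ : F →* F) c) = θ c) (α : Bh F)
    (c : Fˣ) (σ : F ≃+* F) (h : ∀ x, α.1 (mkS (uu x)) = mkS (uu (c * σ x))) :
    thh h2 θ hθ α = θ c := by
  change θ (semil h2 α.1 ((stab_iff α.1).1 α.2)).choose = _
  obtain ⟨σ1, h1⟩ := (semil h2 α.1 ((stab_iff α.1).1 α.2)).choose_spec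
  have := (h 1).symm.trans (h1 1)
  have := mkS_uu_inj h2 this
  simp at this
  congr 1
  exact Units.ext this.symm

theorem thh_dd (h2 : (2 : F) ≠ 0) (θ : Fˣ →* ℂˣ)
    (hθ : ∀ (σ : F ≃+* F) (c : Fˣ), θ (Units.map (σ : F →* F) c) = θ c) (t : Fˣ) :
    thh h2 θ hθ ⟨MulAut.conj (mkS (dd t)), (conj_stab_iff h2 _).2 rfl⟩ = θ (t * t) := by
  apply thh_eq h2 θ hθ _ _ (RingEquiv.refl F)
  intro x
  rw [MulAut.conj_apply, ← map_inv, ← map_mul, ← map_mul, dd_conj]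
  rfl

theorem thh_uu (h2 : (2 : F) ≠ 0) (θ : Fˣ →* ℂˣ)
    (hθ : ∀ (σ : F ≃+* F) (c : Fˣ), θ (Units.map (σ : F →* F) c) = θ c) (y : F) :
    thh h2 θ hθ ⟨MulAut.conj (mkS (uu y)), (conj_stab_iff h2 _).2 rfl⟩ = 1 := by
  rw [← map_one θ]
  apply thh_eq h2 θ hθ _ _ (RingEquiv.refl F)
  intro x
  rw [MulAut.conj_apply, ← map_inv, ← map_mul, ← map_mul, upper_conj rfl]
  simp

variable {p a : ℕ} [Fact p.Prime]

/-- Borel subgroup -/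
def Bor (F : Type) [Field F] : Subgroup (SL F) where
  carrier := {g | g.1 1 0 = 0}
  mul_mem' := by
    intro a b ha hb
    simp only [Set.mem_ofPred_eq] at *
    simp [mul_10, ha, hb]
  one_mem' := rfl
  inv_mem' := by
    intro a ha
    simp only [Set.mem_ofPred_eq] at *
    simp [inv_10, ha]

theorem mem_Bor (g : SL F) : g ∈ Bor F ↔ g.1 1 0 = 0 := Iff.rfl

/-- parametrization of the Borel subgroup -/
noncomputable def borEquiv : Fˣ × F ≃ Bor F :=
  Equiv.ofBijective (fun x => ⟨mk2 x.1 x.2 0 (x.1⁻¹ : Fˣ) (by simp), rfl⟩) (by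
    constructor
    · rintro ⟨t, x⟩ ⟨t', x'⟩ h
      have h := congrArg Subtype.val h
      have h1 := congrArg (fun m : SL F => m.1 0 0) h
      have h2 := congrArg (fun m : SL F => m.1 0 1) h
      simp only [mk2_00, mk2_01] at h1 h2
      rw [Units.ext h1, h2]
    · rintro ⟨g, hg⟩
      rw [mem_Bor] at hg
      have hd := det4 g
      rw [hg] at hd
      refine ⟨(Units.mkOfMulEqOne (g.1 0 0) (g.1 1 1) (by linear_combination hd), g.1 0 1), ?_⟩
      apply Subtype.ext
      apply ext4 <;> simp [hg, Units.mkOfMulEqOne])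

theorem card_Bor : Nat.card (Bor F) = (Nat.card F - 1) * Nat.card F := by
  rw [← Nat.card_congr borEquiv, Nat.card_prod, Nat.card_units]

theorem index_Bor : (Bor F).index = Nat.card F + 1 := by
  have h := (Bor F).card_mul_index
  rw [card_Bor, card_SL, mul_comm (Nat.card F) (Nat.card F - 1)] at h
  have : 1 < Nat.card F := Finite.one_lt_card
  exact Nat.eq_of_mul_eq_mul_left (Nat.mul_pos (by omega) (by omega)) h

theorem Bh_index (ha : 1 ≤ a) (hF : Nat.card F = p ^ a) (h2 : (2 : F) ≠ 0) :
    (Bh F).index = p ^ a + 1 := by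
  have h3 : ((Bh F).comap (MulAut.conj (G := PS F))).comap mkS = Bor F := by
    ext g
    exact conj_stab_iff h2 g
  have h4 : ((Bh F).comap (MulAut.conj (G := PS F))).index = p ^ a + 1 := by
    rw [← Subgroup.index_comap_of_surjective _ (mkS_surj (F := F)), h3, index_Bor, hF]
  rw [← h4, MulAction.index_stabilizer]
  letI : MulAction (PS F) (Subgroup (PS F)) := MulAction.compHom _ (MulAut.conj (G := PS F))
  have h5 : (Bh F).comap (MulAut.conj (G := PS F)) = MulAction.stabilizer (PS F) (Ubar F) := by
    ext s; rfl
  rw [h5, MulAction.index_stabilizer]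
  congr 1
  ext H
  constructor
  · rintro ⟨α, rfl⟩
    obtain ⟨s, hs⟩ := aut_conj ha hF h2 α
    exact ⟨s, hs.symm⟩
  · rintro ⟨s, rfl⟩
    exact ⟨MulAut.conj s, rfl⟩

theorem chi1 (ha : 1 ≤ a) (hF : Nat.card F = p ^ a) (h2 : (2 : F) ≠ 0) (θ : Fˣ →* ℂˣ)
    (hθ : ∀ (σ : F ≃+* F) (c : Fˣ), θ (Units.map (σ : F →* F) c) = θ c)
    (h4 : ∃ t, θ t ^ 4 ≠ 1) :
    ∃ A : FDRep ℂ (MulAut (PS F)), ∃ χ : FDRep ℂ (PS F), Simple χ ∧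
      Module.finrank ℂ χ = p ^ a + 1 ∧ ∀ s, A.character (MulAut.conj s) = χ.character s := by
  classical
  letI : Fintype (MulAut (PS F)) := Fintype.ofFinite _
  letI : Fintype (Bh F) := Fintype.ofFinite _
  letI : Fintype (PS F) := Fintype.ofFinite _
  set Θ := thh h2 θ hθ with hΘ
  set j := (Bh F).subtype with hj
  let ρ := indRep j Θ
  let ρ' : Representation ℂ (PS F) (indSpace j Θ) := ρ.comp MulAut.conj
  refine ⟨FDRep.of ρ, FDRep.of ρ', ?_, ?_, fun s => rfl⟩
  · have hform : ∀ α : MulAut (PS F), ∃ (β : Bh F) (s : PS F), α = β.1 * MulAut.conj s := by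
      intro α
      obtain ⟨s, hs⟩ := aut_conj ha hF h2 α⁻¹
      refine ⟨⟨α * MulAut.conj s, ?_⟩, s⁻¹, by simp⟩
      rw [MulAction.mem_stabilizer_iff, mul_smul, ← hs, smul_inv_smul]
    let v0 : indSpace j Θ := ⟨fun α => if h : α ∈ Bh F then Θ ⟨α, h⟩ else 0, by
      intro h g
      simp only
      by_cases hg : g ∈ Bh F
      · have : j h * g ∈ Bh F := mul_mem h.2 hg
        rw [dif_pos hg, dif_pos this, ← Units.val_mul, ← map_mul]
        rfl
      · have : j h * g ∉ Bh F := fun h' => hg ((Subgroup.mul_mem_cancel_left _ h.2).1 h')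
        rw [dif_neg hg, dif_neg this, mul_zero]⟩
    have v0b : ∀ b : Bh F, v0.1 b.1 = Θ b := fun b => dif_pos b.2
    have v0n : ∀ α, α ∉ Bh F → v0.1 α = 0 := fun α h => dif_neg h
    apply simple_of_end
    · refine ⟨v0, fun h => ?_⟩
      have := v0b 1
      rw [h] at this
      simp at this
    · intro T hT
      have hT' : ∀ s v, T (ρ (MulAut.conj s) v) = ρ (MulAut.conj s) (T v) := hT
      -- equivariance of v0
      have hv0 : ∀ (g : SL F) (hg : MulAut.conj (mkS g) ∈ Bh F),
          ρ (MulAut.conj (mkS g)) v0 = (Θ ⟨_, hg⟩ : ℂ) • v0 := by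
        intro g hg
        ext α
        change v0.1 (α * MulAut.conj (mkS g)) = (Θ ⟨_, hg⟩ : ℂ) * v0.1 α
        by_cases hα : α ∈ Bh F
        · have e := v0b (⟨α, hα⟩ * ⟨_, hg⟩)
          have e2 := v0b ⟨α, hα⟩
          simp only [Subgroup.coe_mul] at e e2
          rw [e, e2, map_mul, Units.val_mul, mul_comm]
        · rw [v0n _ hα, v0n, mul_zero]
          exact fun h' => hα ((Subgroup.mul_mem_cancel_right _ hg).1 h')
      set f := T v0 with hf
      have hfe : ∀ (g : SL F) (hg : MulAut.conj (mkS g) ∈ Bh F) (α : MulAut (PS F)),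
          f.1 (α * MulAut.conj (mkS g)) = Θ ⟨_, hg⟩ * f.1 α := by
        intro g hg α
        have := hT' (mkS g) v0
        rw [hv0 g hg, map_smul] at this
        have := congrArg (fun w : indSpace j Θ => w.1 α) this
        exact this.symm
      have hfw : f.1 (MulAut.conj (mkS ww)) = 0 := by
        obtain ⟨t, ht⟩ := h4
        have hd : ∀ t : Fˣ, MulAut.conj (mkS (dd t)) ∈ Bh F := fun t => (conj_stab_iff h2 _).2 rfl
        have e1 := hfe (dd t) (hd t) (MulAut.conj (mkS ww))
        have e2 := f.2 ⟨_, hd t⁻¹⟩ (MulAut.conj (mkS ww))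
        rw [← map_mul, ← map_mul, dd_ww] at e1
        change f.1 (MulAut.conj (mkS (dd t⁻¹)) * MulAut.conj (mkS ww)) = _ at e2
        rw [← map_mul, ← map_mul] at e2
        have d1 : ∀ t, Θ ⟨_, hd t⟩ = θ (t * t) := fun t => thh_dd h2 θ hθ t
        rw [e1, d1, d1] at e2
        by_contra hne
        have e3 := Units.ext (mul_right_cancel₀ hne e2)
        apply ht
        simp only [map_mul, map_inv] at e3
        have e4 : θ t ^ 4 = (θ t * θ t) * (θ t * θ t) := by
          rw [pow_succ, pow_succ, pow_two]; simp only [mul_assoc]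
        rw [e4]
        nth_rewrite 1 [e3]
        simp [mul_assoc]
      have hfsupp : ∀ α, α ∉ Bh F → f.1 α = 0 := by
        intro α hα
        obtain ⟨β, s, rfl⟩ := hform α
        obtain ⟨g, rfl⟩ := mkS_surj s
        have hg : g.1 1 0 ≠ 0 := by
          intro h
          exact hα (mul_mem β.2 ((conj_stab_iff h2 g).2 h))
        obtain ⟨b, x, hb, rfl⟩ := bruhat g hg
        have e1 := f.2 β (MulAut.conj (mkS (b * ww * uu x)))
        change f.1 (β.1 * _) = _ at e1
        rw [e1, map_mul, map_mul, hfe (uu x) ((conj_stab_iff h2 _).2 rfl), map_mul, map_mul]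
        have e2 := f.2 ⟨_, (conj_stab_iff h2 b).2 hb⟩ (MulAut.conj (mkS ww))
        change f.1 (MulAut.conj (mkS b) * _) = _ at e2
        rw [e2, hfw]; simp
      have hfv : f = f.1 1 • v0 := by
        ext α
        change f.1 α = f.1 1 * v0.1 α
        by_cases hα : α ∈ Bh F
        · have e := f.2 ⟨α, hα⟩ 1
          change f.1 (α * 1) = _ at e
          rw [mul_one] at e
          rw [e, mul_comm]
          congr 1
          exact (v0b ⟨α, hα⟩).symm
        · rw [v0n _ hα, hfsupp _ hα, mul_zero]
      let N : ℕ := (Finset.univ.filter (fun s : PS F => MulAut.conj s ∈ Bh F)).card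
      have hN : (N : ℂ) ≠ 0 := by
        rw [Nat.cast_ne_zero]
        apply Finset.card_ne_zero.2
        exact ⟨1, by simp⟩
      have hgen : ∀ w : indSpace j Θ,
          (N : ℂ) • w = ∑ s : PS F, w.1 (MulAut.conj s) • ρ (MulAut.conj s⁻¹) v0 := by
        intro w
        ext α
        have e0 : (∑ s : PS F, w.1 (MulAut.conj s) • ρ (MulAut.conj s⁻¹) v0).1 α =
            ∑ s : PS F, w.1 (MulAut.conj s) * v0.1 (α * MulAut.conj s⁻¹) := by
          rw [Submodule.coe_sum, Finset.sum_apply]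
          rfl
        rw [e0]
        change (N : ℂ) * w.1 α = _
        obtain ⟨β, x, rfl⟩ := hform α
        rw [← Equiv.sum_comp (Equiv.mulRight x)]
        have e1 : ∀ s : PS F, w.1 (MulAut.conj (Equiv.mulRight x s)) *
            v0.1 (β.1 * MulAut.conj x * MulAut.conj (Equiv.mulRight x s)⁻¹) =
            if MulAut.conj s ∈ Bh F then w.1 (β.1 * MulAut.conj x) else 0 := by
          intro s
          have e2 : β.1 * MulAut.conj x * MulAut.conj (Equiv.mulRight x s)⁻¹ =
              β.1 * (MulAut.conj s)⁻¹ := by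
            simp [mul_assoc]
          rw [e2]
          split_ifs with hs
          · have e3 := v0b (β * ⟨_, hs⟩⁻¹)
            have e4 := w.2 ⟨_, hs⟩ (MulAut.conj x)
            have e5 := w.2 β (MulAut.conj x)
            change w.1 (MulAut.conj s * _) = _ at e4
            change w.1 (β.1 * _) = _ at e5
            change v0.1 (β.1 * (MulAut.conj s)⁻¹) = _ at e3
            have e6 : MulAut.conj (Equiv.mulRight x s) = MulAut.conj s * MulAut.conj x := by simp
            rw [e3, e5, e6, e4, map_mul, map_inv, Units.val_mul]
            have e7 := Units.mul_inv (Θ ⟨_, hs⟩)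
            linear_combination (Θ β : ℂ) * w.1 (MulAut.conj x) * e7
          · rw [v0n, mul_zero]
            intro h'
            exact hs (by simpa using (Subgroup.mul_mem_cancel_left _ β.2).1 h')
        rw [Finset.sum_congr rfl fun s _ => e1 s, Finset.sum_ite, Finset.sum_const_zero, add_zero,
          Finset.sum_const, nsmul_eq_mul]
      refine ⟨f.1 1, fun w => ?_⟩
      have e := congrArg T (hgen w)
      rw [map_smul, map_sum] at e
      simp only [map_smul, hT', ← hf] at e
      rw [hfv] at e
      simp only [map_smul] at e
      rw [← smul_right_injective _ hN |>.eq_iff]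
      change (N : ℂ) • T w = (N : ℂ) • _
      rw [e, smul_comm, hgen w, Finset.smul_sum]
      refine Finset.sum_congr rfl fun s _ => ?_
      rw [smul_comm]
  · have e1 := indRep_character j Θ 1
    change LinearMap.trace ℂ _ _ = _ at e1
    rw [map_one, LinearMap.trace_one] at e1
    change Module.finrank ℂ (indSpace j Θ) = _
    rw [← Bh_index ha hF h2]
    have hc := (Bh F).card_mul_index
    have e2 : (Module.finrank ℂ (indSpace j Θ) : ℂ) =
        (Fintype.card (Bh F) : ℂ)⁻¹ * (Fintype.card (MulAut (PS F)) : ℂ) := by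
      rw [e1, indChar_one j Θ (Bh F).subtype_injective]
    have h0 : (Fintype.card (Bh F) : ℂ) ≠ 0 := Nat.cast_ne_zero.2 Fintype.card_ne_zero
    rw [Nat.card_eq_fintype_card, Nat.card_eq_fintype_card] at hc
    rw [← hc] at e2
    push_cast at e2
    rw [inv_mul_cancel_left₀ h0] at e2
    exact_mod_cast e2

end auts
end Stmt12

open CategoryTheory

namespace Stmt12
set_option linter.unusedSectionVars false
section piS
variable {F : Type} [Field F] [Fintype F] [Fintype (SL F)] [Fintype (Bor F)]

theorem conj_10 (x g : SL F) : (x * g * x⁻¹).1 1 0 =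
    g.1 1 0 * (x.1 1 1 * x.1 1 1) + (g.1 0 0 - g.1 1 1) * (x.1 1 0 * x.1 1 1)
      - g.1 0 1 * (x.1 1 0 * x.1 1 0) := by
  simp only [mul_00, mul_01, mul_10, mul_11, inv_00, inv_01, inv_10, inv_11]
  ring

open Classical in
/-- number of fixed points in the affine line -/
noncomputable def nfix (g : SL F) : ℕ :=
  (Finset.univ.filter fun y : F => g.1 1 0 * (y * y) + (g.1 0 0 - g.1 1 1) * y - g.1 0 1 = 0).card

/-- permutation character -/
noncomputable def piC (F : Type) [Field F] [Fintype F] [Fintype (SL F)] [Fintype (Bor F)] :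
    SL F → ℂ := indChar (Bor F).subtype 1

theorem card_Bor_C [Fintype Fˣ] : (Fintype.card (Bor F) : ℂ) = (Fintype.card Fˣ : ℂ) * Fintype.card F := by
  rw [← Fintype.card_congr (borEquiv (F := F)), Fintype.card_prod, Nat.cast_mul]

open Classical in
theorem piC_eq (g : SL F) : piC F g = (if g.1 1 0 = 0 then 1 else 0) + nfix g := by
  have h0 : (Fintype.card (Bor F) : ℂ) ≠ 0 := Nat.cast_ne_zero.2 Fintype.card_ne_zero
  have e1 : ∀ x : SL F, (∑ h : Bor F, if (Bor F).subtype h = x * g * x⁻¹ then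
      (((1 : Bor F →* ℂˣ) h : ℂˣ) : ℂ) else 0) = if (x * g * x⁻¹).1 1 0 = 0 then 1 else 0 := by
    intro x
    split_ifs with h
    · rw [Finset.sum_eq_single ⟨_, h⟩]
      · simp
      · intro b _ hb
        rw [if_neg]
        intro h'; apply hb; exact Subtype.ext h'
      · simp
    · apply Finset.sum_eq_zero
      intro b _
      rw [if_neg]
      intro h'
      exact h (h' ▸ b.2)
  have e2 : piC F g = (Fintype.card (Bor F) : ℂ)⁻¹ *
      ∑ x : SL F, if (x * g * x⁻¹).1 1 0 = 0 then 1 else 0 := by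
    rw [piC, indChar]
    congr 1
    refine Finset.sum_congr rfl fun x _ => ?_
    convert e1 x
  rw [e2]
  apply mul_left_cancel₀ h0
  rw [mul_inv_cancel_left₀ h0, ← Equiv.sum_comp (slEquiv (F := F)).symm, Fintype.sum_sum_type,
    Fintype.sum_prod_type, Fintype.sum_prod_type, card_Bor_C, mul_add, add_comm]
  congr 1
  · have : ∀ (a : Fˣ) (b : F), ((slEquiv.symm (Sum.inr (a, b)) * g *
        (slEquiv.symm (Sum.inr (a, b)))⁻¹).1 1 0 = 0) ↔ g.1 1 0 = 0 := by
      intro a b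
      rw [conj_10]
      change g.1 1 0 * (((a⁻¹ : Fˣ) : F) * (a⁻¹ : Fˣ)) + (g.1 0 0 - g.1 1 1) * (0 * (a⁻¹ : Fˣ)) -
        g.1 0 1 * (0 * 0) = 0 ↔ _
      simp
    simp only [this]
    simp
  · have : ∀ (a : F) (c : Fˣ), (∑ d : F, if (slEquiv.symm (Sum.inl (a, c, d)) * g *
        (slEquiv.symm (Sum.inl (a, c, d)))⁻¹).1 1 0 = 0 then (1 : ℂ) else 0) = nfix g := by
      intro a c
      rw [← Equiv.sum_comp (Units.mulLeft c)]
      rw [nfix, Finset.sum_boole]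
      congr 2
      refine Finset.filter_congr fun y _ => ?_
      rw [conj_10]
      change g.1 1 0 * ((c * y) * (c * y)) + (g.1 0 0 - g.1 1 1) * (c * (c * y)) -
        g.1 0 1 * ((c : F) * c) = 0 ↔ _
      have : g.1 1 0 * ((c * y) * (c * y)) + (g.1 0 0 - g.1 1 1) * (c * (c * y)) -
        g.1 0 1 * ((c : F) * c) = c * c * (g.1 1 0 * (y * y) + (g.1 0 0 - g.1 1 1) * y - g.1 0 1) := by
        ring
      rw [this]
      simp
    simp only [Fintype.sum_prod_type, this]
    simp
    ring

theorem piC_inv (g : SL F) : piC F g⁻¹ = piC F g := by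
  classical
  rw [piC_eq, piC_eq, nfix, nfix]
  simp only [inv_00, inv_01, inv_10, inv_11, neg_eq_zero]
  congr 3
  refine Finset.filter_congr fun y _ => ?_
  rw [← neg_eq_zero]
  ring_nf

theorem piC_conj (x g : SL F) : piC F (x * g * x⁻¹) = piC F g := indChar_conj _ _ _ _

theorem piC_neg (g : SL F) : piC F (-g) = piC F g := by
  classical
  rw [piC_eq, piC_eq, nfix, nfix]
  simp only [neg_00, neg_01, neg_10, neg_11, neg_eq_zero]
  congr 3
  refine Finset.filter_congr fun y _ => ?_
  rw [← neg_eq_zero]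
  ring_nf

theorem piC_one : piC F 1 = Fintype.card F + 1 := by
  classical
  rw [piC_eq, nfix]
  simp only [one_00, one_01, one_10, one_11]
  simp
  ring

theorem piC_small (g : SL F) (h1 : g ≠ 1) (h2 : g ≠ -1) :
    piC F g = 0 ∨ piC F g = 1 ∨ piC F g = 2 := by
  classical
  rw [piC_eq]
  by_cases hc : g.1 1 0 = 0
  · rw [if_pos hc]
    have hle : nfix g ≤ 1 := by
      rw [nfix, Finset.card_le_one]
      intro y hy z hz
      simp only [hc, Finset.mem_filter, Finset.mem_univ, true_and] at hy hz
      by_contra hyz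
      have e1 : (g.1 0 0 - g.1 1 1) * (y - z) = 0 := by linear_combination hy - hz
      have e2 : g.1 0 0 - g.1 1 1 = 0 := by
        rcases mul_eq_zero.1 e1 with h | h
        · exact h
        · exact absurd (sub_eq_zero.1 h) hyz
      have e3 : g.1 0 1 = 0 := by
        rw [e2] at hy; linear_combination -hy
      have hm : g ∈ Subgroup.center (SL F) := by
        rw [Subgroup.mem_center_iff]
        intro x
        have e4 : g.1 1 1 = g.1 0 0 := by linear_combination -e2
        apply ext4 <;> simp only [mul_00, mul_01, mul_10, mul_11, hc, e3, e4] <;> ring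
      rcases (mem_center g).1 hm with h | h
      · exact h1 h
      · exact h2 h
    interval_cases nfix g
    · right; left; simp
    · right; right; norm_num
  · rw [if_neg hc]
    have hle : nfix g ≤ 2 := by
      by_contra hlt
      rw [not_le, nfix, Finset.two_lt_card] at hlt
      obtain ⟨x, hx, y, hy, z, hz, hxy, hxz, hyz⟩ := hlt
      simp only [Finset.mem_filter, Finset.mem_univ, true_and] at hx hy hz
      have e1 : (x - y) * (g.1 1 0 * (x + y) + (g.1 0 0 - g.1 1 1)) = 0 := by
        linear_combination hx - hy
      have e2 : (x - z) * (g.1 1 0 * (x + z) + (g.1 0 0 - g.1 1 1)) = 0 := by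
        linear_combination hx - hz
      have e3 := (mul_eq_zero.1 e1).resolve_left (sub_ne_zero.2 hxy)
      have e4 := (mul_eq_zero.1 e2).resolve_left (sub_ne_zero.2 hxz)
      have e5 : g.1 1 0 * (y - z) = 0 := by linear_combination e3 - e4
      rcases mul_eq_zero.1 e5 with h | h
      · exact hc h
      · exact hyz (sub_eq_zero.1 h)
    interval_cases nfix g
    · left; simp
    · right; left; simp
    · right; right; simp

theorem sum_piC : ∑ g, piC F g = Fintype.card (SL F) := by
  have h0 : (Fintype.card (Bor F) : ℂ) ≠ 0 := Nat.cast_ne_zero.2 Fintype.card_ne_zero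
  have := indChar_sum (Bor F).subtype 1 (fun _ => 1) (by simp)
  simp at this
  exact this

theorem sum_piC_Bor : ∑ b : Bor F, piC F b.1 = 2 * Fintype.card (Bor F) := by
  classical
  rw [← Equiv.sum_comp (borEquiv (F := F))]
  have : ∀ b, piC F (borEquiv b).1 = 1 + nfix (borEquiv (F := F) b).1 := by
    intro b
    rw [piC_eq, if_pos ((mem_Bor _).1 (borEquiv b).2)]
  rw [Finset.sum_congr rfl fun b _ => this b, Finset.sum_add_distrib,
    Fintype.sum_prod_type (f := fun b => (nfix (borEquiv (F := F) b).1 : ℂ))]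
  have h2 : ∀ t : Fˣ, ∑ x : F, (nfix (borEquiv (t, x)).1 : ℂ) = Fintype.card F := by
    intro t
    have h3 : ∀ x : F, (nfix (borEquiv (t, x)).1 : ℂ) =
        ∑ y : F, if ((t : F) - (t⁻¹ : Fˣ)) * y = x then 1 else 0 := by
      intro x
      rw [nfix, Finset.sum_boole]
      congr 2
      refine Finset.filter_congr fun y _ => ?_
      change 0 * (y * y) + ((t : F) - (t⁻¹ : Fˣ)) * y - x = 0 ↔ _
      rw [zero_mul, zero_add, sub_eq_zero]
    rw [Finset.sum_congr rfl fun x _ => h3 x, Finset.sum_comm]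
    simp
  rw [Finset.sum_congr rfl fun t _ => h2 t, card_Bor_C]
  simp
  ring

theorem sum_piC_sq : ∑ g, piC F g * piC F g = 2 * Fintype.card (SL F) := by
  have h0 : (Fintype.card (Bor F) : ℂ) ≠ 0 := Nat.cast_ne_zero.2 Fintype.card_ne_zero
  have := indChar_sum (Bor F).subtype 1 (piC F) piC_conj
  simp only [MonoidHom.one_apply, Units.val_one, one_mul, Subgroup.coe_subtype, sum_piC_Bor] at this
  change ∑ g, piC F g * piC F g = _ at this
  rw [this]
  field_simp

/-- the function pi^2 - 2 pi -/
noncomputable def ff (F : Type) [Field F] [Fintype F] [Fintype (SL F)] [Fintype (Bor F)]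
    (g : SL F) : ℂ := piC F g * piC F g - 2 * piC F g

theorem sum_ff : ∑ g, ff F g = 0 := by
  simp only [ff, Finset.sum_sub_distrib, ← Finset.mul_sum, sum_piC, sum_piC_sq, sub_self]

theorem ff_one : ff F 1 = (Fintype.card F : ℂ) ^ 2 - 1 := by
  rw [ff, piC_one]; ring

theorem ff_neg_one : ff F (-1) = (Fintype.card F : ℂ) ^ 2 - 1 := by
  rw [ff, piC_neg, piC_one]; ring

theorem sum_ff_sq (h2 : (2 : F) ≠ 0) :
    ∑ g, ff F g * ff F g = 2 * (Fintype.card F : ℂ) ^ 2 * ((Fintype.card F : ℂ) ^ 2 - 1) := by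
  classical
  have e : ∑ g, (ff F g * ff F g + ff F g) = ∑ g ∈ ({1, -1} : Finset (SL F)), (ff F g * ff F g + ff F g) := by
    symm
    apply Finset.sum_subset (Finset.subset_univ _)
    intro g _ hg
    simp only [Finset.mem_insert, Finset.mem_singleton, not_or] at hg
    rcases piC_small g hg.1 hg.2 with h | h | h <;> rw [ff, h] <;> ring
  rw [Finset.sum_add_distrib, sum_ff, add_zero, Finset.sum_pair (neg_one_ne h2), ff_one, ff_neg_one] at e
  rw [e]; ring

end piS
end Stmt12

open CategoryTheory

namespace Stmt12
set_option linter.unusedSectionVars false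
section torus
variable {F : Type} [Field F]

/-- nonsplit torus -/
def Tor (d : F) : Subgroup (SL F) where
  carrier := {g | g.1 1 1 = g.1 0 0 ∧ g.1 0 1 = d * g.1 1 0}
  mul_mem' := by
    rintro a b ⟨ha, ha'⟩ ⟨hb, hb'⟩
    refine ⟨?_, ?_⟩ <;> simp only [mul_00, mul_01, mul_10, mul_11, ha, ha', hb, hb'] <;> ring
  one_mem' := ⟨rfl, by simp [one_01, one_10]⟩
  inv_mem' := by
    rintro a ⟨ha, ha'⟩
    refine ⟨?_, ?_⟩ <;> simp only [inv_00, inv_01, inv_10, inv_11, ha, ha'] <;> ring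

theorem mem_Tor (d : F) (g : SL F) : g ∈ Tor d ↔ g.1 1 1 = g.1 0 0 ∧ g.1 0 1 = d * g.1 1 0 := Iff.rfl

theorem Tor_comm {d : F} {g h : SL F} (hg : g ∈ Tor d) (hh : h ∈ Tor d) : g * h = h * g := by
  obtain ⟨ha, ha'⟩ := hg
  obtain ⟨hb, hb'⟩ := hh
  apply ext4 <;> simp only [mul_00, mul_01, mul_10, mul_11, ha, ha', hb, hb'] <;> ring

theorem neg_mem_Tor {d : F} {g : SL F} (hg : g ∈ Tor d) : -g ∈ Tor d := by
  obtain ⟨ha, ha'⟩ := hg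
  refine ⟨?_, ?_⟩ <;> simp only [neg_00, neg_01, neg_10, neg_11, ha, ha']
  ring

/-- commutative group structure -/
instance Tor_commGroup (d : F) : CommGroup (Tor d) :=
  { (inferInstance : Group (Tor d)) with
    mul_comm := fun a b => Subtype.ext (Tor_comm a.2 b.2) }

theorem Tor_det {d : F} {g : SL F} (hg : g ∈ Tor d) :
    g.1 0 0 * g.1 0 0 - d * (g.1 1 0 * g.1 1 0) = 1 := by
  have := det4 g
  rw [hg.1, hg.2] at this
  linear_combination this

theorem Tor_ext {d : F} {g h : SL F} (hg : g ∈ Tor d) (hh : h ∈ Tor d)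
    (h0 : g.1 0 0 = h.1 0 0) (h1 : g.1 1 0 = h.1 1 0) : g = h := by
  apply ext4
  · exact h0
  · rw [hg.2, hh.2, h1]
  · exact h1
  · rw [hg.1, hh.1, h0]

theorem Tor_v_ne {d : F} {g : SL F} (hg : g ∈ Tor d) (h1 : g ≠ 1) (h2 : g ≠ -1) : g.1 1 0 ≠ 0 := by
  intro h
  have e := Tor_det hg
  rw [h] at e
  have : (g.1 0 0 - 1) * (g.1 0 0 + 1) = 0 := by linear_combination e
  rcases mul_eq_zero.1 this with h' | h'
  · exact h1 (Tor_ext hg (one_mem _) (by rw [one_00]; linear_combination h') (by rw [h, one_10]))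
  · exact h2 (Tor_ext hg (neg_mem_Tor (one_mem _)) (by rw [neg_00, one_00]; linear_combination h')
      (by rw [h, neg_10, one_10]; simp))

theorem Tor_cyclic (d : F) (hd : ¬ IsSquare d) [Finite F] : IsCyclic (Tor d) := by
  obtain ⟨r, hr⟩ := IsAlgClosed.exists_pow_nat_eq (algebraMap F (AlgebraicClosure F) d) (n := 2) (by norm_num)
  let ι := algebraMap F (AlgebraicClosure F)
  let f : Tor d →* AlgebraicClosure F :=
    { toFun := fun g => ι (g.1.1 0 0) + r * ι (g.1.1 1 0)
      map_one' := by
        simp only [Subgroup.coe_one, one_00, one_10]; simp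
      map_mul' := by
        intro g h
        simp only [Subgroup.coe_mul, mul_00, mul_10, map_add, map_mul, g.2.1, g.2.2]
        linear_combination (-(ι (g.1.1 1 0) * ι (h.1.1 1 0))) * hr }
  refine isCyclic_of_subgroup_isDomain f ?_
  intro g h hgh
  have hgh : ι (g.1.1 0 0) + r * ι (g.1.1 1 0) = ι (h.1.1 0 0) + r * ι (h.1.1 1 0) := hgh
  have key : g.1.1 1 0 = h.1.1 1 0 := by
    by_contra hne
    have hne' : ι (g.1.1 1 0) - ι (h.1.1 1 0) ≠ 0 := by
      rw [sub_ne_zero]; exact fun h' => hne (ι.injective h')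
    have hr2 : r = ι ((h.1.1 0 0 - g.1.1 0 0) / (g.1.1 1 0 - h.1.1 1 0)) := by
      rw [map_div₀, map_sub, map_sub, eq_div_iff hne']
      linear_combination hgh
    apply hd
    refine ⟨(h.1.1 0 0 - g.1.1 0 0) / (g.1.1 1 0 - h.1.1 1 0), ?_⟩
    apply ι.injective
    rw [map_mul, ← hr2, ← hr]; ring
  apply Subtype.ext
  refine Tor_ext g.2 h.2 ?_ key
  rw [key] at hgh
  exact ι.injective (add_right_cancel hgh)

/-- parametrization -/
theorem card_Tor [Finite F] (d : F) (hd : ¬ IsSquare d) (h2 : (2 : F) ≠ 0) :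
    Nat.card (Tor d) = Nat.card F + 1 := by
  classical
  have hn : ∀ t : F, 1 - d * (t * t) ≠ 0 := by
    intro t h
    apply hd
    have ht : t ≠ 0 := by rintro rfl; simp at h
    refine ⟨t⁻¹, ?_⟩
    field_simp
    linear_combination -h
  rw [← Finite.card_option]
  let f : Option F → Tor d := fun o => match o with
    | none => ⟨-1, neg_mem_Tor (one_mem _)⟩
    | some t => ⟨mk2 ((1 + d * (t * t)) / (1 - d * (t * t))) (d * (2 * t / (1 - d * (t * t))))
        (2 * t / (1 - d * (t * t))) ((1 + d * (t * t)) / (1 - d * (t * t))) (by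
          have := hn t
          rw [← pow_two] at this ⊢
          field_simp; ring), rfl, rfl⟩
  refine (Nat.card_congr (Equiv.ofBijective f ⟨?_, ?_⟩)).symm
  · have hns : ∀ t, f none ≠ f (some t) := by
      intro t h
      have h' := congrArg (fun g : Tor d => g.1.1 0 0) h
      have h' : (-1 : F) = (1 + d * (t * t)) / (1 - d * (t * t)) := h'
      have := hn t
      rw [eq_div_iff this] at h'
      apply h2; linear_combination -h'
    rintro (_ | t) (_ | s) h
    · rfl
    · exact absurd h (hns s)
    · exact absurd h.symm (hns t)
    · have h0 := congrArg (fun g : Tor d => g.1.1 0 0) h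
      have h1 := congrArg (fun g : Tor d => g.1.1 1 0) h
      have h0 : (1 + d * (t * t)) / (1 - d * (t * t)) = (1 + d * (s * s)) / (1 - d * (s * s)) := h0
      have h1 : 2 * t / (1 - d * (t * t)) = 2 * s / (1 - d * (s * s)) := h1
      have a1 := hn t
      have a2 := hn s
      have k : ∀ t : F, 1 - d * (t * t) ≠ 0 → t * (1 + (1 + d * (t * t)) / (1 - d * (t * t))) = 2 * t / (1 - d * (t * t)) := by
        intro t ht; rw [eq_div_iff ht, mul_assoc, add_mul, div_mul_cancel₀ _ ht]; ring
      have k0 : ∀ t : F, 1 - d * (t * t) ≠ 0 → (1 + (1 + d * (t * t)) / (1 - d * (t * t))) ≠ 0 := by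
        intro t ht h
        rw [← pow_two] at ht h
        field_simp at h
        apply h2; linear_combination h
      have e := k t a1
      rw [h1, h0, ← k s a2] at e
      rw [mul_right_cancel₀ (k0 s a2) e]
  · rintro ⟨g, hg⟩
    have hdet := Tor_det hg
    by_cases hu : g.1 0 0 = -1
    · refine ⟨none, Subtype.ext ?_⟩
      refine Tor_ext (neg_mem_Tor (one_mem _)) hg ?_ ?_
      · rw [hu]; rfl
      · rw [hu] at hdet
        have hd0 : d ≠ 0 := by rintro rfl; exact hd ⟨0, by simp⟩
        have : d * (g.1 1 0 * g.1 1 0) = 0 := by linear_combination -hdet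
        have : g.1 1 0 = 0 := by simpa [hd0] using this
        rw [this, neg_10, one_10]; simp
    · have hu' : 1 + g.1 0 0 ≠ 0 := by
        intro h; apply hu; linear_combination h
      refine ⟨some (g.1 1 0 / (1 + g.1 0 0)), Subtype.ext ?_⟩
      set t := g.1 1 0 / (1 + g.1 0 0) with ht
      have e1 : (1 - d * (t * t)) * (1 + g.1 0 0) = 2 := by
        rw [ht]; field_simp; linear_combination hdet
      have e2 : (1 + d * (t * t)) * (1 + g.1 0 0) = 2 * g.1 0 0 := by
        linear_combination -e1 + 2 * (1 + g.1 0 0) - 2 + 2 - 2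
      have e3 : t * (1 + g.1 0 0) = g.1 1 0 := by rw [ht]; field_simp
      have a1 := hn t
      refine Tor_ext (f (some t)).2 hg ?_ ?_
      · change (1 + d * (t * t)) / (1 - d * (t * t)) = _
        rw [div_eq_iff a1]
        apply mul_right_cancel₀ hu'
        linear_combination e2 - g.1 0 0 * e1
      · change 2 * t / (1 - d * (t * t)) = _
        rw [div_eq_iff a1]
        apply mul_right_cancel₀ hu'
        linear_combination 2 * e3 - g.1 1 0 * e1

theorem exists_norm [Fintype F] (h2 : (2 : F) ≠ 0) (d : F) (hd : d ≠ 0) (e : F) :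
    ∃ u v : F, u * u - d * (v * v) = e := by
  have hodd : Fintype.card F % 2 = 1 := by
    apply FiniteField.odd_card_of_char_ne_two
    intro h
    apply h2
    have := CharP.cast_eq_zero F (ringChar F)
    rw [h] at this
    exact_mod_cast this
  open Polynomial in
  obtain ⟨u, v, h⟩ := FiniteField.exists_root_sum_quadratic (f := (X ^ 2 - C e : F[X]))
    (g := (C (-d) * X ^ 2 : F[X])) (degree_X_pow_sub_C (by norm_num) _)
    (degree_C_mul_X_pow 2 (neg_ne_zero.2 hd)) hodd
  refine ⟨u, v, ?_⟩
  simp at h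
  linear_combination h

theorem Tor_of_comm {d : F} {t x : SL F} (ht : t ∈ Tor d) (hv : t.1 1 0 ≠ 0) (h : x * t = t * x) :
    x ∈ Tor d := by
  have h0 := congrArg (fun m : SL F => m.1 0 0) h
  have h1 := congrArg (fun m : SL F => m.1 1 0) h
  simp only [mul_00, mul_01, mul_10, mul_11, ht.1, ht.2] at h0 h1
  constructor
  · apply mul_right_cancel₀ hv
    linear_combination h1
  · apply mul_right_cancel₀ hv
    linear_combination h0

theorem Tor_conj {d : F} (hd : d ≠ 0) {t x : SL F} (ht : t ∈ Tor d) (h2 : (2 : F) ≠ 0)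
    (h : x * t * x⁻¹ ∈ Tor d) : x * t * x⁻¹ = t ∨ x * t * x⁻¹ = t⁻¹ := by
  set s := x * t * x⁻¹ with hs
  have htr : s.1 0 0 + s.1 1 1 = t.1 0 0 + t.1 1 1 := by
    have := det4 x
    rw [hs]
    simp only [mul_00, mul_01, mul_10, mul_11, inv_00, inv_01, inv_10, inv_11]
    linear_combination (t.1 0 0 + t.1 1 1) * this
  rw [h.1, ht.1] at htr
  have h00 : s.1 0 0 = t.1 0 0 := by
    apply mul_right_cancel₀ h2
    linear_combination htr
  have e1 := Tor_det h
  have e2 := Tor_det ht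
  rw [h00] at e1
  have e3 : d * ((s.1 1 0 - t.1 1 0) * (s.1 1 0 + t.1 1 0)) = 0 := by linear_combination e2 - e1
  rcases mul_eq_zero.1 ((mul_eq_zero.1 e3).resolve_left hd) with h' | h'
  · left; exact Tor_ext h ht h00 (sub_eq_zero.1 h')
  · right
    refine Tor_ext h (inv_mem ht) ?_ ?_
    · rw [inv_00, ht.1, h00]
    · rw [inv_10]; linear_combination h'

theorem Tor_flip [Fintype F] (h2 : (2 : F) ≠ 0) {d : F} (hd : d ≠ 0) :
    ∃ n : SL F, ∀ t ∈ Tor d, n * t * n⁻¹ = t⁻¹ := by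
  obtain ⟨u, v, h⟩ := exists_norm h2 d hd (-1)
  refine ⟨mk2 u (-(d * v)) v (-u) (by linear_combination -h), ?_⟩
  intro t ht
  apply ext4 <;> simp only [mul_00, mul_01, mul_10, mul_11, inv_00, inv_01, inv_10, inv_11, mk2_00,
    mk2_01, mk2_10, mk2_11, ht.1, ht.2]
  · linear_combination (-t.1 0 0) * h
  · linear_combination (d * t.1 1 0) * h
  · linear_combination (t.1 1 0) * h
  · linear_combination (-t.1 0 0) * h

variable [Fintype F] [Fintype (SL F)] 

theorem piC_Tor [Fintype (Bor F)] {d : F} (hd : ¬ IsSquare d) {t : SL F} (ht : t ∈ Tor d)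
    (h1 : t ≠ 1) (h2 : t ≠ -1) : piC F t = 0 := by
  classical
  have hv := Tor_v_ne ht h1 h2
  rw [piC_eq, if_neg hv, nfix, Finset.filter_false_of_mem]
  · simp
  · intro y _ h
    rw [ht.1, ht.2] at h
    apply hd
    refine ⟨y, ?_⟩
    have : t.1 1 0 * (d - y * y) = 0 := by linear_combination -h
    exact sub_eq_zero.1 ((mul_eq_zero.1 this).resolve_left hv)

theorem ind_Tor {d : F} [Fintype (Tor d)] (hd : d ≠ 0) (h2 : (2 : F) ≠ 0) (η : Tor d →* ℂˣ)
    (t : Tor d) (h1 : t.1 ≠ 1) (h3 : t.1 ≠ -1) :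
    indChar (Tor d).subtype η t.1 = (η t : ℂ) + (η t⁻¹ : ℂ) := by
  classical
  obtain ⟨n, hn⟩ := Tor_flip h2 hd
  have hv := Tor_v_ne t.2 h1 h3
  have h0 : (Fintype.card (Tor d) : ℂ) ≠ 0 := Nat.cast_ne_zero.2 Fintype.card_ne_zero
  have htt : t.1 ≠ (t.1)⁻¹ := by
    intro h
    have := congrArg (fun m : SL F => m.1 1 0) h
    simp only [inv_10] at this
    have : 2 * t.1.1 1 0 = 0 := by linear_combination this
    exact hv ((mul_eq_zero.1 this).resolve_left h2)
  have ex : ∀ x : SL F, (∑ h : Tor d, if (Tor d).subtype h = x * t.1 * x⁻¹ then (η h : ℂ) else 0) =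
      (∑ k : Tor d, if k.1 = x then (η t : ℂ) else 0) +
      (∑ k : Tor d, if n * k.1 = x then (η t⁻¹ : ℂ) else 0) := by
    intro x
    have ca : x ∈ Tor d → x * t.1 * x⁻¹ = t.1 := fun h => by
      rw [Tor_comm h t.2, mul_inv_cancel_right]
    have cb : n⁻¹ * x ∈ Tor d → x * t.1 * x⁻¹ = (t.1)⁻¹ := fun h => by
      have e1 : (n⁻¹ * x) * t.1 * (n⁻¹ * x)⁻¹ = t.1 := by
        rw [Tor_comm h t.2, mul_inv_cancel_right]
      calc x * t.1 * x⁻¹ = n * ((n⁻¹ * x) * t.1 * (n⁻¹ * x)⁻¹) * n⁻¹ := by group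
        _ = _ := by rw [e1, hn _ t.2]
    have ca' : x * t.1 * x⁻¹ = t.1 → x ∈ Tor d := fun h => by
      apply Tor_of_comm t.2 hv
      rw [mul_inv_eq_iff_eq_mul] at h; exact h
    have cb' : x * t.1 * x⁻¹ = (t.1)⁻¹ → n⁻¹ * x ∈ Tor d := fun h => by
      apply Tor_of_comm t.2 hv
      rw [← hn _ t.2] at h
      rw [mul_inv_eq_iff_eq_mul] at h
      rw [mul_assoc, h]; group
    have s1 : ∀ (z : ℂ), (∑ k : Tor d, if k.1 = x then z else 0) = if x ∈ Tor d then z else 0 := by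
      intro z
      split_ifs with h
      · rw [Finset.sum_eq_single ⟨x, h⟩]
        · simp
        · intro b _ hb; rw [if_neg]; exact fun h' => hb (Subtype.ext h')
        · simp
      · apply Finset.sum_eq_zero
        intro b _; rw [if_neg]; exact fun h' => h (h' ▸ b.2)
    have s2 : ∀ (z : ℂ), (∑ k : Tor d, if n * k.1 = x then z else 0) =
        if n⁻¹ * x ∈ Tor d then z else 0 := by
      intro z
      split_ifs with h
      · rw [Finset.sum_eq_single ⟨_, h⟩]
        · simp
        · intro b _ hb; rw [if_neg]; exact fun h' => hb (Subtype.ext (eq_inv_mul_iff_mul_eq.2 h'))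
        · simp
      · apply Finset.sum_eq_zero
        intro b _; rw [if_neg]; exact fun h' => h (by rw [← h']; simp)
    rw [s1, s2]
    by_cases hx : x ∈ Tor d
    · have e := ca hx
      have hx2 : n⁻¹ * x ∉ Tor d := fun h => htt (e.symm.trans (cb h))
      rw [if_pos hx, if_neg hx2, add_zero, e, Finset.sum_eq_single t]
      · simp
      · intro b _ hb; rw [if_neg]; exact fun h' => hb (Subtype.ext h')
      · simp
    · rw [if_neg hx, zero_add]
      by_cases hx2 : n⁻¹ * x ∈ Tor d
      · rw [if_pos hx2, cb hx2, Finset.sum_eq_single t⁻¹]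
        · simp
        · intro b _ hb; rw [if_neg]; exact fun h' => hb (Subtype.ext h')
        · simp
      · rw [if_neg hx2]
        apply Finset.sum_eq_zero
        intro b _
        rw [if_neg]
        intro h'
        have h' : b.1 = x * t.1 * x⁻¹ := h'
        rcases Tor_conj hd t.2 h2 (h' ▸ b.2) with h | h
        · exact hx (ca' h)
        · exact hx2 (cb' h)
  have e2 : indChar (Tor d).subtype η t.1 = (Fintype.card (Tor d) : ℂ)⁻¹ *
      ∑ x : SL F, ((∑ k : Tor d, if k.1 = x then (η t : ℂ) else 0) +
      (∑ k : Tor d, if n * k.1 = x then (η t⁻¹ : ℂ) else 0)) := by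
    rw [indChar]
    congr 1
    refine Finset.sum_congr rfl fun x _ => ?_
    convert ex x
  rw [e2, Finset.sum_add_distrib, Finset.sum_comm]
  rw [Finset.sum_comm (f := fun (x : SL F) (k : Tor d) => if n * k.1 = x then (η t⁻¹ : ℂ) else 0)]
  simp only [Finset.sum_ite_eq, Finset.mem_univ, if_true, Finset.sum_const, nsmul_eq_mul,
    Finset.card_univ]
  field_simp

end torus
end Stmt12

open CategoryTheory

namespace Stmt12
set_option linter.unusedSectionVars false
section chi2
variable {F : Type} [Field F] [Fintype F] [Fintype (SL F)] [Fintype (Bor F)]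

/-- minus one in the torus -/
def mone (d : F) : Tor d := ⟨-1, neg_mem_Tor (one_mem _)⟩

theorem sum_T (h2 : (2 : F) ≠ 0) {d : F} [Fintype (Tor d)] (f : Tor d → ℂ)
    (hf : ∀ t, t.1 ≠ 1 → t.1 ≠ -1 → f t = 0) : ∑ t, f t = f 1 + f (mone d) := by
  classical
  have hne : (1 : Tor d) ≠ mone d := fun h => neg_one_ne h2 (congrArg Subtype.val h)
  rw [← Finset.sum_pair hne]
  symm
  apply Finset.sum_subset (Finset.subset_univ _)
  intro g _ hg
  simp only [Finset.mem_insert, Finset.mem_singleton, not_or] at hg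
  exact hf g (fun h => hg.1 (Subtype.ext h)) (fun h => hg.2 (Subtype.ext h))

theorem card_T_C (h2 : (2 : F) ≠ 0) {d : F} [Fintype (Tor d)] (hd : ¬ IsSquare d) :
    (Fintype.card (Tor d) : ℂ) = Fintype.card F + 1 := by
  rw [← Nat.card_eq_fintype_card, card_Tor d hd h2, Nat.card_eq_fintype_card]; push_cast; rfl

theorem card_SL_C : (Fintype.card (SL F) : ℂ) =
    (Fintype.card F : ℂ) * (Fintype.card F - 1) * (Fintype.card F + 1) := by
  have := card_SL (F := F)
  rw [Nat.card_eq_fintype_card, Nat.card_eq_fintype_card] at this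
  rw [this]
  push_cast
  rw [Nat.cast_pred Fintype.card_pos]

theorem ff_inv (g : SL F) : ff F g⁻¹ = ff F g := by rw [ff, ff, piC_inv]

theorem ff_conj (x g : SL F) : ff F (x * g * x⁻¹) = ff F g := by rw [ff, ff, piC_conj]

theorem I_one (h2 : (2 : F) ≠ 0) {d : F} [Fintype (Tor d)] (hd : ¬ IsSquare d) (η : Tor d →* ℂˣ) :
    indChar (Tor d).subtype η 1 = (Fintype.card F : ℂ) * (Fintype.card F - 1) := by
  have h0 : (Fintype.card (Tor d) : ℂ) ≠ 0 := Nat.cast_ne_zero.2 Fintype.card_ne_zero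
  rw [indChar_one _ _ (Tor d).subtype_injective, card_SL_C]
  rw [card_T_C h2 hd] at h0 ⊢
  field_simp

theorem I_neg_one (h2 : (2 : F) ≠ 0) {d : F} [Fintype (Tor d)] (hd : ¬ IsSquare d) (η : Tor d →* ℂˣ)
    (hη : η (mone d) = 1) :
    indChar (Tor d).subtype η (-1) = (Fintype.card F : ℂ) * (Fintype.card F - 1) := by
  rw [← I_one h2 hd η]
  rw [indChar, indChar]
  congr 1
  refine Finset.sum_congr rfl fun x _ => ?_
  rw [← Equiv.sum_comp (Equiv.mulLeft (mone d))]
  refine Finset.sum_congr rfl fun t _ => ?_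
  have e1 : η (Equiv.mulLeft (mone d) t) = η t := by simp [hη]
  have e2 : (Tor d).subtype (Equiv.mulLeft (mone d) t) = - t.1 := by
    change (-1 : SL F) * t.1 = _
    simp
  rw [e1, e2]
  have : x * (-1) * x⁻¹ = -1 := by simp
  rw [this, mul_one, mul_inv_cancel]
  have key : -t.1 = -1 ↔ (Tor d).subtype t = 1 := ?_
  · by_cases h : (Tor d).subtype t = 1
    · rw [if_pos h, if_pos (key.2 h)]
    · rw [if_neg h, if_neg (fun h' => h (key.1 h'))]
  constructor
  · intro h
    have h' := congrArg (fun g : SL F => -1 * g) h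
    simp only [neg_mul_neg, one_mul] at h'
    exact h'
  · intro h
    have h : t.1 = 1 := h
    rw [h]

theorem sum_I_ff (h2 : (2 : F) ≠ 0) {d : F} [Fintype (Tor d)] (hd : ¬ IsSquare d) (η : Tor d →* ℂˣ)
    (hη : η (mone d) = 1) :
    ∑ g, indChar (Tor d).subtype η g * ff F g =
      Fintype.card (SL F) * (2 * (Fintype.card F - 1)) := by
  have h0 : (Fintype.card (Tor d) : ℂ) ≠ 0 := Nat.cast_ne_zero.2 Fintype.card_ne_zero
  rw [indChar_sum _ _ _ ff_conj, sum_T h2 _ (by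
    intro t h1 h3
    rw [ff, Subgroup.coe_subtype, piC_Tor hd t.2 h1 h3]; ring)]
  simp only [map_one, hη, Units.val_one, one_mul]
  have : (Tor d).subtype (mone d) = -1 := rfl
  rw [this, ff_one, ff_neg_one]
  rw [card_T_C h2 hd] at h0 ⊢
  field_simp
  ring

theorem sum_I_I (h2 : (2 : F) ≠ 0) {d : F} [Fintype (Tor d)] (hd : ¬ IsSquare d) (η : Tor d →* ℂˣ)
    (hη : η (mone d) = 1) (hη2 : η ^ 2 ≠ 1) :
    ∑ g, indChar (Tor d).subtype η g * indChar (Tor d).subtype η g⁻¹ =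
      Fintype.card (SL F) * (2 * Fintype.card F - 3) := by
  have h0 : (Fintype.card (Tor d) : ℂ) ≠ 0 := Nat.cast_ne_zero.2 Fintype.card_ne_zero
  have hd0 : d ≠ 0 := by rintro rfl; exact hd ⟨0, by simp⟩
  rw [indChar_sum (Tor d).subtype η (fun g => indChar (Tor d).subtype η g⁻¹) (by
    intro x g
    have : (x * g * x⁻¹)⁻¹ = x * g⁻¹ * x⁻¹ := by group
    rw [this, indChar_conj])]
  have hs : ∑ t : Tor d, ((η t : ℂ) * indChar (Tor d).subtype η ((Tor d).subtype t)⁻¹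
      - (1 + (η t : ℂ) ^ 2)) = 2 * ((Fintype.card F : ℂ) * (Fintype.card F - 1) - 2) := by
    rw [sum_T h2]
    · have e1 : (Tor d).subtype (mone d) = -1 := rfl
      have e2 : (-1 : SL F)⁻¹ = -1 := by simp
      rw [e1, e2, I_neg_one h2 hd η hη, hη]
      simp only [map_one, inv_one]
      rw [I_one h2 hd]
      simp only [Units.val_one]
      ring
    · intro t h1 h3
      have e := ind_Tor hd0 h2 η t⁻¹ (by simpa using h1) (by
        intro h
        apply h3
        have : (t⁻¹).1 = (t.1)⁻¹ := rfl
        rw [this, inv_eq_iff_eq_inv] at h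
        rw [h]; simp)
      have e1 : ((Tor d).subtype t)⁻¹ = (t⁻¹).1 := rfl
      rw [e1, e, inv_inv, map_inv]
      have := Units.mul_inv (η t)
      linear_combination this
  have hz : ∑ t : Tor d, (η t : ℂ) ^ 2 = 0 := by
    have := sum_hom_units_eq_zero ((Units.coeHom ℂ).comp (η ^ 2)) (by
      intro h
      apply hη2
      ext t
      have := DFunLike.congr_fun h t
      simpa using this)
    simpa using this
  rw [Finset.sum_sub_distrib, Finset.sum_add_distrib, hz] at hs
  simp only [Finset.sum_const, Finset.card_univ, nsmul_eq_mul, mul_one, add_zero] at hs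
  rw [sub_eq_iff_eq_add] at hs
  rw [hs]
  rw [card_T_C h2 hd] at h0 ⊢
  field_simp
  ring

theorem norm_SL (h2 : (2 : F) ≠ 0) {d : F} [Fintype (Tor d)] (hd : ¬ IsSquare d) (η : Tor d →* ℂˣ)
    (hη : η (mone d) = 1) (hη2 : η ^ 2 ≠ 1) :
    ∑ g, (ff F g - indChar (Tor d).subtype η g) * (ff F g⁻¹ - indChar (Tor d).subtype η g⁻¹) =
      Fintype.card (SL F) := by
  have e : ∀ g, (ff F g - indChar (Tor d).subtype η g) * (ff F g⁻¹ - indChar (Tor d).subtype η g⁻¹)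
     = ff F g * ff F g - indChar (Tor d).subtype η g * ff F g
      - indChar (Tor d).subtype η g⁻¹ * ff F g⁻¹
      + indChar (Tor d).subtype η g * indChar (Tor d).subtype η g⁻¹ := by
    intro g; rw [ff_inv]; ring
  have e2 := Equiv.sum_comp (Equiv.inv (SL F)) (fun g => indChar (Tor d).subtype η g * ff F g)
  simp only [Equiv.inv_apply] at e2
  rw [Finset.sum_congr rfl fun g _ => e g, Finset.sum_add_distrib, Finset.sum_sub_distrib,
    Finset.sum_sub_distrib, e2, sum_I_ff h2 hd η hη, sum_I_I h2 hd η hη hη2, sum_ff_sq h2, card_SL_C]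
  ring

theorem sum_mkS (h2 : (2 : F) ≠ 0) [Fintype (PS F)] (Fn : PS F → ℂ) :
    ∑ x : SL F, Fn (mkS x) = 2 * ∑ s, Fn s := by
  classical
  have hk : Nat.card (mkS (F := F)).ker = 2 := by
    rw [mkS, QuotientGroup.ker_mk', card_center h2]
  rw [← Finset.sum_fiberwise (s := Finset.univ) (g := mkS) (f := fun x => Fn (mkS x)), Finset.mul_sum]
  refine Finset.sum_congr rfl fun s _ => ?_
  rw [Finset.sum_congr rfl (g := fun _ => Fn s) (by
    intro x hx; rw [(Finset.mem_filter.1 hx).2])]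
  rw [Finset.sum_const, nsmul_eq_mul]
  congr 1
  obtain ⟨y, rfl⟩ := mkS_surj s
  have hk2 : (Nat.card (mkS (F := F)).ker : ℂ) = 2 := by rw [hk]; norm_num
  refine Eq.trans ?_ hk2
  rw [Nat.card_eq_fintype_card, Fintype.card_subtype]
  congr 1
  refine Finset.card_bij (fun x _ => x * y⁻¹) ?_ ?_ ?_
  · intro a ha
    simp only [Finset.mem_filter, Finset.mem_univ, true_and] at ha ⊢
    simp [MonoidHom.mem_ker, ha]
  · intro a _ b _ h; simpa using h
  · intro b hb
    simp only [Finset.mem_filter, Finset.mem_univ, true_and, MonoidHom.mem_ker] at hb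
    exact ⟨b * y, by simp [hb], by simp⟩

theorem chi2_exists (h2 : (2 : F) ≠ 0) {d : F} [Fintype (Tor d)] (hd : ¬ IsSquare d) (η : Tor d →* ℂˣ)
    (hη : η (mone d) = 1) (hη2 : η ^ 2 ≠ 1) :
    ∃ U : FDRep ℂ (PS F), Simple U ∧ Module.finrank ℂ U = Fintype.card F - 1 ∧
      ∀ g, U.character (mkS g) = ff F g - indChar (Tor d).subtype η g := by
  classical
  have := Fintype.ofFinite (PS F)
  let π := indRep (mkS.comp (Bor F).subtype) 1
  let ι := indRep (mkS.comp (Tor d).subtype) η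
  have hπ : ∀ g, π.character (mkS g) = piC F g := by
    intro g
    rw [indRep_character, piC, indChar_quot _ mkS_surj]
    intro k hk
    refine ⟨⟨k, ?_⟩, rfl, rfl⟩
    rcases (mkS_ker k).1 hk with rfl | rfl
    · exact one_mem _
    · rw [mem_Bor, neg_10, one_10, neg_zero]
  have hι : ∀ g, ι.character (mkS g) = indChar (Tor d).subtype η g := by
    intro g
    rw [indRep_character, indChar_quot _ mkS_surj]
    intro k hk
    rcases (mkS_ker k).1 hk with rfl | rfl
    · exact ⟨1, rfl, map_one _⟩
    · exact ⟨mone d, rfl, hη⟩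
  let V := indSpace (mkS.comp (Bor F).subtype) 1
  let W := indSpace (mkS.comp (Tor d).subtype) η
  let ρ : Representation ℂ (PS F) (TensorProduct ℂ V V) := π.tprod π
  let σ : Representation ℂ (PS F) ((V × V) × W) := (π.prod π).prod ι
  have hρ : ∀ s, Representation.character (V := TensorProduct ℂ V V) ρ s = π.character s * π.character s := by
    intro s
    exact LinearMap.trace_tensorProduct' _ _
  have hσ : ∀ s, Representation.character (V := (V × V) × W) σ s = π.character s + π.character s + ι.character s := by
    intro s
    have e1 : Representation.character (V := (V × V) × W) σ s = LinearMap.trace ℂ _ (LinearMap.prodMap (LinearMap.prodMap (π s) (π s)) (ι s)) := rfl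
    rw [e1, LinearMap.trace_prodMap', LinearMap.trace_prodMap']
    rfl
  have hd2 : ∀ g : SL F, Representation.character (V := TensorProduct ℂ V V) ρ (mkS g) - Representation.character (V := (V × V) × W) σ (mkS g) =
      ff F g - indChar (Tor d).subtype η g := by
    intro g
    rw [hρ, hσ, hπ, hι, ff]; ring
  obtain ⟨U, hU, hc⟩ := virt _ (TensorProduct ℂ V V) ((V × V) × W) ρ σ le_rfl (by
    have e := sum_mkS h2 (fun s => (Representation.character (V := TensorProduct ℂ V V) ρ s - Representation.character (V := (V × V) × W) σ s) * (Representation.character (V := TensorProduct ℂ V V) ρ s⁻¹ - Representation.character (V := (V × V) × W) σ s⁻¹))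
    simp only [← map_inv, hd2] at e
    rw [norm_SL h2 hd η hη hη2] at e
    have e2 := Subgroup.card_eq_card_quotient_mul_card_subgroup (Subgroup.center (SL F))
    rw [card_center h2, Nat.card_eq_fintype_card] at e2
    rw [e2] at e
    push_cast at e
    linear_combination (-1/2 : ℂ) * e)
  have h1 : ff F 1 - indChar (Tor d).subtype η 1 = (Fintype.card F : ℂ) - 1 := by
    rw [ff_one, I_one h2 hd]; ring
  have hU1 : U.character (mkS 1) = Module.finrank ℂ U := by
    rw [map_one, FDRep.char_one]
  have hq := Fintype.one_lt_card (α := F)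
  rcases hc with hc | hc
  · refine ⟨U, hU, ?_, fun g => by rw [hc, hd2]⟩
    rw [hc, hd2, h1] at hU1
    have : ((Module.finrank ℂ U : ℕ) : ℂ) = ((Fintype.card F - 1 : ℕ) : ℂ) := by
      rw [← hU1]; push_cast [hq.le]; rfl
    exact_mod_cast this
  · exfalso
    rw [hc, ← neg_sub, hd2, h1] at hU1
    have : ((Module.finrank ℂ U + Fintype.card F : ℕ) : ℂ) = ((1 : ℕ) : ℂ) := by
      push_cast; rw [← hU1]; ring
    have : Module.finrank ℂ U + Fintype.card F = 1 := by exact_mod_cast this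
    omega

end chi2
end Stmt12

open CategoryTheory

namespace Stmt12
set_option linter.unusedSectionVars false
section inv
variable {F : Type} [Field F] [Fintype F] [Fintype (SL F)] [Fintype (Bor F)]

theorem indChar_aut {G : Type} [Group G] [Fintype G] (H : Subgroup G) [Fintype H] (θ : H →* ℂˣ)
    (τ : G →* G) (hi : Function.Injective τ) (hτ : ∀ h ∈ H, τ h ∈ H)
    (hθ : ∀ h : H, θ ⟨τ h.1, hτ _ h.2⟩ = θ h) (g : G) :
    indChar H.subtype θ (τ g) = indChar H.subtype θ g := by
  let κ : H → H := fun h => ⟨τ h.1, hτ _ h.2⟩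
  have hκ : Function.Bijective κ := by
    apply Finite.injective_iff_bijective.1
    intro a b h
    exact Subtype.ext (hi (congrArg Subtype.val h))
  rw [indChar, indChar]
  congr 1
  rw [← Equiv.sum_comp (Equiv.ofBijective τ (Finite.injective_iff_bijective.1 hi))]
  refine Finset.sum_congr rfl fun x _ => ?_
  rw [← Equiv.sum_comp (Equiv.ofBijective κ hκ)]
  refine Finset.sum_congr rfl fun h _ => ?_
  have key : H.subtype (Equiv.ofBijective κ hκ h) = Equiv.ofBijective τ (Finite.injective_iff_bijective.1 hi) x *
      τ g * (Equiv.ofBijective τ (Finite.injective_iff_bijective.1 hi) x)⁻¹ ↔ H.subtype h = x * g * x⁻¹ := by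
    change τ h.1 = τ x * τ g * (τ x)⁻¹ ↔ h.1 = _
    rw [← map_inv, ← map_mul, ← map_mul, hi.eq_iff]
  have e : θ (Equiv.ofBijective κ hκ h) = θ h := hθ h
  rw [e]
  by_cases h' : H.subtype h = x * g * x⁻¹
  · rw [if_pos h', if_pos (key.2 h')]
  · rw [if_neg h', if_neg (fun h'' => h' (key.1 h''))]

theorem twist_00 (c : Fˣ) (σ : F ≃+* F) (g : SL F) : (twist c σ g).1 0 0 = σ (g.1 0 0) := rfl
theorem twist_01 (c : Fˣ) (σ : F ≃+* F) (g : SL F) : (twist c σ g).1 0 1 = c * σ (g.1 0 1) := rfl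
theorem twist_10 (c : Fˣ) (σ : F ≃+* F) (g : SL F) :
    (twist c σ g).1 1 0 = (c⁻¹ : Fˣ) * σ (g.1 1 0) := rfl
theorem twist_11 (c : Fˣ) (σ : F ≃+* F) (g : SL F) : (twist c σ g).1 1 1 = σ (g.1 1 1) := rfl

theorem twist_inj (c : Fˣ) (σ : F ≃+* F) : Function.Injective (twist c σ) := by
  intro g h e
  have h0 := congrArg (fun m : SL F => m.1 0 0) e
  have h1 := congrArg (fun m : SL F => m.1 0 1) e
  have h2 := congrArg (fun m : SL F => m.1 1 0) e
  have h3 := congrArg (fun m : SL F => m.1 1 1) e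
  simp only [twist_00, twist_01, twist_10, twist_11] at h0 h1 h2 h3
  apply ext4
  · exact σ.injective h0
  · exact σ.injective (mul_left_cancel₀ (Units.ne_zero _) h1)
  · exact σ.injective (mul_left_cancel₀ (Units.ne_zero _) h2)
  · exact σ.injective h3

theorem piC_twist (c : Fˣ) (σ : F ≃+* F) (g : SL F) : piC F (twist c σ g) = piC F g := by
  refine indChar_aut (Bor F) 1 _ (twist_inj c σ) ?_ ?_ g
  · intro h hh
    rw [mem_Bor] at hh ⊢
    rw [twist_10, hh]; simp
  · intro h; rfl

theorem ff_twist (c : Fˣ) (σ : F ≃+* F) (g : SL F) : ff F (twist c σ g) = ff F g := by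
  rw [ff, ff, piC_twist]

theorem twist_Tor {d : F} {σ : F ≃+* F} (hσ : σ d = d) {t : SL F} (ht : t ∈ Tor d) :
    twist 1 σ t ∈ Tor d := by
  constructor
  · rw [twist_11, twist_00, ht.1]
  · rw [twist_01, twist_10, ht.2, map_mul, hσ]; simp

theorem I_twist (h2 : (2 : F) ≠ 0) {d : F} (hd : d ≠ 0) [Fintype (Tor d)] (η : Tor d →* ℂˣ)
    (c : Fˣ) (σ : F ≃+* F) (hσ : σ d = d) (hη : ∀ t : Tor d, η ⟨twist 1 σ t.1, twist_Tor hσ t.2⟩ = η t)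
    (g : SL F) : indChar (Tor d).subtype η (twist c σ g) = indChar (Tor d).subtype η g := by
  obtain ⟨u, v, h⟩ := exists_norm h2 d hd ((c⁻¹ : Fˣ) : F)
  have hc : (c : F) * ((c⁻¹ : Fˣ) : F) = 1 := c.mul_inv
  let x : SL F := mk2 (c * u) (c * d * v) v u (by linear_combination (c : F) * h + hc)
  let τ : SL F →* SL F := (MulAut.conj x⁻¹).toMonoidHom.comp (twist c σ)
  have hτ : ∀ g, τ g = x⁻¹ * twist c σ g * x := fun g => by
    change x⁻¹ * twist c σ g * x⁻¹⁻¹ = _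
    rw [inv_inv]
  have hτT : ∀ t ∈ Tor d, τ t = twist 1 σ t := by
    intro t ht
    rw [hτ, mul_assoc, inv_mul_eq_iff_eq_mul]
    apply ext4 <;> simp only [mul_00, mul_01, mul_10, mul_11, twist_00, twist_01, twist_10, twist_11, ht.1,
      ht.2, x, mk2_00, mk2_01, mk2_10, mk2_11, map_mul, hσ, Units.val_one, inv_one]
    · ring
    · ring
    · linear_combination u * σ (t.1 1 0) * hc
    · linear_combination d * v * σ (t.1 1 0) * hc
  have hm : ∀ t ∈ Tor d, τ t ∈ Tor d := fun t ht => by rw [hτT t ht]; exact twist_Tor hσ ht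
  have e := indChar_aut (Tor d) η τ ((MulAut.conj x⁻¹).injective.comp (twist_inj c σ)) hm (by
    intro t
    rw [← hη t]
    congr 1
    exact Subtype.ext (hτT t.1 t.2)) g
  rw [← e, hτ]
  have : x⁻¹ * twist c σ g * x = x⁻¹ * twist c σ g * x⁻¹⁻¹ := by rw [inv_inv]
  rw [this, indChar_conj]

theorem tr_conj (y g : SL F) : (y * g * y⁻¹).1 0 0 + (y * g * y⁻¹).1 1 1 = g.1 0 0 + g.1 1 1 := by
  have := det4 y
  simp only [mul_00, mul_01, mul_10, mul_11, inv_00, inv_01, inv_10, inv_11]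
  linear_combination (g.1 0 0 + g.1 1 1) * this

theorem order_sigma (h2 : (2 : F) ≠ 0) (φ : MulAut (PS F)) (s : PS F) (c : Fˣ) (σ : RingAut F)
    (hφ : ∀ g, φ (mkS g) = s * mkS (twist c σ g) * s⁻¹) (n : ℕ) (hn : φ ^ n = 1) : σ ^ n = 1 := by
  obtain ⟨y, rfl⟩ := mkS_surj s
  have key : ∀ (n : ℕ) (g h : SL F), (φ ^ n) (mkS g) = mkS h →
      (h.1 0 0 + h.1 1 1) * (h.1 0 0 + h.1 1 1) =
        (σ ^ n) ((g.1 0 0 + g.1 1 1) * (g.1 0 0 + g.1 1 1)) := by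
    intro n
    induction n with
    | zero =>
      intro g h e
      have e : mkS g = mkS h := e
      rw [pow_zero, RingAut.one_apply]
      rcases (mkS_eq g h).1 e with rfl | rfl
      · rfl
      · simp only [neg_00, neg_11]; ring
    | succ n ih =>
      intro g h e
      obtain ⟨k, hk⟩ := mkS_surj ((φ ^ n) (mkS g))
      have e1 := ih g k hk.symm
      rw [pow_succ', MulAut.mul_apply, ← hk, hφ, ← map_inv, ← map_mul, ← map_mul] at e
      rw [pow_succ', RingAut.mul_apply, ← e1, map_mul, map_add]
      have e2 := tr_conj y (twist c σ k)
      rw [twist_00, twist_11] at e2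
      rcases (mkS_eq _ h).1 e with e | e
      · rw [← e, e2]
      · rw [← e2, e]; simp only [neg_00, neg_11]; ring
  have k2 : ∀ t : F, (σ ^ n) (t * t) = t * t := by
    intro t
    have := key n (mk2 t (-1) 1 0 (by ring)) (mk2 t (-1) 1 0 (by ring)) (by rw [hn]; rfl)
    simp only [mk2_00, mk2_11, add_zero] at this
    exact this.symm
  ext x
  rw [RingAut.one_apply]
  have e1 := k2 (x + 1)
  have e2 := k2 (x - 1)
  have h4 : (2 : F) * 2 ≠ 0 := mul_ne_zero h2 h2
  have e3 : (σ ^ n) (2 * 2 * x) = 2 * 2 * x := by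
    have : 2 * 2 * x = (x + 1) * (x + 1) - (x - 1) * (x - 1) := by ring
    rw [this, map_sub, e1, e2]
  apply mul_left_cancel₀ h4
  rw [← e3, map_mul, map_mul, map_ofNat]

end inv
end Stmt12

open CategoryTheory

namespace Stmt12
set_option linter.unusedSectionVars false

theorem exists_fixed {p : ℕ} [Fact p.Prime] (hp5 : 5 < p) {T : Type} [CommGroup T] [IsCyclic T] [Finite T]
    {Q : Type} [Group Q] [Finite Q] (hQ : IsPGroup p Q) (A : Q →* MulAut T) (m : T) (hm : m ≠ 1)
    (hm2 : m ^ 2 = 1) (k : ℕ) (hc : Nat.card T = p * k + 1) :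
    ∃ ξ : T →* ℂˣ, ξ ^ 4 ≠ 1 ∧ ∀ σ t, ξ (A σ t) = ξ t := by
  classical
  obtain ⟨E⟩ := CommGroup.monoidHom_mulEquiv_of_hasEnoughRootsOfUnity T ℂ
  have hfin : Finite (T →* ℂˣ) := Finite.of_equiv _ E.symm.toEquiv
  have := Fintype.ofFinite T
  have := Fintype.ofFinite (T →* ℂˣ)
  let X := {ξ : T →* ℂˣ // ξ ^ 4 ≠ 1}
  have h4 : ∀ (ξ : T →* ℂˣ) (a : MulAut T), ξ ^ 4 ≠ 1 → (ξ.comp a.toMonoidHom) ^ 4 ≠ 1 := by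
    intro ξ a h h'
    apply h
    ext t
    have := DFunLike.congr_fun h' (a.symm t)
    have e : a (a.symm t) = t := a.apply_symm_apply t
    simp only [MonoidHom.pow_apply, MonoidHom.comp_apply, MulEquiv.toMonoidHom_eq_coe,
      MonoidHom.coe_coe, e] at this
    simpa using congrArg Units.val this
  let act : MulAction Q X :=
    { smul := fun σ ξ => ⟨ξ.1.comp (A σ⁻¹).toMonoidHom, h4 _ _ ξ.2⟩
      one_smul := by
        intro ξ
        apply Subtype.ext
        ext t
        change ((ξ.1 (A 1⁻¹ t) : ℂˣ) : ℂ) = _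
        rw [inv_one, map_one]; rfl
      mul_smul := by
        intro σ τ ξ
        apply Subtype.ext
        ext t
        change ((ξ.1 (A (σ * τ)⁻¹ t) : ℂˣ) : ℂ) = ((ξ.1 (A τ⁻¹ (A σ⁻¹ t)) : ℂˣ) : ℂ)
        rw [mul_inv_rev, map_mul]; rfl }
  have hX : ¬ p ∣ Nat.card X := by
    intro hdvd
    have c1 : Nat.card X + Nat.card {ξ : T →* ℂˣ // ξ ^ 4 = 1} = Nat.card (T →* ℂˣ) := by
      rw [Nat.card_eq_fintype_card, Nat.card_eq_fintype_card, Nat.card_eq_fintype_card]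
      rw [add_comm]
      have := Fintype.card_subtype_compl (fun ξ : T →* ℂˣ => ξ ^ 4 = 1)
      have h' := Fintype.card_subtype_le (fun ξ : T →* ℂˣ => ξ ^ 4 = 1)
      change Fintype.card X = _ at this
      omega
    have c2 : Nat.card (T →* ℂˣ) = Nat.card T := Nat.card_congr E.toEquiv
    have c3 : Nat.card {ξ : T →* ℂˣ // ξ ^ 4 = 1} = Nat.card {t : T // t ^ 4 = 1} :=
      Nat.card_congr (E.toEquiv.subtypeEquiv (by
        intro ξ
        change _ ↔ (E ξ) ^ 4 = 1
        rw [← map_pow, E.map_eq_one_iff]))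
    have c4 : Nat.card {t : T // t ^ 4 = 1} ≤ 4 := by
      rw [Nat.card_eq_fintype_card, Fintype.card_subtype]
      exact IsCyclic.card_pow_eq_one_le (by norm_num)
    have c5 : 1 < Nat.card {t : T // t ^ 4 = 1} := by
      rw [Finite.one_lt_card_iff_nontrivial]
      refine ⟨⟨1, one_pow _⟩, ⟨m, ?_⟩, ?_⟩
      · rw [show 4 = 2 * 2 from rfl, pow_mul, hm2, one_pow]
      · intro h; exact hm (congrArg Subtype.val h).symm
    obtain ⟨l, hl⟩ := hdvd
    set e := Nat.card {t : T // t ^ 4 = 1} with he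
    rw [c2, c3, hc, hl] at c1
    have c6 : p * l + (e - 1) = p * k := by omega
    have c7 : p ∣ e - 1 := (Nat.dvd_add_right (dvd_mul_right p l)).1 (c6 ▸ dvd_mul_right p k)
    have := Nat.le_of_dvd (by omega) c7
    omega
  obtain ⟨ξ, hξ⟩ := hQ.nonempty_fixed_point_of_prime_not_dvd_card X hX
  refine ⟨ξ.1, ξ.2, fun σ t => ?_⟩
  have e := hξ σ⁻¹
  have e := congrArg (fun x : X => x.1 t) e
  change ξ.1 (A σ⁻¹⁻¹ t) = ξ.1 t at e
  rwa [inv_inv] at e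

section final
variable {F : Type} [Field F] [Fintype F]

/-- the p-part -/
def QQ (p : ℕ) (F : Type) [Field F] (hcomm : ∀ σ τ : RingAut F, σ * τ = τ * σ) : Subgroup (RingAut F) where
  carrier := {σ | ∃ k : ℕ, σ ^ p ^ k = 1}
  one_mem' := ⟨0, one_pow _⟩
  mul_mem' := by
    rintro σ τ ⟨k, hk⟩ ⟨l, hl⟩
    refine ⟨k + l, ?_⟩
    rw [Commute.mul_pow (hcomm σ τ), pow_add, pow_mul, hk, one_pow, mul_comm, pow_mul, hl, one_pow, one_mul]
  inv_mem' := by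
    rintro σ ⟨k, hk⟩
    exact ⟨k, by rw [inv_pow, hk, inv_one]⟩

/-- action on the torus -/
def twT [Fintype (SL F)] [Fintype (Bor F)] {d : F} (Q : Subgroup (RingAut F)) (hQ : ∀ σ ∈ Q, σ d = d) : Q →* MulAut (Tor d) where
  toFun σ :=
    { toFun := fun t => ⟨twist 1 σ.1 t.1, twist_Tor (hQ _ σ.2) t.2⟩
      invFun := fun t => ⟨twist 1 (σ⁻¹).1 t.1, twist_Tor (hQ _ (σ⁻¹).2) t.2⟩
      left_inv := by
        intro t
        apply Subtype.ext
        apply ext4 <;> simp only [twist_00, twist_01, twist_10, twist_11] <;> simp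
      right_inv := by
        intro t
        apply Subtype.ext
        apply ext4 <;> simp only [twist_00, twist_01, twist_10, twist_11] <;> simp
      map_mul' := by
        intro a b
        apply Subtype.ext
        exact map_mul (twist 1 σ.1) a.1 b.1 }
  map_one' := by
    ext t : 1
    apply Subtype.ext
    change twist 1 (1 : RingAut F) t.1 = t.1
    apply ext4 <;> simp only [twist_00, twist_01, twist_10, twist_11] <;> simp
  map_mul' := by
    intro σ τ
    ext t : 1
    apply Subtype.ext
    change twist 1 (σ.1 * τ.1) t.1 = twist 1 σ.1 (twist 1 τ.1 t.1)
    apply ext4 <;> simp only [twist_00, twist_01, twist_10, twist_11] <;> simp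

theorem chi2 {p a : ℕ} [Fact p.Prime] (hp5 : 5 < p) (ha : 1 ≤ a) (hF : Nat.card F = p ^ a)
    (h2 : (2 : F) ≠ 0) (hcomm : ∀ σ τ : RingAut F, σ * τ = τ * σ) :
    ∃ χ : FDRep ℂ (PS F), Simple χ ∧ Module.finrank ℂ χ = p ^ a - 1 ∧
      ∀ φ : MulAut (PS F), (∃ k : ℕ, orderOf φ = p ^ k) →
        ∀ s, χ.character (φ s) = χ.character s := by
  classical
  have hp : p.Prime := Fact.out
  have := Fintype.ofFinite (SL F)
  have := Fintype.ofFinite (Bor F)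
  have hfinA : Finite (RingAut F) := Finite.of_injective (fun σ : RingAut F => (σ : F → F)) DFunLike.coe_injective
  let Q := QQ p F hcomm
  have hQp : IsPGroup p Q := by
    rintro ⟨σ, k, hk⟩
    exact ⟨k, Subtype.ext (by simpa using hk)⟩
  have := Fintype.ofFinite Q
  have hchar : ringChar F ≠ 2 := by
    intro h
    apply h2
    have := CharP.cast_eq_zero F (ringChar F)
    rw [h] at this
    exact_mod_cast this
  obtain ⟨d₀, hd₀⟩ := FiniteField.exists_nonsquare hchar
  let d : F := ∏ σ : Q, σ.1 d₀
  have hQd : ∀ σ ∈ Q, σ d = d := by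
    intro σ hσ
    simp only [d, map_prod]
    exact Fintype.prod_equiv (Equiv.mulLeft (⟨σ, hσ⟩ : Q)) _ _ (fun τ => rfl)
  have hd : ¬ IsSquare d := by
    rw [← quadraticChar_neg_one_iff_not_isSquare]
    simp only [d, map_prod]
    have e : ∀ σ : Q, quadraticChar F (σ.1 d₀) = -1 := by
      intro σ
      rw [quadraticChar_neg_one_iff_not_isSquare]
      rintro ⟨r, hr⟩
      apply hd₀
      refine ⟨σ.1.symm r, ?_⟩
      rw [← map_mul, ← hr]
      exact (σ.1.symm_apply_apply d₀).symm
    rw [Finset.prod_congr rfl fun σ _ => e σ, Finset.prod_const, Finset.card_univ]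
    obtain ⟨n, hn⟩ := IsPGroup.iff_card.1 hQp
    rw [← Nat.card_eq_fintype_card, hn]
    exact Odd.neg_one_pow ((hp.odd_of_ne_two (by omega)).pow)
  have hd0 : d ≠ 0 := by intro h; rw [h] at hd; exact hd ⟨0, by simp⟩
  have := Fintype.ofFinite (Tor d)
  have := Tor_cyclic d hd
  obtain ⟨ξ, hξ4, hξ⟩ := exists_fixed hp5 hQp (twT Q hQd) (mone d)
    (fun h => neg_one_ne h2 (congrArg Subtype.val h).symm)
    (by apply Subtype.ext; change (-1 : SL F) ^ 2 = 1; simp) (p ^ (a - 1)) (by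
      rw [card_Tor d hd h2, hF, ← pow_succ', Nat.sub_add_cancel ha])
  have hm2 : mone d ^ 2 = 1 := by apply Subtype.ext; change (-1 : SL F) ^ 2 = 1; simp
  obtain ⟨U, hU, hUd, hUc⟩ := chi2_exists h2 hd (ξ ^ 2) (by
    rw [MonoidHom.pow_apply, ← map_pow, hm2, map_one]) (by
    rw [← pow_mul]; exact hξ4)
  refine ⟨U, hU, ?_, ?_⟩
  · rw [hUd, ← hF, Nat.card_eq_fintype_card]
  · rintro φ ⟨k, hk⟩ s
    obtain ⟨g, rfl⟩ := mkS_surj s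
    obtain ⟨s, c, σ, hφ⟩ := aut_form ha hF h2 φ
    have hσ : σ ∈ Q := ⟨k, order_sigma h2 φ s c σ hφ (p ^ k) (by rw [← hk, pow_orderOf_eq_one])⟩
    obtain ⟨y, rfl⟩ := mkS_surj s
    rw [hφ, ← map_inv, ← map_mul, ← map_mul, hUc, hUc, ff_conj, indChar_conj, ff_twist,
      I_twist h2 hd0 (ξ ^ 2) c σ (hQd _ hσ)]
    intro t
    rw [MonoidHom.pow_apply, MonoidHom.pow_apply]
    congr 1
    exact hξ ⟨σ, hσ⟩ t

end final
end Stmt12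

namespace Stmt12

/-- ring automorphisms are algebra automorphisms -/
noncomputable def toAlg (p a : ℕ) [Fact p.Prime] (σ : RingAut (GaloisField p a)) :
    GaloisField p a ≃ₐ[ZMod p] GaloisField p a :=
  AlgEquiv.ofRingEquiv (f := σ) (fun r => by
    exact RingHom.congr_fun (Subsingleton.elim ((σ : GaloisField p a →+* GaloisField p a).comp
      (algebraMap (ZMod p) (GaloisField p a))) (algebraMap (ZMod p) (GaloisField p a))) r)

theorem ringAut_comm (p a : ℕ) [Fact p.Prime] (σ τ : RingAut (GaloisField p a)) : σ * τ = τ * σ := by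
  have : IsCyclic (GaloisField p a ≃ₐ[ZMod p] GaloisField p a) := inferInstance
  have h := IsCyclic.commGroup (α := GaloisField p a ≃ₐ[ZMod p] GaloisField p a) |>.mul_comm
    (toAlg p a σ) (toAlg p a τ)
  ext x
  exact DFunLike.congr_fun h x

theorem exists_theta (p a : ℕ) [Fact p.Prime] (hp5 : 5 < p) (ha : 1 ≤ a) :
    ∃ θ : (GaloisField p a)ˣ →* ℂˣ, (∀ (σ : GaloisField p a ≃+* GaloisField p a) c,
      θ (Units.map (σ : GaloisField p a →* GaloisField p a) c) = θ c) ∧ ∃ t, θ t ^ 4 ≠ 1 := by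
  have hp : p.Prime := Fact.out
  obtain ⟨g, hg⟩ := IsCyclic.exists_generator (α := (ZMod p)ˣ)
  have hord : orderOf g = p - 1 := by
    rw [orderOf_eq_card_of_forall_mem_zpowers hg, Nat.card_eq_fintype_card, ZMod.card_units]
  have hg4 : g ^ 4 ≠ 1 := by
    intro h
    have := orderOf_le_of_pow_eq_one (by norm_num) h
    omega
  obtain ⟨l, hl⟩ := CommGroup.exists_apply_ne_one_of_hasEnoughRootsOfUnity (ZMod p)ˣ ℂ hg4
  refine ⟨l.comp (Units.map (Algebra.norm (ZMod p) : GaloisField p a →* ZMod p)), ?_, ?_⟩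
  · intro σ c
    simp only [MonoidHom.comp_apply]
    congr 1
    ext
    exact Algebra.norm_eq_of_algEquiv (toAlg p a σ) (c : GaloisField p a)
  · obtain ⟨t, ht⟩ := FiniteField.unitsMap_norm_surjective (ZMod p) (GaloisField p a) g
    refine ⟨t, ?_⟩
    rw [MonoidHom.comp_apply, ht, ← map_pow]
    exact hl

end Stmt12

theorem stmt12 (p : ℕ) [Fact p.Prime] (hp5 : 5 < p) (a : ℕ) (ha : 1 ≤ a) :
    ∃ χ₁ χ₂ : FDRep ℂ (PSL 2 p a), Simple χ₁ ∧ Simple χ₂ ∧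
      Module.finrank ℂ χ₁ = p ^ a + 1 ∧ Module.finrank ℂ χ₂ = p ^ a - 1 ∧
      ¬ p ∣ Module.finrank ℂ χ₁ ∧ ¬ p ∣ Module.finrank ℂ χ₂ ∧
      (∃ A : FDRep ℂ (MulAut (PSL 2 p a)), ∀ s : PSL 2 p a,
        A.character (MulAut.conj s) = χ₁.character s) ∧
      (∀ φ : MulAut (PSL 2 p a), (∃ k : ℕ, orderOf φ = p ^ k) →
        ∀ s : PSL 2 p a, χ₂.character (φ s) = χ₂.character s) := by
  have hp : p.Prime := Fact.out
  have hF : Nat.card (GaloisField p a) = p ^ a := GaloisField.card p a (by omega)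
  have := Fintype.ofFinite (GaloisField p a)
  have h2 : (2 : GaloisField p a) ≠ 0 := by
    have h := (CharP.cast_eq_zero_iff (GaloisField p a) p 2).not.2 (fun h => by
      have := Nat.le_of_dvd (by norm_num) h
      omega)
    exact_mod_cast h
  obtain ⟨θ, hθ, h4⟩ := Stmt12.exists_theta p a hp5 ha
  obtain ⟨A, χ₁, s1, d1, e1⟩ := Stmt12.chi1 (F := GaloisField p a) ha hF h2 θ hθ h4
  obtain ⟨χ₂, s2, d2, e2⟩ := Stmt12.chi2 (F := GaloisField p a) hp5 ha hF h2 (Stmt12.ringAut_comm p a)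
  have hpd : p ∣ p ^ a := dvd_pow_self p (by omega)
  have hpos : 1 ≤ p ^ a := Nat.one_le_pow _ _ hp.pos
  refine ⟨χ₁, χ₂, s1, s2, d1, d2, ?_, ?_, ⟨A, e1⟩, e2⟩
  · rw [d1]
    intro h
    have := (Nat.dvd_add_right hpd).1 h
    exact hp.one_lt.ne' (Nat.dvd_one.1 this)
  · rw [d2]
    intro h
    have : p ∣ (p ^ a - 1) + 1 := by rwa [Nat.sub_add_cancel hpos]
    have := (Nat.dvd_add_right h).1 this
    exact hp.one_lt.ne' (Nat.dvd_one.1 this)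
end
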